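/- Let n ∈ ℤ, n ≥ 2, let S ⊆ 𝕋 be a finite set, and let (t_i)_{i∈ℕ} be a sequence of positive real numbers. Then the intersection of the set {s ∈ ℝ : the closure of 𝒪^ℕ_{T_n}([s]) in 𝕋 is disjoint from S} with ⋂_m D̃(T_m) (the intersection taken over all natural numbers m ≥ 2 that are multiplicatively independent from n) and with ⋂_i {s ∈ ℝ : the closure of {g_{t_i}ᵏ·h₂(s) : k ∈ ℕ} equals X₂} has Hausdorff dimension 1. -/

import Mathlib

open MeasureTheory Matrix Filter Set
open scoped ENNReal

noncomputable section

/-- Topology on special linear groups (induced from the matrix topology). -/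
instance (n : Type*) [DecidableEq n] [Fintype n] (R : Type*) [CommRing R] [TopologicalSpace R] :
    TopologicalSpace (Matrix.SpecialLinearGroup n R) :=
  TopologicalSpace.induced (fun A => (A : Matrix n n R)) inferInstance

abbrev SL2R := Matrix.SpecialLinearGroup (Fin 2) ℝ
abbrev SL2Z := Matrix.SpecialLinearGroup (Fin 2) ℤ

/-- The image of `SL₂(ℤ)` in `SL₂(ℝ)`. -/
def SL2Zsub : Subgroup SL2R :=
  MonoidHom.range (Matrix.SpecialLinearGroup.map (n := Fin 2) (Int.castRingHom ℝ))

/-- The space of unimodular lattices `X₂ = SL₂(ℝ)/SL₂(ℤ)`. -/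
abbrev X2 := SL2R ⧸ SL2Zsub

/-- `h₂(s)` is the class of the matrix `[[1, s], [0, 1]]` in `X₂`. -/
def h2 (s : ℝ) : X2 :=
  QuotientGroup.mk ⟨!![(1:ℝ), s; 0, 1], by simp [Matrix.det_fin_two_of]⟩

/-- The diagonal matrix `diag(e^t, e^{-t}) ∈ SL₂(ℝ)`. -/
def g2 (t : ℝ) : SL2R :=
  ⟨!![Real.exp t, 0; 0, Real.exp (-t)], by
    simp [Matrix.det_fin_two_of, ← Real.exp_add]⟩

/-- The circle `𝕋 = ℝ/ℤ`. -/
abbrev Circ := UnitAddCircle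

/-- `n` and `m` are multiplicatively independent: there are no integers `p, q ≥ 1`
with `n^p = m^q`. -/
def MultIndep (n : ℤ) (m : ℕ) : Prop :=
  ¬ ∃ p q : ℕ, 1 ≤ p ∧ 1 ≤ q ∧ n ^ p = (m : ℤ) ^ q

/-- Multiples by powers of `b` of finite subset sums, as points of the circle. -/
def powSums (b : ℕ) (φ : ℝ) (k : ℕ) : Set Circ :=
  {x | ∃ I : Finset ℕ, (∀ i ∈ I, k ≤ i) ∧ x = (((∑ i ∈ I, (b : ℝ) ^ i) * φ : ℝ) : Circ)}

theorem powSums_add {b : ℕ} {φ : ℝ} {x y : Circ}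
    (hx : x ∈ ⋂ k, closure (powSums b φ k)) (hy : y ∈ ⋂ k, closure (powSums b φ k)) :
    x + y ∈ ⋂ k, closure (powSums b φ k) := by
  rw [mem_iInter] at *
  intro k
  rw [Metric.mem_closure_iff]
  intro ε hε
  obtain ⟨x', ⟨I, hI, rfl⟩, hx'⟩ := Metric.mem_closure_iff.1 (hx k) (ε / 2) (by positivity)
  obtain ⟨y', ⟨J, hJ, rfl⟩, hy'⟩ :=
    Metric.mem_closure_iff.1 (hy (I.sup id + 1 + k)) (ε / 2) (by positivity)
  have hdisj : Disjoint I J := by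
    rw [Finset.disjoint_left]
    intro i hi hj
    have := hJ i hj
    have h2 : i ≤ I.sup id := Finset.le_sup (f := id) hi
    omega
  refine ⟨_, ⟨I ∪ J, ?_, rfl⟩, ?_⟩
  · intro i hi
    rcases Finset.mem_union.1 hi with h | h
    · exact hI i h
    · have := hJ i h
      omega
  · rw [Finset.sum_union hdisj, add_mul, AddCircle.coe_add]
    calc _ ≤ _ := dist_add_add_le _ _ _ _
      _ < ε / 2 + ε / 2 := add_lt_add hx' hy'
      _ = ε := by ring

theorem isClosed_add_mem_neg {T : Set Circ} (hT : IsClosed T) (h0 : (0 : Circ) ∈ T)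
    (hadd : ∀ x ∈ T, ∀ y ∈ T, x + y ∈ T) {x : Circ} (hx : x ∈ T) : -x ∈ T := by
  have hn : ∀ n : ℕ, n • x ∈ T := by
    intro n
    induction n with
    | zero => simpa using h0
    | succ n ih => rw [succ_nsmul]; exact hadd _ ih _ hx
  rw [← hT.closure_eq, Metric.mem_closure_iff]
  intro ε hε
  obtain ⟨N, hN⟩ := exists_nat_gt (1 / ε)
  have hN0 : 0 < N := by
    have : (0 : ℝ) < N := lt_trans (by positivity) hN
    exact_mod_cast this
  obtain ⟨j, hj, hj2⟩ := AddCircle.exists_norm_nsmul_le (T := (1 : ℝ)) x hN0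
  refine ⟨(j - 1) • x, hn _, ?_⟩
  have : (j - 1) • x = j • x - x := by
    have h1 : 1 ≤ j := hj.1
    obtain ⟨i, rfl⟩ := Nat.exists_eq_add_of_le h1
    rw [add_tsub_cancel_left, add_smul, one_smul]; abel
  rw [this, dist_eq_norm]
  have e : -x - (j • x - x) = -(j • x) := by abel
  rw [e, norm_neg]
  refine lt_of_le_of_lt hj2 ?_
  rw [div_lt_iff₀ (by positivity)]
  rw [div_lt_iff₀ hε] at hN
  push_cast
  nlinarith

theorem norm_nsmul_of_norm_le {b : ℕ} (hb : 0 < b) {y : Circ} (hy : ‖y‖ ≤ 1 / (2 * b)) :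
    ‖b • y‖ = b * ‖y‖ := by
  obtain ⟨x, rfl, hx⟩ : ∃ x : ℝ, (x : Circ) = y ∧ |x| = ‖y‖ := by
    induction y using QuotientAddGroup.induction_on with
    | H z =>
      refine ⟨z - round z, ?_, ?_⟩
      · have : ((round z : ℝ) : Circ) = 0 := by
          rw [AddCircle.coe_eq_zero_iff]; exact ⟨round z, by simp⟩
        rw [AddCircle.coe_sub, this, sub_zero]
      · exact (UnitAddCircle.norm_eq).symm
  have hb' : (0 : ℝ) < b := by exact_mod_cast hb
  rw [← hx] at hy ⊢
  have : b • (x : Circ) = ((b * x : ℝ) : Circ) := by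
    rw [← nsmul_eq_mul]; rfl
  rw [this, (AddCircle.norm_coe_eq_abs_iff 1 one_ne_zero).2, abs_mul, abs_of_pos hb']
  rw [abs_mul, abs_of_pos hb']
  rw [le_div_iff₀ (by positivity)] at hy
  simp
  linarith

theorem eq_zero_of_norm_pow_nsmul_le {b : ℕ} (hb : 2 ≤ b) {y : Circ}
    (hy : ∀ i : ℕ, ‖b ^ i • y‖ ≤ 1 / (2 * b)) : y = 0 := by
  have h : ∀ i : ℕ, ‖b ^ i • y‖ = b ^ i * ‖y‖ := by
    intro i
    induction i with
    | zero => simp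
    | succ i ih =>
      rw [pow_succ', mul_smul, norm_nsmul_of_norm_le (by omega) (hy i), ih]; ring
  by_contra h0
  have hpos : 0 < ‖y‖ := norm_pos_iff.2 h0
  have hb1 : (1 : ℝ) < b := by exact_mod_cast (by omega : 1 < b)
  obtain ⟨i, hi⟩ := pow_unbounded_of_one_lt (1 / ‖y‖) hb1
  have h1 := h i ▸ hy i
  rw [div_lt_iff₀ hpos] at hi
  have : (1 : ℝ) / (2 * b) < 1 := by rw [div_lt_one (by positivity)]; linarith
  linarith

theorem dense_powSums {b : ℕ} (hb : 2 ≤ b) {φ : ℝ} (hφ : Irrational φ) :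
    Dense (powSums b φ 0) := by
  set T : Set Circ := ⋂ k, closure (powSums b φ k) with hTdef
  have hTc : IsClosed T := isClosed_iInter fun k => isClosed_closure
  have h0 : (0 : Circ) ∈ T := mem_iInter.2 fun k => subset_closure ⟨∅, by simp, by simp⟩
  have hadd : ∀ x ∈ T, ∀ y ∈ T, x + y ∈ T := fun x hx y hy => powSums_add hx hy
  let G : AddSubgroup Circ :=
    { carrier := T
      zero_mem' := h0
      add_mem' := fun hx hy => hadd _ hx _ hy
      neg_mem' := fun hx => isClosed_add_mem_neg hTc h0 hadd hx }
  have hG : Dense (G : Set Circ) := by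
    rw [AddCircle.dense_addSubgroup_iff_ne_zmultiples]
    intro a ha hGa
    set q := addOrderOf a with hq
    have hqT : ∀ x ∈ T, q • x = 0 := by
      intro x hx
      have : x ∈ G := hx
      rw [hGa, AddSubgroup.mem_zmultiples_iff] at this
      obtain ⟨k, rfl⟩ := this
      rw [smul_comm, hq, addOrderOf_nsmul_eq_zero, smul_zero]
    have hb' : (0 : ℝ) < b := by exact_mod_cast (by omega : 0 < b)
    have hev : ∀ᶠ i : ℕ in atTop, ‖q • (((b : ℝ) ^ i * φ : ℝ) : Circ)‖ < 1 / (2 * b) := by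
      by_contra hcon
      rw [not_eventually] at hcon
      have : ((atTop : Filter ℕ) ⊓ 𝓟 {i : ℕ | ¬ ‖q • (((b : ℝ) ^ i * φ : ℝ) : Circ)‖ < 1 / (2 * b)}).NeBot :=
        frequently_mem_iff_neBot.1 hcon
      obtain ⟨U, hU⟩ := Ultrafilter.exists_le
        (atTop ⊓ 𝓟 {i : ℕ | ¬ ‖q • (((b : ℝ) ^ i * φ : ℝ) : Circ)‖ < 1 / (2 * b)})
      obtain ⟨z, -, hz⟩ := isCompact_univ.ultrafilter_le_nhds
        (U.map fun i : ℕ => (((b : ℝ) ^ i * φ : ℝ) : Circ)) (by simp)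
      have hz' : Tendsto (fun i : ℕ => (((b : ℝ) ^ i * φ : ℝ) : Circ)) U (nhds z) := hz
      have hzT : z ∈ T := by
        refine mem_iInter.2 fun k => mem_closure_of_tendsto hz' ?_
        have : ∀ᶠ i : ℕ in atTop, k ≤ i := eventually_ge_atTop k
        filter_upwards [hU (mem_inf_of_left this)] with i hi
        exact ⟨{i}, by simpa using hi, by simp⟩
      have h1 : Tendsto (fun i : ℕ => ‖q • (((b : ℝ) ^ i * φ : ℝ) : Circ)‖) U
          (nhds ‖q • z‖) := (hz'.const_smul q).norm
      rw [hqT z hzT, norm_zero] at h1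
      have h2 : ∀ᶠ i in (U : Filter ℕ), ‖q • (((b : ℝ) ^ i * φ : ℝ) : Circ)‖ < 1 / (2 * b) :=
        h1.eventually_lt_const (by positivity)
      obtain ⟨i, hi1, hi2⟩ := (h2.and (hU (mem_inf_of_right (mem_principal_self _)))).exists
      exact hi2 hi1
    obtain ⟨i0, hi0⟩ := eventually_atTop.1 hev
    have hzero : q • (((b : ℝ) ^ i0 * φ : ℝ) : Circ) = 0 := by
      apply eq_zero_of_norm_pow_nsmul_le hb
      intro i
      have := (hi0 (i0 + i) (by omega)).le
      have e : b ^ i • q • (((b : ℝ) ^ i0 * φ : ℝ) : Circ)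
          = q • (((b : ℝ) ^ (i0 + i) * φ : ℝ) : Circ) := by
        rw [smul_comm, pow_add]
        congr 1
        rw [← AddCircle.coe_nsmul, nsmul_eq_mul]
        congr 1
        push_cast; ring
      rw [e]; exact this
    rw [← AddCircle.coe_nsmul, AddCircle.coe_eq_zero_iff] at hzero
    obtain ⟨k, hk⟩ := hzero
    have hi : Irrational ((q * b ^ i0 : ℕ) * φ) := by
      apply hφ.natCast_mul
      positivity
    apply hi
    refine ⟨k, ?_⟩
    simp at hk ⊢
    rw [hk]; ring
  refine hG.mono ?_ |>.of_closure
  exact iInter_subset _ 0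

/-- Finite sums of distinct powers of `b`, times an irrational number, are dense modulo one. -/
theorem exists_sum_pow_mul_near {b : ℕ} (hb : 2 ≤ b) {φ : ℝ} (hφ : Irrational φ) (c : ℝ) {ε : ℝ}
    (hε : 0 < ε) :
    ∃ (I : Finset ℕ) (n : ℤ), |(∑ i ∈ I, (b : ℝ) ^ i) * φ - c - n| < ε := by
  obtain ⟨y, ⟨I, -, rfl⟩, hy⟩ := Metric.mem_closure_iff.1 (dense_powSums hb hφ (c : Circ)) ε hε
  refine ⟨I, round ((∑ i ∈ I, (b : ℝ) ^ i) * φ - c), ?_⟩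
  rw [dist_comm, dist_eq_norm, ← AddCircle.coe_sub, UnitAddCircle.norm_eq] at hy
  exact hy

theorem exists_finset_near_of_dense {ι : Type*} (f : ι → ℝ)
    (hd : DenseRange fun i => (f i : Circ)) {ε : ℝ} (hε : 0 < ε) :
    ∃ F : Finset ι, ∀ c : ℝ, ∃ i ∈ F, ∃ n : ℤ, |f i - c - n| < ε := by
  obtain ⟨F, hF⟩ := isCompact_univ.elim_finite_subcover
    (fun i => Metric.ball (f i : Circ) ε) (fun i => Metric.isOpen_ball) (by
      intro y _
      obtain ⟨_, ⟨i, rfl⟩, hi⟩ := Metric.mem_closure_iff.1 (hd y) ε hε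
      exact mem_iUnion.2 ⟨i, hi⟩)
  refine ⟨F, fun c => ?_⟩
  obtain ⟨i, hi, hci⟩ := mem_iUnion₂.1 (hF (mem_univ (c : Circ)))
  refine ⟨i, hi, round (f i - c), ?_⟩
  rw [Metric.mem_ball, dist_comm, dist_eq_norm, ← AddCircle.coe_sub, UnitAddCircle.norm_eq] at hci
  exact hci

/-- The half-line version of Kronecker's theorem, with bounded gaps. -/
theorem exists_bounded_gap_near {α : ℝ} (hα : Irrational α) (hα0 : 0 < α) (τ : ℝ) (R : ℕ) {δ : ℝ}
    (hδ : 0 < δ) :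
    ∃ G : ℕ, ∀ N : ℕ, ∃ k M : ℕ, N + R < M ∧ M ≤ N + G ∧ |k * α - M - τ| < δ := by
  have hd : DenseRange fun k : ℤ => ((k * α : ℝ) : Circ) := by
    have := (AddCircle.denseRange_zsmul_coe_iff (a := α) (p := 1)).2 (by simpa using hα)
    convert this using 2 with k
    rw [← AddCircle.coe_zsmul, zsmul_eq_mul]
  obtain ⟨F, hF⟩ := exists_finset_near_of_dense _ hd hδ
  set K : ℕ := F.sup Int.natAbs
  have hK : ∀ k ∈ F, |(k : ℝ)| ≤ K := by
    intro k hk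
    have : k.natAbs ≤ K := Finset.le_sup (f := Int.natAbs) hk
    have h2 : |k| ≤ (K : ℤ) := by rw [Int.abs_eq_natAbs]; exact_mod_cast this
    exact_mod_cast h2
  obtain ⟨G, hG⟩ := exists_nat_gt (R + 1 + |τ| + δ + α + 2 * K * α + |τ| + δ)
  refine ⟨G, fun N => ?_⟩
  set A : ℝ := (N + R + 1 + |τ| + δ) / α
  have hA0 : 0 ≤ A := by positivity
  have hAα : A * α = N + R + 1 + |τ| + δ := div_mul_cancel₀ _ hα0.ne'
  set k1 : ℕ := ⌈A⌉₊
  have hk1 : A ≤ k1 := Nat.le_ceil _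
  have hk1' : (k1 : ℝ) < A + 1 := Nat.ceil_lt_add_one hA0
  obtain ⟨k', hk', n, hn⟩ := hF (τ - (k1 + K) * α)
  have hb := abs_le.1 (hK k' hk')
  have hτ := abs_le.1 (le_refl |τ|)
  have hn' := abs_lt.1 hn
  have h1 : A * α ≤ k1 * α := by gcongr
  have h1' : k1 * α < (A + 1) * α := by gcongr
  have h2 : (-K : ℝ) * α ≤ k' * α := by gcongr; exact hb.1
  have h2' : (k' : ℝ) * α ≤ K * α := by gcongr; exact hb.2
  have hnlow : (N + R : ℝ) < n := by nlinarith
  have hnup : (n : ℝ) < N + G := by nlinarith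
  have hn0 : 0 ≤ n := by
    have : (0 : ℝ) < n := lt_of_le_of_lt (by positivity) hnlow
    exact_mod_cast this.le
  obtain ⟨M, rfl⟩ := Int.eq_ofNat_of_zero_le hn0
  have hk0 : 0 ≤ (k1 : ℤ) + K + k' := by
    have : (0 : ℝ) ≤ k1 + K + k' := by
      have : (0 : ℝ) ≤ k1 := by positivity
      linarith [hb.1]
    exact_mod_cast this
  obtain ⟨k, hk⟩ := Int.eq_ofNat_of_zero_le hk0
  refine ⟨k, M, ?_, ?_, ?_⟩
  · exact_mod_cast hnlow
  · have : (M : ℝ) < N + G := by exact_mod_cast hnup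
    exact_mod_cast this.le
  · have : (k : ℝ) = k1 + K + k' := by exact_mod_cast hk.symm
    rw [this]
    convert hn using 2
    push_cast
    ring

theorem irrational_log_div_log {m b : ℕ} (hm : 2 ≤ m) (hb : 2 ≤ b)
    (h : ∀ p q : ℕ, 1 ≤ p → 1 ≤ q → b ^ p ≠ m ^ q) :
    Irrational (Real.log m / Real.log b) := by
  rintro ⟨r, hr⟩
  have hlm : 0 < Real.log m := Real.log_pos (by exact_mod_cast (by omega : 1 < m))
  have hlb : 0 < Real.log b := Real.log_pos (by exact_mod_cast (by omega : 1 < b))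
  have hr0 : (0 : ℝ) < r := by rw [hr]; positivity
  have hr0' : 0 < r := by exact_mod_cast hr0
  have hnum : 0 < r.num := Rat.num_pos.2 hr0'
  obtain ⟨p, hp⟩ := Int.eq_ofNat_of_zero_le hnum.le
  have hp' : (r.num : ℝ) = p := by rw [hp]; simp
  have h1 : (r : ℝ) = p / r.den := by rw [← hp', Rat.cast_def]
  rw [h1, div_eq_div_iff (by have := r.den_pos; positivity) hlb.ne'] at hr
  have h2 : Real.log ((b : ℝ) ^ p) = Real.log ((m : ℝ) ^ r.den) := by
    rw [Real.log_pow, Real.log_pow, hr, mul_comm]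
  have h3 : (b : ℝ) ^ p = (m : ℝ) ^ r.den :=
    Real.log_injOn_pos (by simp; positivity) (by simp; positivity) h2
  exact h p r.den (by omega) r.den_pos (by exact_mod_cast h3)

theorem exists_bounded_gap_pow_div_pow {m b : ℕ} (hm : 2 ≤ m) (hb : 2 ≤ b)
    (h : ∀ p q : ℕ, 1 ≤ p → 1 ≤ q → b ^ p ≠ m ^ q) {σ : ℝ} (hσ : 0 < σ) (R : ℕ) {η : ℝ}
    (hη : 0 < η) :
    ∃ G : ℕ, ∀ N : ℕ, ∃ k M : ℕ, N + R < M ∧ M ≤ N + G ∧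
      |(m : ℝ) ^ k / (b : ℝ) ^ M - σ| < η := by
  have hlm : 0 < Real.log m := Real.log_pos (by exact_mod_cast (by omega : 1 < m))
  have hlb : 0 < Real.log b := Real.log_pos (by exact_mod_cast (by omega : 1 < b))
  have hb0 : (0 : ℝ) < b := by positivity
  have hm0 : (0 : ℝ) < m := by positivity
  have hcont : Tendsto (fun u : ℝ => (b : ℝ) ^ u) (nhds (Real.log σ / Real.log b)) (nhds σ) := by
    have : (b : ℝ) ^ (Real.log σ / Real.log b) = σ := by
      rw [Real.rpow_def_of_pos hb0, mul_div_cancel₀ _ hlb.ne', Real.exp_log hσ]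
    conv => rhs; rw [← this]
    exact (Real.continuous_const_rpow hb0.ne').continuousAt
  obtain ⟨δ, hδ, hδ'⟩ := Metric.tendsto_nhds_nhds.1 hcont η hη
  obtain ⟨G, hG⟩ := exists_bounded_gap_near (irrational_log_div_log hm hb h) (by positivity)
    (Real.log σ / Real.log b) R hδ
  refine ⟨G, fun N => ?_⟩
  obtain ⟨k, M, h1, h2, h3⟩ := hG N
  refine ⟨k, M, h1, h2, ?_⟩
  have := hδ' (x := k * (Real.log m / Real.log b) - M) (by rwa [Real.dist_eq])
  rw [Real.dist_eq] at this
  convert this using 3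
  rw [Real.rpow_sub hb0, Real.rpow_natCast]
  congr 1
  rw [Real.rpow_def_of_pos hb0, ← Real.exp_log (pow_pos hm0 k), Real.log_pow]
  congr 1
  field_simp

/-- `X = (a + d₀ ∑_{i=1}^L b^{-i} + ∑_{i ∈ I} b^{-i}) / b^N`. -/
def startPoint (b d0 L N a : ℕ) (I : Finset ℕ) : ℝ :=
  (a + d0 * ∑ i ∈ Finset.Icc 1 L, ((b : ℝ) ^ i)⁻¹ + ∑ i ∈ I, ((b : ℝ) ^ i)⁻¹) / (b : ℝ) ^ N

/-- A set of reals which can be entered, from every initial word `a / b ^ N` satisfying `P`, by appending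
a bounded number of digits `d0` and `d0 + 1`. -/
def IsEvent (b d0 : ℕ) (P : ℕ → ℕ → Prop) (V : Set ℝ) : Prop :=
  ∃ L : ℕ, ∀ N a : ℕ, P N a → ∃ I ⊆ Finset.Icc 1 L, ∀ x : ℝ,
    startPoint b d0 L N a I ≤ x → x ≤ startPoint b d0 L N a I + ((b : ℝ) ^ (N + L))⁻¹ → x ∈ V

theorem isEvent_iterate_mem {m b d0 : ℕ} (hm : 2 ≤ m) (hb : 2 ≤ b)
    (h : ∀ p q : ℕ, 1 ≤ p → 1 ≤ q → b ^ p ≠ m ^ q) (P : ℕ → ℕ → Prop) {V : Set Circ}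
    (hV : IsOpen V) (hVne : V.Nonempty) :
    IsEvent b d0 P {x : ℝ | ∃ k : ℕ, (((m : ℝ) ^ k * x : ℝ) : Circ) ∈ V} := by
  obtain ⟨y, hy⟩ := hVne
  obtain ⟨y0, rfl⟩ := QuotientAddGroup.mk_surjective y
  obtain ⟨ε, hε, hεV⟩ := Metric.isOpen_iff.1 hV _ hy
  have hb0 : (0 : ℝ) < b := by positivity
  have hb1 : (1 : ℝ) < b := by exact_mod_cast (by omega : 1 < b)
  obtain ⟨σ, hσ, hσ1, hσb⟩ := exists_irrational_btwn hb1
  have hd : DenseRange fun I : Finset ℕ => (((∑ i ∈ I, (b : ℝ) ^ i) * σ : ℝ) : Circ) := by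
    refine (dense_powSums hb hσ).mono ?_
    rintro _ ⟨I, -, rfl⟩
    exact ⟨I, rfl⟩
  obtain ⟨F, hF⟩ := exists_finset_near_of_dense _ hd (ε := ε / 4) (by positivity)
  set R : ℕ := F.sup (fun I => I.sup id) + 1
  have hR : ∀ I ∈ F, ∀ i ∈ I, i < R := by
    intro I hI i hi
    have h1 : i ≤ I.sup id := Finset.le_sup (f := id) hi
    have h2 : I.sup id ≤ F.sup (fun I => I.sup id) := Finset.le_sup (f := fun I => I.sup id) hI
    omega
  set W : ℝ := ∑ i ∈ Finset.range R, (b : ℝ) ^ i with hW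
  have hW0 : 0 ≤ W := by positivity
  have hWI : ∀ I ∈ F, ∑ i ∈ I, (b : ℝ) ^ i ≤ W := by
    intro I hI
    refine Finset.sum_le_sum_of_subset_of_nonneg (fun i hi => Finset.mem_range.2 (hR I hI i hi)) ?_
    intros; positivity
  obtain ⟨G, hG⟩ := exists_bounded_gap_pow_div_pow hm hb h (zero_lt_one.trans hσ1) R
    (η := min 1 (ε / (4 * (W + 1)))) (by positivity)
  obtain ⟨L0, hL0⟩ := pow_unbounded_of_one_lt ((σ + 1) / (ε / 4)) hb1
  refine ⟨G + L0, fun N a _ => ?_⟩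
  obtain ⟨k, M, hM1, hM2, hkM⟩ := hG N
  set L := G + L0
  set D : ℝ := d0 * ∑ i ∈ Finset.Icc 1 L, ((b : ℝ) ^ i)⁻¹
  obtain ⟨I0, hI0, n, hn⟩ := hF (y0 - (m : ℝ) ^ k * ((a + D) / (b : ℝ) ^ N))
  refine ⟨I0.image (fun r => M - N - r), ?_, ?_⟩
  · intro i hi
    obtain ⟨r, hr, rfl⟩ := Finset.mem_image.1 hi
    have := hR I0 hI0 r hr
    rw [Finset.mem_Icc]
    omega
  have hsum : ∑ i ∈ I0.image (fun r => M - N - r), ((b : ℝ) ^ i)⁻¹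
      = (∑ i ∈ I0, (b : ℝ) ^ i) * (b : ℝ) ^ N / (b : ℝ) ^ M := by
    rw [Finset.sum_image, Finset.sum_mul, Finset.sum_div]
    · refine Finset.sum_congr rfl fun r hr => ?_
      have := hR I0 hI0 r hr
      rw [eq_div_iff (by positivity), inv_mul_eq_iff_eq_mul₀ (by positivity), ← pow_add, ← pow_add]
      congr 1
      omega
    · intro r hr r' hr' hrr
      have := hR I0 hI0 r hr
      have := hR I0 hI0 r' hr'
      simp only at hrr
      omega
  have hX : startPoint b d0 L N a (I0.image (fun r => M - N - r))
      = (a + D) / (b : ℝ) ^ N + (∑ i ∈ I0, (b : ℝ) ^ i) / (b : ℝ) ^ M := by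
    rw [startPoint, hsum, add_div _ ((∑ i ∈ I0, (b : ℝ) ^ i) * (b : ℝ) ^ N / (b : ℝ) ^ M)]
    congr 1
    field_simp
  intro x hx1 hx2
  refine ⟨k, hεV ?_⟩
  rw [Metric.mem_ball]
  set w := ∑ i ∈ I0, (b : ℝ) ^ i
  set ρ := (m : ℝ) ^ k / (b : ℝ) ^ M
  have hρ1 : |ρ - σ| < 1 := lt_of_lt_of_le hkM (min_le_left _ _)
  have hρ2 : |ρ - σ| * (W + 1) < ε / 4 := by
    have := lt_of_lt_of_le hkM (min_le_right _ _)
    rw [lt_div_iff₀ (by positivity)] at this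
    linarith
  have hw0 : 0 ≤ w := Finset.sum_nonneg fun i _ => by positivity
  have hwW : w ≤ W := hWI I0 hI0
  have e1 : |(ρ - σ) * w| < ε / 4 := by
    rw [abs_mul, abs_of_nonneg hw0]
    nlinarith [abs_nonneg (ρ - σ)]
  rw [hX] at hx1 hx2
  set X := (a + D) / (b : ℝ) ^ N + w / (b : ℝ) ^ M
  have hmk : (m : ℝ) ^ k = ρ * (b : ℝ) ^ M := (div_mul_cancel₀ _ (by positivity)).symm
  have e2 : (m : ℝ) ^ k * (x - X) ≤ ε / 4 := by
    have h1 : (m : ℝ) ^ k * (x - X) ≤ (m : ℝ) ^ k * ((b : ℝ) ^ (N + L))⁻¹ := by gcongr; linarith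
    have h2 : (m : ℝ) ^ k * ((b : ℝ) ^ (N + L))⁻¹ ≤ (σ + 1) * ((b : ℝ) ^ L0)⁻¹ := by
      rw [hmk, mul_assoc]
      have h3 : ρ ≤ σ + 1 := by linarith [(abs_lt.1 hρ1).2]
      have h4 : (b : ℝ) ^ M * ((b : ℝ) ^ (N + L))⁻¹ ≤ ((b : ℝ) ^ L0)⁻¹ := by
        rw [← div_eq_mul_inv, div_le_iff₀ (by positivity), inv_mul_eq_div,
          le_div_iff₀ (by positivity), ← pow_add]
        exact pow_le_pow_right₀ hb1.le (by omega)
      have h5 : 0 ≤ (b : ℝ) ^ M * ((b : ℝ) ^ (N + L))⁻¹ := by positivity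
      have : 0 ≤ σ + 1 := by linarith
      gcongr
    have h3 : (σ + 1) * ((b : ℝ) ^ L0)⁻¹ ≤ ε / 4 := by
      rw [← div_eq_mul_inv, div_le_iff₀ (by positivity)]
      rw [div_lt_iff₀ (by positivity)] at hL0
      linarith
    linarith
  have e3 : 0 ≤ (m : ℝ) ^ k * (x - X) := mul_nonneg (by positivity) (by linarith)
  have e4 : (m : ℝ) ^ k * X = (m : ℝ) ^ k * ((a + D) / (b : ℝ) ^ N) + ρ * w := by
    simp only [X, ρ]; ring
  have key : |(m : ℝ) ^ k * x - y0 - n| < ε := by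
    have : (m : ℝ) ^ k * x - y0 - n = (w * σ - (y0 - (m : ℝ) ^ k * ((a + D) / (b : ℝ) ^ N)) - n)
        + (ρ - σ) * w + (m : ℝ) ^ k * (x - X) := by
      rw [mul_sub, e4]; ring
    rw [this]
    have a1 := abs_lt.1 hn
    have a2 := abs_lt.1 e1
    rw [abs_lt]
    constructor <;> linarith
  have hz : (((m : ℝ) ^ k * x : ℝ) : Circ) - (y0 : Circ) = (((m : ℝ) ^ k * x - y0 - n : ℝ) : Circ) := by
    rw [AddCircle.coe_sub, AddCircle.coe_sub]
    have : ((n : ℝ) : Circ) = 0 := by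
      rw [AddCircle.coe_eq_zero_iff]; exact ⟨n, by simp⟩
    rw [this, sub_zero]
  have h6 : dist (((m : ℝ) ^ k * x : ℝ) : Circ) (y0 : Circ) < ε := by
    rw [dist_eq_norm, hz]
    exact lt_of_le_of_lt (QuotientAddGroup.norm_mk_le_norm) key
  exact h6

/-- The integer with base-`b` digits produced by the digit rule `dig`, which at level `j` reads the
letter `ω (idx j)`. -/
def digitNode {M : ℕ} (b : ℕ) (dig : ℕ → ℕ → Fin M → ℕ) (idx : ℕ → ℕ) (ω : ℕ → Fin M) : ℕ → ℕ
  | 0 => 0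
  | j + 1 => b * digitNode b dig idx ω j + dig j (digitNode b dig idx ω j) (ω (idx j))

theorem exists_limit_of_digits {b : ℕ} (hb : 0 < b) (a : ℕ → ℕ)
    (ha : ∀ j, b * a j ≤ a (j + 1) ∧ a (j + 1) + 1 ≤ b * a j + b) :
    ∃ x : ℝ, ∀ j, (a j : ℝ) / (b : ℝ) ^ j ≤ x ∧ x ≤ (a j + 1) / (b : ℝ) ^ j := by
  have hb0 : (0 : ℝ) < b := by exact_mod_cast hb
  have hanti : Antitone fun j => Icc ((a j : ℝ) / (b : ℝ) ^ j) ((a j + 1) / (b : ℝ) ^ j) := by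
    refine antitone_nat_of_succ_le fun j => ?_
    obtain ⟨h1, h2⟩ := ha j
    have h1' : (b : ℝ) * a j ≤ a (j + 1) := by exact_mod_cast h1
    have h2' : (a (j + 1) : ℝ) + 1 ≤ b * a j + b := by exact_mod_cast h2
    apply Icc_subset_Icc
    · rw [div_le_div_iff₀ (by positivity) (by positivity), pow_succ]
      have : 0 < (b : ℝ) ^ j := by positivity
      nlinarith
    · rw [div_le_div_iff₀ (by positivity) (by positivity), pow_succ]
      have : 0 < (b : ℝ) ^ j := by positivity
      nlinarith
  have hne : ∀ j, (a j : ℝ) / (b : ℝ) ^ j ≤ (a j + 1) / (b : ℝ) ^ j := by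
    intro j; gcongr; linarith
  exact ⟨_, fun j => mem_iInter.1 (ciSup_mem_iInter_Icc_of_antitone_Icc hanti hne) j⟩

theorem le_dimH_of_digitNode {M b : ℕ} (hb : 2 ≤ b) (hM : 1 < M) (dig : ℕ → ℕ → Fin M → ℕ)
    (free : ℕ → Prop) [DecidablePred free] (hinf : {j | free j}.Infinite)
    (hinj : ∀ j a, free j → Function.Injective (dig j a))
    (heven : ∀ j a u, free j → Even (dig j a u))
    (hforced : ∀ j a u u', ¬ free j → dig j a u = dig j a u')
    {α α' η : ℝ} (hα : 0 < α) (hα' : 0 ≤ α') (hηα : α ≤ α' * (1 - η))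
    (hcount : ∀ j : ℕ, (1 - η) * j ≤ Nat.count free j) (hMb : (b : ℝ) ^ α' ≤ M)
    (x : (ℕ → Fin M) → ℝ)
    (hx : ∀ ω j, (digitNode b dig (Nat.count free) ω j : ℝ) / (b : ℝ) ^ j ≤ x ω ∧
      x ω ≤ (digitNode b dig (Nat.count free) ω j + 1) / (b : ℝ) ^ j) :
    ENNReal.ofReal α ≤ dimH (range x) := by
  have hb0 : (0 : ℝ) < b := by positivity
  have hb1 : (1 : ℝ) < b := by exact_mod_cast (by omega : 1 < b)
  have hM0 : (0 : ℝ) < M := by positivity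
  -- first difference
  have key : ∀ ω ω', ω ≠ ω' → ∃ j : ℕ, (∀ i < Nat.count free j, ω i = ω' i) ∧
      ((b : ℝ) ^ (j + 1))⁻¹ ≤ |x ω - x ω'| := by
    intro ω ω' hne
    set A := digitNode b dig (Nat.count free) ω with hA
    set A' := digitNode b dig (Nat.count free) ω' with hA'
    have hstep : ∀ j, free j → A j = A' j → A (j + 1) = A' (j + 1) →
        ω (Nat.count free j) = ω' (Nat.count free j) := by
      intro j hj h1 h2
      apply hinj j (A j) hj
      have e1 : A (j + 1) = b * A j + dig j (A j) (ω (Nat.count free j)) := rfl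
      have e2 : A' (j + 1) = b * A' j + dig j (A' j) (ω' (Nat.count free j)) := rfl
      rw [e1, e2, ← h1] at h2
      omega
    have hex : ∃ j, A (j + 1) ≠ A' (j + 1) := by
      by_contra hcon
      push Not at hcon
      have hall : ∀ j, A j = A' j := fun j => by
        cases j with
        | zero => rfl
        | succ j => exact hcon j
      apply hne
      funext t
      have h1 := Nat.count_nth_of_infinite (p := free) hinf t
      have h2 := Nat.nth_mem_of_infinite (p := free) hinf t
      have := hstep _ h2 (hall _) (hall _)
      rwa [h1] at this
    classical
    obtain ⟨j, hj, hmin⟩ : ∃ j, A (j + 1) ≠ A' (j + 1) ∧ ∀ i ≤ j, A i = A' i := by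
      refine ⟨Nat.find hex, Nat.find_spec hex, fun i hi => ?_⟩
      cases i with
      | zero => rfl
      | succ i => exact not_not.1 (Nat.find_min hex (by omega))
    have hjfree : free j := by
      by_contra hnf
      apply hj
      have e1 : A (j + 1) = b * A j + dig j (A j) (ω (Nat.count free j)) := rfl
      have e2 : A' (j + 1) = b * A' j + dig j (A' j) (ω' (Nat.count free j)) := rfl
      rw [e1, e2, hmin j le_rfl, hforced j _ _ _ hnf]
    refine ⟨j, ?_, ?_⟩
    · intro i hi
      have h1 := Nat.count_nth_of_infinite (p := free) hinf i
      have h2 := Nat.nth_mem_of_infinite (p := free) hinf i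
      have h3 : Nat.nth free i < j := Nat.nth_lt_of_lt_count hi
      have := hstep _ h2 (hmin _ h3.le) (hmin _ h3)
      rwa [h1] at this
    · have e1 : A (j + 1) = b * A j + dig j (A j) (ω (Nat.count free j)) := rfl
      have e2 : A' (j + 1) = b * A' j + dig j (A' j) (ω' (Nat.count free j)) := rfl
      obtain ⟨c, hc⟩ := heven j (A j) (ω (Nat.count free j)) hjfree
      obtain ⟨c', hc'⟩ := heven j (A' j) (ω' (Nat.count free j)) hjfree
      have hgap : A (j + 1) + 2 ≤ A' (j + 1) ∨ A' (j + 1) + 2 ≤ A (j + 1) := by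
        rw [e1, e2, hmin j le_rfl] at hj ⊢
        rw [hmin j le_rfl] at hc
        omega
      have hP : 0 < (b : ℝ) ^ (j + 1) := by positivity
      have hx1 := hx ω (j + 1)
      have hx2 := hx ω' (j + 1)
      rw [← hA] at hx1
      rw [← hA'] at hx2
      rw [div_le_iff₀ hP, le_div_iff₀ hP] at hx1 hx2
      have hgoal : 1 ≤ |x ω - x ω'| * (b : ℝ) ^ (j + 1) := by
        rcases hgap with h | h
        · have h' : (A (j + 1) : ℝ) + 2 ≤ A' (j + 1) := by exact_mod_cast h
          have := neg_le_abs (x ω - x ω')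
          nlinarith
        · have h' : (A' (j + 1) : ℝ) + 2 ≤ A (j + 1) := by exact_mod_cast h
          have := le_abs_self (x ω - x ω')
          nlinarith
      rwa [inv_le_iff_one_le_mul₀ hP]
  have hxinj : Function.Injective x := by
    intro ω ω' h
    by_contra hne
    obtain ⟨j, -, hj⟩ := key ω ω' hne
    rw [h, sub_self, abs_zero] at hj
    have : 0 < ((b : ℝ) ^ (j + 1))⁻¹ := by positivity
    linarith
  have : Nonempty (ℕ → Fin M) := ⟨fun _ => ⟨0, by omega⟩⟩
  set f : ℝ → ℝ := fun y => Real.ofDigits (Function.invFun x y) with hf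
  have hfx : ∀ ω, f (x ω) = Real.ofDigits ω := fun ω => by
    rw [hf]; simp only [Function.leftInverse_invFun hxinj ω]
  have hα0 : (0 : ℝ) ≤ α := hα.le
  have hhol : HolderOnWith (Real.toNNReal ((b : ℝ) ^ α)) (Real.toNNReal α) f (range x) := by
    rintro _ ⟨ω, rfl⟩ _ ⟨ω', rfl⟩
    by_cases hne : ω = ω'
    · subst hne; simp
    obtain ⟨j, h1, h2⟩ := key ω ω' hne
    rw [hfx, hfx, edist_dist, edist_dist, Real.dist_eq, Real.dist_eq, Real.coe_toNNReal _ hα0]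
    rw [ENNReal.ofReal_rpow_of_nonneg (abs_nonneg _) hα0]
    change _ ≤ ENNReal.ofReal ((b : ℝ) ^ α) * _
    rw [← ENNReal.ofReal_mul (by positivity)]
    apply ENNReal.ofReal_le_ofReal
    calc _ ≤ ((M : ℝ) ^ Nat.count free j)⁻¹ := Real.abs_ofDigits_sub_ofDigits_le h1
      _ ≤ ((b : ℝ) ^ (α * j))⁻¹ := by
        apply inv_anti₀ (by positivity)
        calc (b : ℝ) ^ (α * j) ≤ (b : ℝ) ^ (α' * Nat.count free j) := by
              apply Real.rpow_le_rpow_of_exponent_le hb1.le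
              calc α * j ≤ α' * (1 - η) * j := by gcongr
                _ = α' * ((1 - η) * j) := by ring
                _ ≤ _ := by gcongr; exact hcount j
          _ = ((b : ℝ) ^ α') ^ Nat.count free j := by
              rw [Real.rpow_mul hb0.le, Real.rpow_natCast]
          _ ≤ _ := by gcongr
      _ = (b : ℝ) ^ α * (((b : ℝ) ^ (j + 1))⁻¹) ^ α := by
        rw [Real.inv_rpow (by positivity), ← Real.rpow_natCast, ← Real.rpow_mul hb0.le,
          ← Real.rpow_neg hb0.le, ← Real.rpow_neg hb0.le, ← Real.rpow_add hb0]
        congr 1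
        push_cast
        ring
      _ ≤ _ := by gcongr
  have h1 := hhol.dimH_image_le (Real.toNNReal_pos.2 hα)
  have h2 : Icc (0 : ℝ) 1 ⊆ f '' range x := by
    intro y hy
    obtain ⟨ω, -, rfl⟩ := Real.ofDigits_SurjOn hM hy
    exact ⟨x ω, ⟨ω, rfl⟩, hfx ω⟩
  have h3 : dimH (Icc (0 : ℝ) 1) = 1 := by
    have := Real.dimH_of_nonempty_interior (E := ℝ) (s := Icc 0 1) (by simp)
    simpa using this
  have h4 : 1 ≤ dimH (range x) / (Real.toNNReal α : ℝ≥0∞) := by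
    rw [← h3]; exact (dimH_mono h2).trans h1
  have h5 := (ENNReal.le_div_iff_mul_le (Or.inl (by simpa using hα)) (Or.inl ENNReal.coe_ne_top)).1 h4
  rw [one_mul] at h5
  exact h5

/-- The lattice attached to the initial word `a / b ^ N`, where `b = β ^ 2`, has no short vectors. -/
def ThickNode (β N a : ℕ) : Prop :=
  ∀ p q : ℤ, ¬(p = 0 ∧ q = 0) →
    1 / (2 * (β : ℝ) ^ 3) ≤
      max |(β : ℝ) ^ N * (p + a / ((β : ℝ) ^ 2) ^ N * q)| (|(q : ℝ)| / (β : ℝ) ^ N)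

/-- No rational of small denominator lies near the `b`-adic interval of the level `j + 1` node
`a`. -/
def FarFromRationals (b j a : ℕ) : Prop :=
  ∀ p q : ℤ, 1 ≤ q → 4 * q ^ 2 ≤ (b : ℤ) ^ j →
    ¬(((a : ℤ) - 1) * q < p * (b : ℤ) ^ (j + 1) ∧ p * (b : ℤ) ^ (j + 1) < ((a : ℤ) + 2) * q)

theorem not_farFromRationals_near {b j a c c' : ℕ} (hb : 2 ≤ b) (hc : c < b) (hc' : c' < b)
    (h : ¬ FarFromRationals b j (b * a + c)) (h' : ¬ FarFromRationals b j (b * a + c')) :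
    c ≤ c' + 2 := by
  unfold FarFromRationals at h h'
  push Not at h h'
  obtain ⟨p, q, hq, hqb, h1, h2⟩ := h
  obtain ⟨p', q', hq', hqb', h1', h2'⟩ := h'
  push_cast at h1 h2 h1' h2'
  set B : ℤ := (b : ℤ) ^ j with hB
  have hB0 : 0 < B := by positivity
  have hbZ : (2 : ℤ) ≤ b := by exact_mod_cast hb
  have hcZ : (c : ℤ) < b := by exact_mod_cast hc
  have hcZ' : (c' : ℤ) < b := by exact_mod_cast hc'
  have hc0 : (0 : ℤ) ≤ c := by positivity
  have hc0' : (0 : ℤ) ≤ c' := by positivity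
  rw [pow_succ, ← hB] at h1 h2 h1' h2'
  have hqq : 4 * (q * q') ≤ B := by nlinarith [sq_nonneg (q - q')]
  have hqq0 : 0 < q * q' := by positivity
  have k1 := mul_lt_mul_of_pos_right h1 (by omega : 0 < q')
  have k2 := mul_lt_mul_of_pos_right h2 (by omega : 0 < q')
  have k1' := mul_lt_mul_of_pos_right h1' (by omega : 0 < q)
  have k2' := mul_lt_mul_of_pos_right h2' (by omega : 0 < q)
  have hBb : 0 < B * b := by positivity
  have hfin : ((b : ℤ) + 2) * (q * q') ≤ B * b := by
    have h5 : ((b : ℤ) + 2) * (4 * (q * q')) ≤ (b + 2) * B := by gcongr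
    have h6 : ((b : ℤ) + 2) * B ≤ (2 * b) * B := by gcongr; omega
    nlinarith
  rcases lt_trichotomy (p * q') (p' * q) with hlt | heq | hgt
  · exfalso
    have e0 := le_mul_of_one_le_left hBb.le (by omega : 1 ≤ p' * q - p * q')
    have e1 : B * b < ((c' : ℤ) - c + 3) * (q * q') := by linarith
    have e2 : ((c' : ℤ) - c + 3) * (q * q') ≤ (b + 2) * (q * q') :=
      mul_le_mul_of_nonneg_right (by omega) hqq0.le
    linarith
  · have e1 : ((b : ℤ) * a + c - 1) * (q * q') < ((b : ℤ) * a + c' + 2) * (q * q') := by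
      have : p * q' * (B * b) = p' * q * (B * b) := by rw [heq]
      linarith
    have := lt_of_mul_lt_mul_right e1 hqq0.le
    omega
  · exfalso
    have e0 := le_mul_of_one_le_left hBb.le (by omega : 1 ≤ p * q' - p' * q)
    have e1 : B * b < ((c : ℤ) - c' + 3) * (q * q') := by linarith
    have e2 : ((c : ℤ) - c' + 3) * (q * q') ≤ (b + 2) * (q * q') :=
      mul_le_mul_of_nonneg_right (by omega) hqq0.le
    linarith

theorem exists_free_digits {b M : ℕ} (hb : 2 ≤ b) (Dg : Finset ℕ) (hD : ∀ d ∈ Dg, d < b)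
    (hM : M + 3 ≤ (Dg.filter Even).card) (j a : ℕ) :
    ∃ f : Fin M → ℕ, Function.Injective f ∧
      ∀ u, f u ∈ Dg ∧ Even (f u) ∧ FarFromRationals b j (b * a + f u) := by
  classical
  set G := (Dg.filter Even).filter fun c => FarFromRationals b j (b * a + c) with hG
  set B := (Dg.filter Even).filter fun c => ¬ FarFromRationals b j (b * a + c) with hB
  have hcard : G.card + B.card = (Dg.filter Even).card := Finset.card_filter_add_card_filter_not _
  have hBcard : B.card ≤ 3 := by
    rcases B.eq_empty_or_nonempty with h | h
    · simp [h]
    have hmem := Finset.min'_mem B h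
    have : B ⊆ Finset.Icc (B.min' h) (B.min' h + 2) := by
      intro c hc
      rw [Finset.mem_Icc]
      refine ⟨Finset.min'_le _ _ hc, ?_⟩
      simp only [hB, Finset.mem_filter] at hc
      have hmem := (Finset.mem_filter.1 hmem)
      rw [Finset.mem_filter] at hmem
      exact not_farFromRationals_near hb (hD _ hc.1.1) (hD _ hmem.1.1) hc.2 hmem.2
    have := Finset.card_le_card this
    rw [Nat.card_Icc] at this
    omega
  have hGM : M ≤ G.card := by omega
  refine ⟨fun u => G.orderEmbOfFin rfl (Fin.castLE hGM u), ?_, fun u => ?_⟩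
  · exact (G.orderEmbOfFin rfl).injective.comp (Fin.castLE_injective hGM)
  · have := Finset.orderEmbOfFin_mem G rfl (Fin.castLE hGM u)
    have := Finset.mem_filter.1 this
    rw [Finset.mem_filter] at this
    exact ⟨this.1.1, this.1.2, this.2⟩

theorem digit_chain_bounds {b : ℕ} (a : ℕ → ℕ)
    (ha : ∀ j, b * a j ≤ a (j + 1) ∧ a (j + 1) + 1 ≤ b * a j + b) (m i : ℕ) :
    a m * b ^ i ≤ a (m + i) ∧ a (m + i) + 1 ≤ (a m + 1) * b ^ i := by
  induction i with
  | zero => simp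
  | succ i ih =>
    obtain ⟨h1, h2⟩ := ha (m + i)
    rw [← add_assoc, pow_succ]
    constructor
    · calc a m * (b ^ i * b) = b * (a m * b ^ i) := by ring
        _ ≤ b * a (m + i) := by gcongr; exact ih.1
        _ ≤ _ := h1
    · calc _ ≤ b * (a (m + i) + 1) := by rw [mul_add, mul_one]; exact h2
        _ ≤ b * ((a m + 1) * b ^ i) := by gcongr; exact ih.2
        _ = _ := by ring

theorem thickNode_of_farFromRationals {β b : ℕ} (hβ : 2 ≤ β) (hbβ : b = β ^ 2) (a : ℕ → ℕ)
    (ha : ∀ j, b * a j ≤ a (j + 1) ∧ a (j + 1) + 1 ≤ b * a j + b) {M0 N : ℕ}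
    (hN : 2 * M0 + 2 ≤ N) (hfar : ∀ j, M0 ≤ j → j < N → FarFromRationals b j (a (j + 1))) :
    ThickNode β N (a N) := by
  have hβ0 : (0 : ℝ) < β := by positivity
  have hβ1 : (1 : ℝ) ≤ β := by exact_mod_cast (by omega : 1 ≤ β)
  have hsmall : 1 / (2 * (β : ℝ) ^ 3) ≤ 1 := by
    rw [div_le_one (by positivity)]
    have : (1 : ℝ) ≤ β ^ 3 := one_le_pow₀ hβ1
    linarith
  have hpos : ∀ p q : ℤ, 1 ≤ q → 1 / (2 * (β : ℝ) ^ 3) ≤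
      max |(β : ℝ) ^ N * (p + a N / ((β : ℝ) ^ 2) ^ N * q)| (|(q : ℝ)| / (β : ℝ) ^ N) := by
    intro p q hq
    by_cases hlarge : 1 / (2 * (β : ℝ) ^ 3) ≤ |(q : ℝ)| / (β : ℝ) ^ N
    · exact le_max_of_le_right hlarge
    apply le_max_of_le_left
    have hq0 : (0 : ℝ) < q := by exact_mod_cast hq
    have hq1 : (1 : ℝ) ≤ q := by exact_mod_cast hq
    rw [not_le, abs_of_pos hq0, div_lt_div_iff₀ (by positivity) (by positivity), one_mul] at hlarge
    have hlargeZ : q * (2 * (β : ℤ) ^ 3) < (β : ℤ) ^ N := by exact_mod_cast hlarge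
    have hex : ∃ j, M0 ≤ j ∧ 4 * q ^ 2 ≤ (b : ℤ) ^ j := by
      refine ⟨N - 1, by omega, ?_⟩
      have hβZ : (1 : ℤ) ≤ β := by exact_mod_cast (by omega : 1 ≤ β)
      have h1 : 2 * q * (β : ℤ) ^ 1 ≤ (β : ℤ) ^ N := by
        have : (β : ℤ) ^ 1 ≤ (β : ℤ) ^ 3 := pow_le_pow_right₀ hβZ (by norm_num)
        nlinarith
      have h2 : 2 * q ≤ (β : ℤ) ^ (N - 1) := by
        have : (β : ℤ) ^ N = (β : ℤ) ^ (N - 1) * (β : ℤ) ^ 1 := by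
          rw [← pow_add]; congr 1; omega
        rw [this] at h1
        exact le_of_mul_le_mul_right h1 (by positivity)
      rw [hbβ]
      push_cast
      rw [← pow_mul, mul_comm 2, pow_mul]
      calc 4 * q ^ 2 = (2 * q) ^ 2 := by ring
        _ ≤ _ := by gcongr
    classical
    obtain ⟨hj1, hj2⟩ := Nat.find_spec hex
    have hmin := fun i (hi : i < Nat.find hex) => Nat.find_min hex hi
    set j := Nat.find hex with hj
    have hjN : j < N := by
      by_contra hcon
      have := hmin (N - 1) (by omega)
      apply this
      refine ⟨by omega, ?_⟩
      have hβZ : (1 : ℤ) ≤ β := by exact_mod_cast (by omega : 1 ≤ β)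
      have h1 : 2 * q * (β : ℤ) ^ 1 ≤ (β : ℤ) ^ N := by
        have : (β : ℤ) ^ 1 ≤ (β : ℤ) ^ 3 := pow_le_pow_right₀ hβZ (by norm_num)
        nlinarith
      have h2 : 2 * q ≤ (β : ℤ) ^ (N - 1) := by
        have : (β : ℤ) ^ N = (β : ℤ) ^ (N - 1) * (β : ℤ) ^ 1 := by
          rw [← pow_add]; congr 1; omega
        rw [this] at h1
        exact le_of_mul_le_mul_right h1 (by positivity)
      rw [hbβ]
      push_cast
      rw [← pow_mul, mul_comm 2, pow_mul]
      calc 4 * q ^ 2 = (2 * q) ^ 2 := by ring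
        _ ≤ _ := by gcongr
    have hf := hfar j hj1 hjN (-p) q hq hj2
    set A := a (j + 1) with hA
    have hchain := digit_chain_bounds a ha (j + 1) (N - (j + 1))
    rw [Nat.add_sub_cancel' (by omega : j + 1 ≤ N), ← hA] at hchain
    have hb0 : (0 : ℝ) < b := by rw [hbβ]; push_cast; positivity
    have hbN : (b : ℝ) ^ N = (b : ℝ) ^ (N - (j + 1)) * (b : ℝ) ^ (j + 1) := by
      rw [← pow_add]; congr 1; omega
    have hlo : (A : ℝ) / (b : ℝ) ^ (j + 1) ≤ a N / (b : ℝ) ^ N := by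
      rw [div_le_div_iff₀ (by positivity) (by positivity), hbN, ← mul_assoc]
      gcongr
      exact_mod_cast hchain.1
    have hhi : (a N : ℝ) / (b : ℝ) ^ N ≤ (A + 1) / (b : ℝ) ^ (j + 1) := by
      rw [div_le_div_iff₀ (by positivity) (by positivity), hbN, ← mul_assoc]
      gcongr
      have : a N ≤ (A + 1) * b ^ (N - (j + 1)) := by omega
      exact_mod_cast this
    have hbβ' : ((β : ℝ) ^ 2) = b := by rw [hbβ]; push_cast; rfl
    have hdist : q / (b : ℝ) ^ (j + 1) ≤ |p + a N / (b : ℝ) ^ N * q| := by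
      have hcases : -p * (b : ℤ) ^ (j + 1) ≤ ((A : ℤ) - 1) * q ∨
          ((A : ℤ) + 2) * q ≤ -p * (b : ℤ) ^ (j + 1) := by
        by_contra hcon
        push Not at hcon
        exact hf hcon
      rcases hcases with h | h
      · have h' : -(p : ℝ) * (b : ℝ) ^ (j + 1) ≤ ((A : ℝ) - 1) * q := by exact_mod_cast h
        refine le_trans ?_ (le_abs_self _)
        have h2 : (A : ℝ) / (b : ℝ) ^ (j + 1) * q ≤ a N / (b : ℝ) ^ N * q := by gcongr
        have h3 : q / (b : ℝ) ^ (j + 1) ≤ p + (A : ℝ) / (b : ℝ) ^ (j + 1) * q := by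
          rw [div_mul_eq_mul_div, ← sub_le_iff_le_add, ← sub_div, div_le_iff₀ (by positivity)]
          linarith
        linarith
      · have h' : ((A : ℝ) + 2) * q ≤ -(p : ℝ) * (b : ℝ) ^ (j + 1) := by exact_mod_cast h
        refine le_trans ?_ (neg_le_abs _)
        have h2 : (a N : ℝ) / (b : ℝ) ^ N * q ≤ (A + 1) / (b : ℝ) ^ (j + 1) * q := by gcongr
        have h3 : q / (b : ℝ) ^ (j + 1) + ((A : ℝ) + 1) / (b : ℝ) ^ (j + 1) * q ≤ -p := by
          rw [div_mul_eq_mul_div, ← add_div, div_le_iff₀ (by positivity)]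
          linarith
        linarith
    rw [hbβ', abs_mul, abs_of_pos (by positivity : (0 : ℝ) < (β : ℝ) ^ N)]
    refine le_trans ?_ (mul_le_mul_of_nonneg_left hdist (by positivity))
    rw [← hbβ', ← pow_mul, ← mul_div_assoc, div_le_div_iff₀ (by positivity) (by positivity), one_mul]
    have hgoal : (β : ℝ) ^ (2 * (j + 1)) ≤ 2 * q * (β : ℝ) ^ (N + 3) := by
      rcases Nat.eq_or_lt_of_le hj1 with h | h
      · calc (β : ℝ) ^ (2 * (j + 1)) ≤ (β : ℝ) ^ (N + 3) := pow_le_pow_right₀ hβ1 (by omega)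
          _ ≤ _ := by
            have : 0 < (β : ℝ) ^ (N + 3) := by positivity
            nlinarith
      · have h1 := hmin (j - 1) (by omega)
        have h2 : (b : ℤ) ^ (j - 1) < 4 * q ^ 2 := by
          by_contra hcon
          exact h1 ⟨by omega, not_lt.1 hcon⟩
        have h3 : ((β : ℤ) ^ (j - 1)) ^ 2 < (2 * q) ^ 2 := by
          rw [← pow_mul, mul_comm, pow_mul]
          rw [hbβ] at h2
          push_cast at h2
          linarith
        have h4 : (β : ℤ) ^ (j - 1) < 2 * q := lt_of_pow_lt_pow_left₀ 2 (by positivity) h3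
        have h5 : (β : ℝ) ^ (j - 1) < 2 * q := by exact_mod_cast h4
        calc (β : ℝ) ^ (2 * (j + 1)) ≤ (β : ℝ) ^ (j - 1 + (N + 3)) :=
              pow_le_pow_right₀ hβ1 (by omega)
          _ = (β : ℝ) ^ (j - 1) * (β : ℝ) ^ (N + 3) := pow_add _ _ _
          _ ≤ _ := by gcongr
    calc (β : ℝ) ^ (2 * (j + 1)) ≤ 2 * q * (β : ℝ) ^ (N + 3) := hgoal
      _ = _ := by rw [pow_add]; ring
  intro p q hpq
  rcases lt_trichotomy q 0 with hq | hq | hq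
  · have := hpos (-p) (-q) (by omega)
    push_cast at this
    rw [abs_neg] at this
    convert this using 2
    rw [← abs_neg]
    congr 1
    ring
  · subst hq
    have hp : p ≠ 0 := fun h => hpq ⟨h, rfl⟩
    apply le_max_of_le_left
    have h1 : (1 : ℝ) ≤ |(p : ℝ)| := by exact_mod_cast Int.one_le_abs hp
    have h2 : (1 : ℝ) ≤ β ^ N := one_le_pow₀ hβ1
    simp only [Int.cast_zero, mul_zero, add_zero, abs_mul]
    rw [abs_of_pos (by positivity : (0 : ℝ) < (β : ℝ) ^ N)]
    nlinarith
  · exact hpos p q hq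

/-- Window lengths `L r` can be placed at positions `N r` so sparsely that their union has upper
density at most `η`. -/
theorem exists_sparse_windows (L : ℕ → ℕ) {η : ℝ} (hη : 0 < η) :
    ∃ N : ℕ → ℕ, 2 ≤ N 0 ∧ (∀ r, 2 * (N r + L r) + 2 ≤ N (r + 1)) ∧
      ∀ r, (∑ i ∈ Finset.range (r + 1), (L i : ℝ)) ≤ η * N r := by
  set Q : ℕ → ℕ := fun r => ⌈(∑ i ∈ Finset.range (r + 1), (L i : ℝ)) / η⌉₊ with hQ
  have hQ' : ∀ r n, Q r ≤ n → (∑ i ∈ Finset.range (r + 1), (L i : ℝ)) ≤ η * n := by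
    intro r n h
    have h1 : (∑ i ∈ Finset.range (r + 1), (L i : ℝ)) / η ≤ n := Nat.ceil_le.1 h
    rwa [div_le_iff₀ hη, mul_comm] at h1
  let N : ℕ → ℕ := fun r => Nat.rec (2 + Q 0) (fun r N => 2 * (N + L r) + 2 + Q (r + 1)) r
  have hN : ∀ r, N (r + 1) = 2 * (N r + L r) + 2 + Q (r + 1) := fun r => rfl
  have hN0 : N 0 = 2 + Q 0 := rfl
  refine ⟨N, by omega, fun r => by rw [hN]; omega, fun r => hQ' _ _ ?_⟩
  cases r with
  | zero => omega
  | succ r => rw [hN]; omega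

theorem count_free_of_sparse {L N : ℕ → ℕ} {η : ℝ} (hη : 0 < η)
    (hstep : ∀ r, 2 * (N r + L r) + 2 ≤ N (r + 1))
    (hsum : ∀ r, (∑ i ∈ Finset.range (r + 1), (L i : ℝ)) ≤ η * N r)
    (free : ℕ → Prop) [DecidablePred free]
    (hfree : ∀ j, free j ↔ ¬ ∃ r, N r ≤ j ∧ j < N r + L r) (j : ℕ) :
    (1 - η) * j ≤ Nat.count free j := by
  classical
  have hmono : StrictMono N := strictMono_nat_of_lt_succ fun r => by
    have := hstep r; omega
  have hc : Nat.count free j + ((Finset.range j).filter fun i => ¬ free i).card = j := by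
    rw [Nat.count_eq_card_filter_range, Finset.card_filter_add_card_filter_not, Finset.card_range]
  have hforced : (((Finset.range j).filter fun i => ¬ free i).card : ℝ) ≤ η * j := by
    by_cases hex : N 0 < j
    · set R := Nat.findGreatest (fun r => N r < j) j with hR
      have hR1 : N R < j := Nat.findGreatest_spec (P := fun r => N r < j) (Nat.zero_le _) hex
      have hR2 : ∀ r, N r < j → r ≤ R := fun r hr =>
        Nat.le_findGreatest ((hmono.le_apply (x := r)).trans hr.le) hr
      have hsub : ((Finset.range j).filter fun i => ¬ free i) ⊆
          (Finset.range (R + 1)).biUnion fun r => Finset.Ico (N r) (N r + L r) := by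
        intro i hi
        rw [Finset.mem_filter, hfree, not_not, Finset.mem_range] at hi
        obtain ⟨hij, r, h1, h2⟩ := hi
        rw [Finset.mem_biUnion]
        have := hR2 r (by omega)
        exact ⟨r, Finset.mem_range.2 (by omega), Finset.mem_Ico.2 ⟨h1, h2⟩⟩
      have h1 := (Finset.card_le_card hsub).trans Finset.card_biUnion_le
      simp only [Nat.card_Ico, Nat.add_sub_cancel_left] at h1
      have h2 : (((Finset.range j).filter fun i => ¬ free i).card : ℝ) ≤
          ∑ i ∈ Finset.range (R + 1), (L i : ℝ) := by exact_mod_cast h1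
      have h3 : (N R : ℝ) ≤ j := by exact_mod_cast hR1.le
      have := hsum R
      nlinarith
    · have : ((Finset.range j).filter fun i => ¬ free i) = ∅ := by
        rw [Finset.filter_eq_empty_iff]
        intro i hi
        rw [Finset.mem_range] at hi
        rw [not_not, hfree]
        rintro ⟨r, h1, -⟩
        have := hmono.monotone (Nat.zero_le r)
        omega
      rw [this]
      simp
      positivity
  have hc' : (Nat.count free j : ℝ) + (((Finset.range j).filter fun i => ¬ free i).card : ℝ) = j := by
    exact_mod_cast hc
  linarith

theorem le_dimH_of_isEvent {β b d0 M : ℕ} (hβ : 2 ≤ β) (hbβ : b = β ^ 2) (Dg : Finset ℕ)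
    (hD : ∀ d ∈ Dg, d < b) (hd0 : d0 ∈ Dg) (hd1 : d0 + 1 ∈ Dg) (hM : 1 < M)
    (hMD : M + 3 ≤ (Dg.filter Even).card) (V : ℕ → Set ℝ)
    (hV : ∀ r, IsEvent b d0 (ThickNode β) (V r))
    {α α' : ℝ} (hα : 0 < α) (hαα' : α < α') (hMb : (b : ℝ) ^ α' ≤ M) :
    ENNReal.ofReal α ≤ dimH {x : ℝ | (∃ a : ℕ → ℕ, (∀ j, ∃ d ∈ Dg, a (j + 1) = b * a j + d) ∧
      ∀ j, (a j : ℝ) / (b : ℝ) ^ j ≤ x ∧ x ≤ (a j + 1) / (b : ℝ) ^ j) ∧ ∀ r, x ∈ V r} := by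
  classical
  have hb : 2 ≤ b := by rw [hbβ]; nlinarith
  choose L I hI hIV using hV
  set J : ℕ → ℕ → ℕ → Finset ℕ := fun r n a => if h : ThickNode β n a then I r n a h else ∅ with hJ
  have hα'0 : 0 < α' := hα.trans hαα'
  set η := 1 - α / α' with hη
  have hη0 : 0 < η := by
    rw [hη, sub_pos, div_lt_one hα'0]; exact hαα'
  obtain ⟨N, hN0, hstep, hsum⟩ := exists_sparse_windows L hη0
  have hmono : StrictMono N := strictMono_nat_of_lt_succ fun r => by
    have := hstep r; omega
  have hEmono : Monotone fun r => N r + L r := monotone_nat_of_le_succ fun r => by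
    have := hstep r; omega
  have huniq : ∀ r r' j, N r ≤ j → j < N r + L r → N r' ≤ j → j < N r' + L r' → r ≤ r' := by
    intro r r' j h1 h2 h3 h4
    by_contra hcon
    have e1 := hmono.monotone (by omega : r' + 1 ≤ r)
    have e2 := hstep r'
    omega
  choose f hfinj hf using exists_free_digits hb Dg hD hMD
  set free : ℕ → Prop := fun j => ¬ ∃ r, N r ≤ j ∧ j < N r + L r with hfree
  set dig : ℕ → ℕ → Fin M → ℕ := fun j a u =>
    if h : ∃ r, N r ≤ j ∧ j < N r + L r then
      d0 + if j - N h.choose + 1 ∈ J h.choose (N h.choose) (a / b ^ (j - N h.choose)) then 1 else 0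
    else f j a u with hdig
  have hdig_free : ∀ j a u, free j → dig j a u = f j a u := by
    intro j a u h
    simp only [hdig]
    rw [dif_neg h]
  have hdig_forced : ∀ r j a u, N r ≤ j → j < N r + L r →
      dig j a u = d0 + if j - N r + 1 ∈ J r (N r) (a / b ^ (j - N r)) then 1 else 0 := by
    intro r j a u h1 h2
    have h : ∃ r, N r ≤ j ∧ j < N r + L r := ⟨r, h1, h2⟩
    have e : h.choose = r := le_antisymm
      (huniq _ _ j h.choose_spec.1 h.choose_spec.2 h1 h2)
      (huniq _ _ j h1 h2 h.choose_spec.1 h.choose_spec.2)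
    simp only [hdig]
    rw [dif_pos h, e]
  have hdigD : ∀ j a u, dig j a u ∈ Dg := by
    intro j a u
    by_cases h : free j
    · rw [hdig_free j a u h]; exact (hf j a u).1
    · simp only [hfree, not_not] at h
      obtain ⟨r, h1, h2⟩ := h
      rw [hdig_forced r j a u h1 h2]
      split_ifs
      · exact hd1
      · exact hd0
  have hchain : ∀ ω j, b * digitNode b dig (Nat.count free) ω j ≤
        digitNode b dig (Nat.count free) ω (j + 1) ∧
      digitNode b dig (Nat.count free) ω (j + 1) + 1 ≤
        b * digitNode b dig (Nat.count free) ω j + b := by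
    intro ω j
    have e : digitNode b dig (Nat.count free) ω (j + 1) = b * digitNode b dig (Nat.count free) ω j
      + dig j (digitNode b dig (Nat.count free) ω j) (ω (Nat.count free j)) := rfl
    have := hD _ (hdigD j (digitNode b dig (Nat.count free) ω j) (ω (Nat.count free j)))
    omega
  choose x hx using fun ω : ℕ → Fin M => exists_limit_of_digits (by omega) _ (hchain ω)
  have hdim := le_dimH_of_digitNode hb hM dig free
    (by
      refine Set.infinite_of_not_bddAbove ?_
      rintro ⟨B, hB⟩
      have : N (B + 2) - 1 ≤ B := by
        apply hB
        rintro ⟨r, h1, h2⟩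
        have h3 : 2 * (N (B + 1) + L (B + 1)) + 2 ≤ N (B + 2) := hstep (B + 1)
        rcases Nat.lt_or_ge r (B + 2) with h | h
        · have := hEmono (by omega : r ≤ B + 1)
          simp only at this
          omega
        · have := hmono.monotone h
          omega
      have := hmono.le_apply (x := B + 2)
      omega)
    (by
      intro j a hj u u' h
      rw [hdig_free j a u hj, hdig_free j a u' hj] at h
      exact hfinj j a h)
    (by
      intro j a u hj
      rw [hdig_free j a u hj]
      exact (hf j a u).2.1)
    (by
      intro j a u u' hj
      simp only [hfree, not_not] at hj
      obtain ⟨r, h1, h2⟩ := hj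
      rw [hdig_forced r j a u h1 h2, hdig_forced r j a u' h1 h2])
    hα hα'0.le (η := η) (by rw [hη]; field_simp; linarith)
    (count_free_of_sparse hη0 hstep hsum free (fun j => Iff.rfl)) hMb x hx
  refine hdim.trans (dimH_mono ?_)
  rintro _ ⟨ω, rfl⟩
  set A := digitNode b dig (Nat.count free) ω with hA
  have hAstep : ∀ j, A (j + 1) = b * A j + dig j (A j) (ω (Nat.count free j)) := fun j => rfl
  refine ⟨⟨A, fun j => ⟨_, hdigD _ _ _, hAstep j⟩, hx ω⟩, fun r => ?_⟩
  have hthick : ThickNode β (N r) (A (N r)) := by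
    apply thickNode_of_farFromRationals hβ hbβ A (hchain ω)
      (M0 := match r with | 0 => 0 | r + 1 => N r + L r)
    · cases r with
      | zero => simpa using hN0
      | succ r => simpa using hstep r
    · intro j h1 h2
      have hj : free j := by
        rintro ⟨r', h3, h4⟩
        have hr' : r' < r := by
          by_contra hcon
          have := hmono.monotone (not_lt.1 hcon)
          omega
        cases r with
        | zero => omega
        | succ r =>
          have := hEmono (by omega : r' ≤ r)
          simp only at this h1
          omega
      rw [hAstep, hdig_free _ _ _ hj]
      exact (hf j (A j) _).2.2
  have hJI : J r (N r) (A (N r)) = I r (N r) (A (N r)) hthick := by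
    simp only [hJ]; rw [dif_pos hthick]
  set Ir := J r (N r) (A (N r)) with hIr
  have hIsub : Ir ⊆ Finset.Icc 1 (L r) := by rw [hJI]; exact hI _ _ _ _
  have hb0 : (0 : ℝ) < b := by positivity
  have hforced : ∀ i < L r, A (N r + i + 1) = b * A (N r + i) + (d0 + if i + 1 ∈ Ir then 1 else 0) := by
    intro i hi
    rw [hAstep, hdig_forced r _ _ _ (by omega) (by omega), Nat.add_sub_cancel_left]
    have : A (N r + i) / b ^ i = A (N r) := by
      have h := digit_chain_bounds A (hchain ω) (N r) i
      have hbi : 0 < b ^ i := by positivity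
      apply Nat.div_eq_of_lt_le
      · exact h.1
      · exact lt_of_lt_of_le (Nat.lt_succ_self _) h.2
    rw [this]
  have hval : ∀ i ≤ L r, (A (N r + i) : ℝ) = (b : ℝ) ^ i * (A (N r) +
      d0 * ∑ l ∈ Finset.Icc 1 i, ((b : ℝ) ^ l)⁻¹ +
      ∑ l ∈ Finset.Icc 1 i, if l ∈ Ir then ((b : ℝ) ^ l)⁻¹ else 0) := by
    intro i
    induction i with
    | zero => simp
    | succ i ih =>
      intro hi
      rw [← add_assoc, hforced i (by omega), Finset.sum_Icc_succ_top (by omega),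
        Finset.sum_Icc_succ_top (by omega)]
      push_cast
      rw [ih (by omega)]
      have hbi : (b : ℝ) ^ (i + 1) * ((b : ℝ) ^ (i + 1))⁻¹ = 1 := mul_inv_cancel₀ (by positivity)
      split_ifs
      · linear_combination (-(d0 : ℝ) - 1) * hbi
      · linear_combination (-(d0 : ℝ)) * hbi
  have hfinal := hval (L r) le_rfl
  have hsumI : (∑ l ∈ Finset.Icc 1 (L r), if l ∈ Ir then ((b : ℝ) ^ l)⁻¹ else 0)
      = ∑ l ∈ Ir, ((b : ℝ) ^ l)⁻¹ := by
    rw [← Finset.sum_filter]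
    congr 1
    ext l
    rw [Finset.mem_filter]
    exact ⟨fun h => h.2, fun h => ⟨hIsub h, h⟩⟩
  rw [hsumI] at hfinal
  have hpp : startPoint b d0 (L r) (N r) (A (N r)) Ir
      = (A (N r + L r) : ℝ) / (b : ℝ) ^ (N r + L r) := by
    rw [hfinal, startPoint, pow_add, mul_comm ((b : ℝ) ^ N r), mul_div_mul_left _ _ (by positivity)]
  have hxx := hx ω (N r + L r)
  apply hIV r (N r) (A (N r)) hthick
  · rw [← hJI, hpp]; exact hxx.1
  · rw [← hJI, hpp, ← one_div, ← add_div]; exact hxx.2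

theorem iterate_zsmul_coe (n : ℤ) (k : ℕ) (x : ℝ) :
    (fun y : Circ => n • y)^[k] (x : Circ) = (((n : ℝ) ^ k * x : ℝ) : Circ) := by
  induction k with
  | zero => simp
  | succ k ih =>
    rw [Function.iterate_succ_apply', ih, ← AddCircle.coe_zsmul, zsmul_eq_mul]
    congr 1
    ring

theorem coe_sub_natCast (x : ℝ) (a : ℕ) : ((x - a : ℝ) : Circ) = (x : Circ) := by
  have : ((a : ℝ) : Circ) = 0 := by
    rw [AddCircle.coe_eq_zero_iff]; exact ⟨a, by simp⟩
  rw [AddCircle.coe_sub, this, sub_zero]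

theorem closure_orbit_inter_eq_empty {n : ℕ} (hn : 2 ≤ n) {p : ℕ} (hp : 1 ≤ p) (S : Set Circ)
    (Dg : Finset ℕ)
    (hDg : ∀ d ∈ Dg, ∀ x : ℝ, (d : ℝ) / (n : ℝ) ^ p ≤ x → x ≤ (d + 1) / (n : ℝ) ^ p →
      ∀ i < p, ∀ s ∈ S, (x : Circ) ≠ (n : ℤ) ^ i • s) (x : ℝ)
    (hx : ∃ a : ℕ → ℕ, (∀ j, ∃ d ∈ Dg, a (j + 1) = n ^ p * a j + d) ∧
      ∀ j, (a j : ℝ) / ((n ^ p : ℕ) : ℝ) ^ j ≤ x ∧ x ≤ (a j + 1) / ((n ^ p : ℕ) : ℝ) ^ j) :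
    closure (Set.range fun k : ℕ => (fun y : Circ => (n : ℤ) • y)^[k] (x : Circ)) ∩ S = ∅ := by
  obtain ⟨a, ha, hax⟩ := hx
  have hn0 : (0 : ℝ) < n := by positivity
  set Z : Set Circ := ⋃ d ∈ Dg,
    (fun x : ℝ => (x : Circ)) '' Icc ((d : ℝ) / (n : ℝ) ^ p) ((d + 1) / (n : ℝ) ^ p) with hZ
  have hZc : IsClosed Z := by
    refine Set.Finite.isClosed_biUnion Dg.finite_toSet fun d _ => ?_
    exact (isCompact_Icc.image (AddCircle.continuous_mk' 1)).isClosed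
  have hZmem : ∀ j : ℕ, ((((n : ℝ) ^ (p * j)) * x : ℝ) : Circ) ∈ Z := by
    intro j
    obtain ⟨d, hd, hj⟩ := ha j
    obtain ⟨h1, h2⟩ := hax (j + 1)
    rw [hZ, mem_iUnion₂]
    refine ⟨d, hd, (n : ℝ) ^ (p * j) * x - a j, ⟨?_, ?_⟩, coe_sub_natCast _ _⟩
    · rw [hj] at h1
      push_cast at h1
      rw [div_le_iff₀ (by positivity)] at h1 ⊢
      rw [pow_mul]
      rw [pow_succ] at h1
      linarith
    · rw [hj] at h2
      push_cast at h2
      rw [le_div_iff₀ (by positivity)] at h2 ⊢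
      rw [pow_mul]
      rw [pow_succ] at h2
      linarith
  set W : Set Circ := ⋃ i ∈ Finset.range p, (fun y : Circ => (n : ℤ) ^ i • y) ⁻¹' Z with hW
  have hWc : IsClosed W := by
    refine Set.Finite.isClosed_biUnion (Finset.range p).finite_toSet fun i _ => ?_
    exact hZc.preimage (continuous_const_smul _)
  have hsub : closure (Set.range fun k : ℕ => (fun y : Circ => (n : ℤ) • y)^[k] (x : Circ)) ⊆ W := by
    apply closure_minimal _ hWc
    rintro _ ⟨k, rfl⟩
    simp only
    rw [iterate_zsmul_coe, hW, mem_iUnion₂]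
    refine ⟨(p - k % p) % p, Finset.mem_range.2 (Nat.mod_lt _ (by omega)), ?_⟩
    obtain ⟨j, hj⟩ : ∃ j, (p - k % p) % p + k = p * j := by
      have h1 := Nat.div_add_mod k p
      have h2 := Nat.mod_lt k (by omega : p > 0)
      rcases Nat.eq_zero_or_pos (k % p) with h | h
      · refine ⟨k / p, ?_⟩
        rw [h, Nat.sub_zero, Nat.mod_self]; omega
      · refine ⟨k / p + 1, ?_⟩
        rw [Nat.mod_eq_of_lt (by omega), mul_add, mul_one]; omega
    have := hZmem j
    rw [mem_preimage, ← AddCircle.coe_zsmul, zsmul_eq_mul]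
    rw [← hj, pow_add, mul_assoc] at this
    convert this using 2
    push_cast
    rfl
  rw [Set.eq_empty_iff_forall_notMem]
  rintro s ⟨hs1, hs2⟩
  have := hsub hs1
  rw [hW, mem_iUnion₂] at this
  obtain ⟨i, hi, hsZ⟩ := this
  rw [mem_preimage, hZ, mem_iUnion₂] at hsZ
  obtain ⟨d, hd, y, ⟨hy1, hy2⟩, hy⟩ := hsZ
  exact hDg d hd y hy1 hy2 i (Finset.mem_range.1 hi) s hs2 hy

/-- The `b`-adic closed arcs of order one meeting a given finite set number at most three per
point. -/
theorem card_bad_digits_le {b : ℕ} (hb : 0 < b) (F : Finset Circ) :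
    ∃ B : Finset ℕ, B.card ≤ 3 * F.card ∧ ∀ d < b, d ∉ B → ∀ x : ℝ, (d : ℝ) / b ≤ x →
      x ≤ (d + 1) / b → (x : Circ) ∉ F := by
  classical
  have hb0 : (0 : ℝ) < b := by exact_mod_cast hb
  have hrep : ∀ s : Circ, ∃ x0 : ℝ, 0 ≤ x0 ∧ x0 < 1 ∧ (x0 : Circ) = s := by
    intro s
    obtain ⟨y, rfl⟩ := QuotientAddGroup.mk_surjective s
    refine ⟨Int.fract y, Int.fract_nonneg y, Int.fract_lt_one y, ?_⟩
    have : ((⌊y⌋ : ℝ) : Circ) = 0 := by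
      rw [AddCircle.coe_eq_zero_iff]; exact ⟨⌊y⌋, by simp⟩
    rw [Int.fract, AddCircle.coe_sub, this, sub_zero]
  choose rep hr0 hr1 hr using hrep
  refine ⟨F.biUnion fun s => {⌊b * rep s⌋₊, ⌊b * rep s⌋₊ - 1, b - 1}, ?_, ?_⟩
  · refine Finset.card_biUnion_le.trans ?_
    calc _ ≤ ∑ s ∈ F, 3 := Finset.sum_le_sum fun s _ => Finset.card_le_three
      _ = 3 * F.card := by simp [mul_comm]
  · intro d hd hdB x hx1 hx2 hxF
    apply hdB
    rw [Finset.mem_biUnion]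
    refine ⟨_, hxF, ?_⟩
    set s : Circ := (x : Circ) with hs
    have hxs : ((x - rep s : ℝ) : Circ) = 0 := by
      rw [AddCircle.coe_sub, hr, ← hs, sub_self]
    rw [AddCircle.coe_eq_zero_iff] at hxs
    obtain ⟨k, hk⟩ := hxs
    simp only [zsmul_eq_mul, mul_one] at hk
    have h0 := hr0 s
    have h1 := hr1 s
    rw [div_le_iff₀ hb0] at hx1
    rw [le_div_iff₀ hb0] at hx2
    have hd' : (d : ℝ) + 1 ≤ b := by exact_mod_cast hd
    have hd0 : (0 : ℝ) ≤ d := by positivity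
    have hx0 : 0 ≤ x := by nlinarith
    have hx1' : x ≤ 1 := by nlinarith
    have hk0 : (-1 : ℝ) < k := by linarith
    have hk1 : (k : ℝ) ≤ 1 := by linarith
    have hk0' : -1 < k := by exact_mod_cast hk0
    have hk1' : k ≤ 1 := by exact_mod_cast hk1
    simp only [Finset.mem_insert, Finset.mem_singleton]
    rcases (by omega : k = 0 ∨ k = 1) with h | h
    · have hxr : x = rep s := by rw [h] at hk; simp at hk; linarith
      rw [← hxr]
      have f1 : d ≤ ⌊(b : ℝ) * x⌋₊ := Nat.le_floor (by linarith)
      have f2 : ⌊(b : ℝ) * x⌋₊ ≤ d + 1 := by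
        have := Nat.floor_le (by positivity : 0 ≤ (b : ℝ) * x)
        have h3 : ((⌊(b : ℝ) * x⌋₊ : ℕ) : ℝ) ≤ (d + 1 : ℕ) := by push_cast; linarith
        exact_mod_cast h3
      omega
    · right; right
      have hx : x = 1 := by rw [h] at hk; push_cast at hk; linarith
      rw [hx] at hx2
      have : (b : ℝ) ≤ (d + 1 : ℕ) := by push_cast; linarith
      have : b ≤ d + 1 := by exact_mod_cast this
      omega

theorem exists_even_pow_large {n : ℕ} (hn : 2 ≤ n) {α' : ℝ} (hα' : α' < 1) (c : ℕ) :
    ∃ k : ℕ, 1 ≤ k ∧ ((n ^ (2 * k) : ℕ) : ℝ) ^ α' + 5 + c * (2 * k : ℕ) ≤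
      ((n ^ (2 * k) : ℕ) : ℝ) / 2 := by
  have hn1 : (1 : ℝ) < n := by exact_mod_cast (by omega : 1 < n)
  have hn0 : (0 : ℝ) < n := by positivity
  have h1 : (fun p : ℕ => ((n : ℝ) ^ α') ^ p) =o[atTop] fun p : ℕ => (n : ℝ) ^ p := by
    apply isLittleO_pow_pow_of_lt_left (by positivity)
    calc (n : ℝ) ^ α' < (n : ℝ) ^ (1 : ℝ) := Real.rpow_lt_rpow_of_exponent_lt hn1 hα'
      _ = n := Real.rpow_one _
  have h2 : (fun p : ℕ => (c : ℝ) * p) =o[atTop] fun p : ℕ => (n : ℝ) ^ p := by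
    apply Asymptotics.IsLittleO.const_mul_left
    simpa using isLittleO_pow_const_const_pow_of_one_lt (R := ℝ) 1 hn1
  have h3 : (fun _ : ℕ => (5 : ℝ)) =o[atTop] fun p : ℕ => (n : ℝ) ^ p := by
    have := isLittleO_pow_const_const_pow_of_one_lt (R := ℝ) 0 hn1
    simpa using this.const_mul_left 5
  have h := ((h1.add h3).add h2).def (c := 1 / 2) (by norm_num)
  have hev : ∀ᶠ k : ℕ in atTop, 1 ≤ k ∧
      ‖((n : ℝ) ^ α') ^ (2 * k) + 5 + (c : ℝ) * (2 * k : ℕ)‖ ≤ 1 / 2 * ‖(n : ℝ) ^ (2 * k)‖ := by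
    have ht : Tendsto (fun k : ℕ => 2 * k) atTop atTop :=
      tendsto_id.const_mul_atTop' (by norm_num)
    exact (eventually_ge_atTop 1).and (ht.eventually h)
  obtain ⟨k, hk1, hk2⟩ := hev.exists
  refine ⟨k, hk1, ?_⟩
  rw [Real.norm_of_nonneg (by positivity), Real.norm_of_nonneg (by positivity)] at hk2
  have e : ((n ^ (2 * k) : ℕ) : ℝ) ^ α' = ((n : ℝ) ^ α') ^ (2 * k) := by
    push_cast
    rw [← Real.rpow_natCast, ← Real.rpow_mul hn0.le, ← Real.rpow_natCast, ← Real.rpow_mul hn0.le,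
      mul_comm]
  rw [e]
  push_cast at hk2 ⊢
  linarith

/-- Lower bound for the Hausdorff dimension of the set of points whose `×n` orbit avoids a finite
set and which realise prescribed events. -/
theorem le_dimH_avoiding {n : ℕ} (hn : 2 ≤ n) {S : Set Circ} (hS : S.Finite) {α : ℝ} (hα : 0 < α)
    (hα1 : α < 1) (V : ℕ → Set ℝ)
    (hV : ∀ k d0, 1 ≤ k → ∀ r, IsEvent ((n ^ k) ^ 2) d0 (ThickNode (n ^ k)) (V r)) :
    ENNReal.ofReal α ≤ dimH ({s : ℝ |
        closure (Set.range fun k : ℕ => (fun x : Circ => (n : ℤ) • x)^[k] (s : Circ)) ∩ S = ∅}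
      ∩ ⋂ r, V r) := by
  classical
  set α' := (1 + α) / 2 with hα'
  obtain ⟨k, hk, hkl⟩ := exists_even_pow_large hn (by rw [hα']; linarith : α' < 1)
    (3 * hS.toFinset.card)
  set b := n ^ (2 * k) with hb
  have hbβ : b = (n ^ k) ^ 2 := by rw [hb, ← pow_mul, mul_comm]
  have hb0 : 0 < b := by positivity
  set F : Finset Circ := (Finset.range (2 * k)).biUnion fun i =>
    hS.toFinset.image fun s => (n : ℤ) ^ i • s with hF
  have hFcard : F.card ≤ 2 * k * hS.toFinset.card := by
    refine Finset.card_biUnion_le.trans ?_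
    calc _ ≤ ∑ i ∈ Finset.range (2 * k), hS.toFinset.card :=
          Finset.sum_le_sum fun i _ => Finset.card_image_le
      _ = _ := by simp
  obtain ⟨B, hBcard, hB⟩ := card_bad_digits_le hb0 F
  set M := ⌈(b : ℝ) ^ α'⌉₊ with hM
  have hMb : (b : ℝ) ^ α' ≤ M := Nat.le_ceil _
  have hMlt : (M : ℝ) < (b : ℝ) ^ α' + 1 := Nat.ceil_lt_add_one (by positivity)
  have hsize : M + 4 + B.card ≤ b / 2 := by
    have h1 : (B.card : ℝ) ≤ 3 * hS.toFinset.card * (2 * k : ℕ) := by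
      have : B.card ≤ 3 * hS.toFinset.card * (2 * k) := by
        calc B.card ≤ 3 * F.card := hBcard
          _ ≤ 3 * (2 * k * hS.toFinset.card) := by gcongr
          _ = _ := by ring
      exact_mod_cast this
    have h2 : ((2 * (M + 4 + B.card) : ℕ) : ℝ) ≤ b := by
      push_cast at hkl h1 ⊢
      linarith
    have h3 : 2 * (M + 4 + B.card) ≤ b := by exact_mod_cast h2
    omega
  set Dg : Finset ℕ := (Finset.range b).filter fun d => d ∉ B with hDg
  have hDlt : ∀ d ∈ Dg, d < b := fun d hd => Finset.mem_range.1 (Finset.mem_filter.1 hd).1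
  have hpairs : ∃ i < b / 2, 2 * i ∉ B ∧ 2 * i + 1 ∉ B := by
    by_contra hcon
    push Not at hcon
    have : (Finset.range (b / 2)).card ≤ (B.image fun d => d / 2).card := by
      apply Finset.card_le_card
      intro i hi
      rw [Finset.mem_range] at hi
      rw [Finset.mem_image]
      by_cases h : 2 * i ∈ B
      · exact ⟨_, h, by omega⟩
      · exact ⟨_, hcon i hi h, by omega⟩
    rw [Finset.card_range] at this
    have := this.trans Finset.card_image_le
    omega
  obtain ⟨i, hi, hi0, hi1⟩ := hpairs
  have heven : M + 3 ≤ (Dg.filter Even).card := by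
    have h1 : ((Finset.range (b / 2)).image fun i => 2 * i) \ B ⊆ Dg.filter Even := by
      intro d hd
      rw [Finset.mem_sdiff, Finset.mem_image] at hd
      obtain ⟨⟨i, hi, rfl⟩, hd⟩ := hd
      rw [Finset.mem_range] at hi
      rw [Finset.mem_filter, hDg, Finset.mem_filter, Finset.mem_range]
      exact ⟨⟨by omega, hd⟩, even_two_mul i⟩
    have h2 := Finset.card_le_card h1
    have h3 := Finset.le_card_sdiff B ((Finset.range (b / 2)).image fun i => 2 * i)
    rw [Finset.card_image_of_injective _ (fun x y h => by simpa using h), Finset.card_range] at h3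
    omega
  have hM1 : 1 < M := by
    have h1 : (1 : ℝ) < (b : ℝ) ^ α' := by
      apply Real.one_lt_rpow
      · have : 1 < b := Nat.one_lt_pow (by omega) (by omega)
        exact_mod_cast this
      · rw [hα']; linarith
    have : (1 : ℝ) < M := h1.trans_le hMb
    exact_mod_cast this
  have hβ : 2 ≤ n ^ k := by
    calc 2 ≤ n := hn
      _ = n ^ 1 := (pow_one n).symm
      _ ≤ n ^ k := Nat.pow_le_pow_right (by omega) hk
  have hdim := le_dimH_of_isEvent hβ hbβ Dg hDlt (d0 := 2 * i)
    (by rw [hDg, Finset.mem_filter, Finset.mem_range]; exact ⟨by omega, hi0⟩)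
    (by rw [hDg, Finset.mem_filter, Finset.mem_range]; exact ⟨by omega, hi1⟩)
    hM1 heven V (fun r => by rw [hbβ]; exact hV k _ hk r) hα (by rw [hα']; linarith : α < α') hMb
  refine hdim.trans (dimH_mono ?_)
  rintro x ⟨hx, hxV⟩
  refine ⟨?_, mem_iInter.2 hxV⟩
  refine closure_orbit_inter_eq_empty hn (p := 2 * k) (by omega) S Dg ?_ x hx
  intro d hd y hy1 hy2 i hi s hs hys
  have hd' := Finset.mem_filter.1 hd
  refine hB d (Finset.mem_range.1 hd'.1) hd'.2 y ?_ ?_ ?_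
  · rw [hb]; push_cast; exact hy1
  · rw [hb]; push_cast; exact hy2
  · rw [hF, Finset.mem_biUnion]
    refine ⟨i, Finset.mem_range.2 hi, ?_⟩
    rw [Finset.mem_image]
    exact ⟨s, hS.mem_toFinset.2 hs, hys.symm⟩

theorem isInducing_coe_SL2R :
    Topology.IsInducing (fun A : SL2R => (A : Matrix (Fin 2) (Fin 2) ℝ)) := ⟨rfl⟩

theorem continuous_SL2R_iff {α : Type*} [TopologicalSpace α] {f : α → SL2R} :
    Continuous f ↔ ∀ i j, Continuous fun x => f x i j :=
  isInducing_coe_SL2R.continuous_iff.trans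
    (continuous_pi_iff.trans (forall_congr' fun _ => continuous_pi_iff))

theorem tendsto_SL2R_iff {α : Type*} {l : Filter α} {f : α → SL2R} {g : SL2R} :
    Tendsto f l (nhds g) ↔ ∀ i j, Tendsto (fun x => f x i j) l (nhds (g i j)) :=
  isInducing_coe_SL2R.tendsto_nhds_iff.trans
    (tendsto_pi_nhds.trans (forall_congr' fun _ => tendsto_pi_nhds))

theorem continuous_SL2R_apply (i j : Fin 2) : Continuous fun g : SL2R => g i j :=
  continuous_SL2R_iff.1 continuous_id i j

instance : ContinuousMul SL2R where
  continuous_mul := by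
    rw [continuous_SL2R_iff]
    intro i j
    simp only [Matrix.SpecialLinearGroup.coe_mul, Matrix.mul_apply, Fin.sum_univ_two]
    have h := fun i j => (continuous_SL2R_apply i j).comp (continuous_fst (X := SL2R) (Y := SL2R))
    have h' := fun i j => (continuous_SL2R_apply i j).comp (continuous_snd (X := SL2R) (Y := SL2R))
    exact ((h i 0).mul (h' 0 j)).add ((h i 1).mul (h' 1 j))

instance : SecondCountableTopology SL2R :=
  haveI : SecondCountableTopology (Matrix (Fin 2) (Fin 2) ℝ) :=
    inferInstanceAs (SecondCountableTopology (Fin 2 → Fin 2 → ℝ))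
  isInducing_coe_SL2R.secondCountableTopology

instance : SecondCountableTopology X2 :=
  ContinuousConstSMul.secondCountableTopology (Γ := SL2Zsub.op) (T := SL2R)

/-- The unipotent matrix `[[1, s], [0, 1]]`. -/
def hu (s : ℝ) : SL2R := ⟨!![(1:ℝ), s; 0, 1], by simp [Matrix.det_fin_two_of]⟩

/-- The element of `SL₂(ℝ)` given by an integral matrix. -/
def ofInt (γ : SL2Z) : SL2R := Matrix.SpecialLinearGroup.map (n := Fin 2) (Int.castRingHom ℝ) γ

@[simp] theorem ofInt_apply (γ : SL2Z) (i j : Fin 2) : ofInt γ i j = (γ i j : ℝ) := rfl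

theorem ofInt_mul (γ δ : SL2Z) : ofInt (γ * δ) = ofInt γ * ofInt δ := map_mul _ _ _

theorem ofInt_one : ofInt 1 = 1 := map_one _

theorem ofInt_inv (γ : SL2Z) : ofInt γ⁻¹ = (ofInt γ)⁻¹ := map_inv _ _

@[simp] theorem hu_00 (s : ℝ) : hu s 0 0 = 1 := rfl
@[simp] theorem hu_01 (s : ℝ) : hu s 0 1 = s := rfl
@[simp] theorem hu_10 (s : ℝ) : hu s 1 0 = 0 := rfl
@[simp] theorem hu_11 (s : ℝ) : hu s 1 1 = 1 := rfl
@[simp] theorem g2_00 (u : ℝ) : g2 u 0 0 = Real.exp u := rfl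
@[simp] theorem g2_01 (u : ℝ) : g2 u 0 1 = 0 := rfl
@[simp] theorem g2_10 (u : ℝ) : g2 u 1 0 = 0 := rfl
@[simp] theorem g2_11 (u : ℝ) : g2 u 1 1 = Real.exp (-u) := rfl

theorem mul_SL2R_apply (g h : SL2R) (i j : Fin 2) :
    (g * h) i j = g i 0 * h 0 j + g i 1 * h 1 j := by
  simp [Matrix.SpecialLinearGroup.coe_mul, Matrix.mul_apply, Fin.sum_univ_two]

theorem ext_SL2R {g h : SL2R} (h00 : g 0 0 = h 0 0) (h01 : g 0 1 = h 0 1) (h10 : g 1 0 = h 1 0)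
    (h11 : g 1 1 = h 1 1) : g = h := by
  ext i j
  fin_cases i <;> fin_cases j <;> assumption

theorem det_SL2R (g : SL2R) : g 0 0 * g 1 1 - g 0 1 * g 1 0 = 1 := by
  rw [← Matrix.det_fin_two]; exact g.2

theorem det_SL2Z (g : SL2Z) : g 0 0 * g 1 1 - g 0 1 * g 1 0 = 1 := by
  rw [← Matrix.det_fin_two]; exact g.2

theorem hu_mul_hu (s s' : ℝ) : hu s * hu s' = hu (s + s') := by
  apply ext_SL2R <;> simp only [mul_SL2R_apply, hu_00, hu_01, hu_10, hu_11] <;> ring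

theorem hu_zero : hu 0 = 1 := by apply ext_SL2R <;> simp

theorem g2_mul_g2 (s s' : ℝ) : g2 s * g2 s' = g2 (s + s') := by
  apply ext_SL2R <;> simp only [mul_SL2R_apply, g2_00, g2_01, g2_10, g2_11, Real.exp_add, neg_add]
    <;> ring

theorem g2_zero : g2 0 = 1 := by apply ext_SL2R <;> simp

theorem g2_pow (s : ℝ) (k : ℕ) : g2 s ^ k = g2 (k * s) := by
  induction k with
  | zero => simp [g2_zero]
  | succ k ih => rw [pow_succ, ih, g2_mul_g2]; congr 1; push_cast; ring

theorem g2_mul_hu (u s : ℝ) : g2 u * hu s = hu (Real.exp (2 * u) * s) * g2 u := by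
  have h : Real.exp (2 * u) * Real.exp (-u) = Real.exp u := by rw [← Real.exp_add]; congr 1; ring
  apply ext_SL2R <;> simp only [mul_SL2R_apply, g2_00, g2_01, g2_10, g2_11, hu_00, hu_01, hu_10, hu_11]
  · ring
  · linear_combination (-s) * h
  · ring
  · ring

theorem continuous_hu : Continuous hu := by
  rw [continuous_SL2R_iff]
  intro i j
  fin_cases i <;> fin_cases j
  · exact continuous_const
  · exact continuous_id
  · exact continuous_const
  · exact continuous_const

theorem continuous_g2 : Continuous g2 := by
  rw [continuous_SL2R_iff]
  intro i j
  fin_cases i <;> fin_cases j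
  · exact Real.continuous_exp
  · exact continuous_const
  · exact continuous_const
  · exact Real.continuous_exp.comp continuous_neg

theorem mk_mul_ofInt (g : SL2R) (γ : SL2Z) :
    (QuotientGroup.mk (g * ofInt γ) : X2) = QuotientGroup.mk g := by
  rw [eq_comm, QuotientGroup.eq]
  refine ⟨γ, ?_⟩
  simp [ofInt]

theorem g2_pow_smul_h2 (t : ℝ) (k : ℕ) (s : ℝ) :
    g2 t ^ k • h2 s = (QuotientGroup.mk (g2 (k * t) * hu s) : X2) := by
  rw [← g2_pow]; rfl

/-- Every nonzero vector of the lattice `q ℤ²` has sup norm at least `ε`. -/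
def Thick (ε : ℝ) (q : SL2R) : Prop :=
  ∀ m n : ℤ, ¬(m = 0 ∧ n = 0) → ε ≤ max |q 0 0 * m + q 0 1 * n| |q 1 0 * m + q 1 1 * n|

theorem Thick.mul_ofInt {ε : ℝ} {q : SL2R} (h : Thick ε q) (γ : SL2Z) : Thick ε (q * ofInt γ) := by
  intro m n hmn
  have hd := det_SL2Z γ
  have key := h (γ 0 0 * m + γ 0 1 * n) (γ 1 0 * m + γ 1 1 * n) (by
    rintro ⟨h1, h2⟩
    apply hmn
    constructor
    · linear_combination (-m) * hd + γ 1 1 * h1 - γ 0 1 * h2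
    · linear_combination (-n) * hd - γ 1 0 * h1 + γ 0 0 * h2)
  simp only [mul_SL2R_apply, ofInt_apply]
  push_cast at key
  convert key using 3 <;> ring

theorem thick_of_tendsto {α : Type*} {l : Filter α} [NeBot l] {f : α → SL2R} {q : SL2R} {ε : ℝ}
    (hf : Tendsto f l (nhds q)) (h : ∀ᶠ k in l, Thick ε (f k)) : Thick ε q := by
  intro m n hmn
  rw [tendsto_SL2R_iff] at hf
  have h1 : ∀ i, Tendsto (fun k => |f k i 0 * m + f k i 1 * n|) l (nhds |q i 0 * m + q i 1 * n|) :=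
    fun i => (((hf i 0).mul_const _).add ((hf i 1).mul_const _)).abs
  exact ge_of_tendsto ((h1 0).max (h1 1)) (h.mono fun k hk => hk m n hmn)

theorem exists_thick (q : SL2R) : ∃ ε > 0, Thick ε q := by
  set R := |q 0 0| + |q 0 1| + |q 1 0| + |q 1 1| + 1 with hR
  have h00 := abs_nonneg (q 0 0)
  have h01 := abs_nonneg (q 0 1)
  have h10 := abs_nonneg (q 1 0)
  have h11 := abs_nonneg (q 1 1)
  have hR0 : 0 < R := by positivity
  refine ⟨1 / (2 * R), by positivity, fun m n hmn => ?_⟩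
  by_contra! hlt
  have hd := det_SL2R q
  set x := q 0 0 * m + q 0 1 * n
  set y := q 1 0 * m + q 1 1 * n
  have hx : |x| < 1 / (2 * R) := (le_max_left _ _).trans_lt hlt
  have hy : |y| < 1 / (2 * R) := (le_max_right _ _).trans_lt hlt
  have hm : (m : ℝ) = q 1 1 * x - q 0 1 * y := by
    simp only [x, y]; linear_combination (-(m : ℝ)) * hd
  have hn : (n : ℝ) = q 0 0 * y - q 1 0 * x := by
    simp only [x, y]; linear_combination (-(n : ℝ)) * hd
  have hRR : R * (1 / (2 * R)) = 1 / 2 := by field_simp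
  have bound : ∀ a b : ℝ, |a| ≤ R → |b| ≤ R → |a * x - b * y| < 1 := by
    intro a b ha hb
    have h1 : |a * x| ≤ R * (1 / (2 * R)) := by rw [abs_mul]; gcongr
    have h2 : |b * y| ≤ R * |y| := by rw [abs_mul]; gcongr
    have h3 : R * |y| < R * (1 / (2 * R)) := by gcongr
    calc |a * x - b * y| ≤ |a * x| + |b * y| := abs_sub _ _
      _ < 1 := by linarith
  have hm' : |(m : ℝ)| < 1 := by
    rw [hm]; exact bound _ _ (by linarith) (by linarith)
  have hn' : |(n : ℝ)| < 1 := by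
    rw [hn, abs_sub_comm]; exact bound _ _ (by linarith) (by linarith)
  apply hmn
  constructor
  · rw [← Int.abs_lt_one_iff]; exact_mod_cast hm'
  · rw [← Int.abs_lt_one_iff]; exact_mod_cast hn'

theorem exists_reduced (q : SL2R) : ∃ γ : SL2Z, ∃ A B C D : ℝ,
    (q * ofInt γ) 0 0 = A ∧ (q * ofInt γ) 0 1 = B ∧ (q * ofInt γ) 1 0 = C ∧
    (q * ofInt γ) 1 1 = D ∧ |A * B + C * D| ≤ (A ^ 2 + C ^ 2) / 2 ∧
    A ^ 2 + C ^ 2 ≤ B ^ 2 + D ^ 2 := by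
  obtain ⟨g, hg⟩ := ModularGroup.exists_smul_mem_fd ((q⁻¹ : SL2R) • UpperHalfPlane.I)
  refine ⟨g⁻¹, _, _, _, _, rfl, rfl, rfl, rfl, ?_⟩
  set M := q * ofInt g⁻¹ with hM
  have hz : (g • ((q⁻¹ : SL2R) • UpperHalfPlane.I) : UpperHalfPlane) = M⁻¹ • UpperHalfPlane.I := by
    have : M⁻¹ = ofInt g * q⁻¹ := by rw [hM, ofInt_inv]; simp
    have hsmul : ∀ z : UpperHalfPlane, g • z = ofInt g • z := fun z => by
      apply UpperHalfPlane.ext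
      rw [UpperHalfPlane.coe_specialLinearGroup_apply, UpperHalfPlane.coe_specialLinearGroup_apply]
      simp
    rw [this, mul_smul, hsmul]
  rw [hz] at hg
  have hd := det_SL2R M
  set A := M 0 0
  set B := M 0 1
  set C := M 1 0
  set D := M 1 1
  have hAC : 0 < A ^ 2 + C ^ 2 := by
    by_contra! h
    have hA : A = 0 := by nlinarith [sq_nonneg A, sq_nonneg C]
    have hC : C = 0 := by nlinarith [sq_nonneg A, sq_nonneg C]
    rw [hA, hC] at hd; norm_num at hd
  have hcoe : ((M⁻¹ • UpperHalfPlane.I : UpperHalfPlane) : ℂ) =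
      (D * Complex.I - B) / (-C * Complex.I + A) := by
    rw [UpperHalfPlane.specialLinearGroup_apply]
    have e : ∀ i j, (M⁻¹ : SL2R) i j = !![D, -B; -C, A] i j := by
      intro i j
      rw [Matrix.SpecialLinearGroup.coe_inv, Matrix.adjugate_fin_two]
    simp [e]
    ring
  have hden : (-C * Complex.I + A : ℂ) ≠ 0 := by
    intro h
    have h1 := congrArg Complex.re h
    have h2 := congrArg Complex.im h
    simp at h1 h2
    rw [h1, h2] at hAC; norm_num at hAC
  have hcoe' : ((M⁻¹ • UpperHalfPlane.I : UpperHalfPlane) : ℂ) =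
      ((-(A * B + C * D) / (A ^ 2 + C ^ 2) : ℝ) : ℂ) + ((1 / (A ^ 2 + C ^ 2) : ℝ) : ℂ) * Complex.I := by
    rw [hcoe, div_eq_iff hden]
    have hACc : ((A : ℂ) ^ 2 + (C : ℂ) ^ 2) ≠ 0 := by exact_mod_cast hAC.ne'
    have hdc : (A : ℂ) * D - B * C = 1 := by exact_mod_cast hd
    push_cast
    field_simp
    linear_combination (Complex.I * A + C) * hdc + C * Complex.I_sq
  obtain ⟨h1, h2⟩ := hg
  have hre : (M⁻¹ • UpperHalfPlane.I : UpperHalfPlane).re = -(A * B + C * D) / (A ^ 2 + C ^ 2) := by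
    have := congrArg Complex.re hcoe'
    rwa [Complex.add_re, Complex.ofReal_re, Complex.re_ofReal_mul, Complex.I_re, mul_zero,
      add_zero] at this
  have him : ((M⁻¹ • UpperHalfPlane.I : UpperHalfPlane) : ℂ).im = 1 / (A ^ 2 + C ^ 2) := by
    have := congrArg Complex.im hcoe'
    rwa [Complex.add_im, Complex.ofReal_im, Complex.im_ofReal_mul, Complex.I_im, mul_one,
      zero_add] at this
  rw [hre, abs_div, abs_neg, abs_of_pos hAC, div_le_div_iff₀ hAC two_pos] at h2
  rw [Complex.normSq_apply, him, show ((M⁻¹ • UpperHalfPlane.I : UpperHalfPlane) : ℂ).re =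
    -(A * B + C * D) / (A ^ 2 + C ^ 2) from hre] at h1
  refine ⟨by linarith, ?_⟩
  have h3 : (A * B + C * D) ^ 2 + 1 = (A ^ 2 + C ^ 2) * (B ^ 2 + D ^ 2) := by
    linear_combination (-(A * D - B * C) - 1) * hd
  have h4 : -(A * B + C * D) / (A ^ 2 + C ^ 2) * (-(A * B + C * D) / (A ^ 2 + C ^ 2)) +
      1 / (A ^ 2 + C ^ 2) * (1 / (A ^ 2 + C ^ 2)) = (B ^ 2 + D ^ 2) / (A ^ 2 + C ^ 2) := by
    field_simp
    linear_combination h3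
  rw [h4, le_div_iff₀ hAC] at h1
  linarith

theorem exists_bounded_of_thick {ε : ℝ} (hε : 0 < ε) {q : SL2R} (h : Thick ε q) :
    ∃ γ : SL2Z, ∀ i j, |(q * ofInt γ) i j| ≤ 2 / ε := by
  obtain ⟨γ, A, B, C, D, hA, hB, hC, hD, h1, h2⟩ := exists_reduced q
  refine ⟨γ, ?_⟩
  have hd := det_SL2R (q * ofInt γ)
  rw [hA, hB, hC, hD] at hd
  have hth := h.mul_ofInt γ 1 0 (by simp)
  rw [hA, hB, hC, hD] at hth
  simp only [Int.cast_one, Int.cast_zero, mul_one, mul_zero, add_zero] at hth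
  have h3 : ε ^ 2 ≤ A ^ 2 + C ^ 2 := by
    rcases le_max_iff.1 hth with h | h
    · have : ε ^ 2 ≤ |A| ^ 2 := by gcongr
      rw [sq_abs] at this; nlinarith [sq_nonneg C]
    · have : ε ^ 2 ≤ |C| ^ 2 := by gcongr
      rw [sq_abs] at this; nlinarith [sq_nonneg A]
  have h4 : (A * B + C * D) ^ 2 + 1 = (A ^ 2 + C ^ 2) * (B ^ 2 + D ^ 2) := by
    linear_combination (-(A * D - B * C) - 1) * hd
  set P := A ^ 2 + C ^ 2
  set Q := B ^ 2 + D ^ 2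
  have hP0 : 0 < P := lt_of_lt_of_le (by positivity) h3
  have h5 : (A * B + C * D) ^ 2 ≤ (P / 2) ^ 2 := by rw [← sq_abs]; gcongr
  have h6 : ε ^ 2 * Q ≤ P * Q := mul_le_mul_of_nonneg_right h3 (by linarith)
  have h7 : P * P ≤ P * Q := mul_le_mul_of_nonneg_left h2 hP0.le
  have h8 : ε ^ 2 * Q ≤ 4 := by nlinarith
  have hQ : Q ≤ (2 / ε) ^ 2 := by
    rw [div_pow, le_div_iff₀ (by positivity)]; linarith
  have hfin : ∀ x : ℝ, x ^ 2 ≤ Q → |x| ≤ 2 / ε := fun x hx =>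
    abs_le_of_sq_le_sq (hx.trans hQ) (by positivity)
  intro i j
  fin_cases i <;> fin_cases j
  · change |(q * ofInt γ) 0 0| ≤ _
    rw [hA]; apply hfin; simp only [P] at h2; nlinarith [sq_nonneg C]
  · change |(q * ofInt γ) 0 1| ≤ _
    rw [hB]; apply hfin; simp only [Q]; nlinarith [sq_nonneg D]
  · change |(q * ofInt γ) 1 0| ≤ _
    rw [hC]; apply hfin; simp only [P] at h2; nlinarith [sq_nonneg A]
  · change |(q * ofInt γ) 1 1| ≤ _
    rw [hD]; apply hfin; simp only [Q]; nlinarith [sq_nonneg B]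

theorem exists_tendsto_real {α : Type*} (l : Ultrafilter α) {f : α → ℝ} {R : ℝ}
    (h : ∀ᶠ k in (l : Filter α), |f k| ≤ R) : ∃ x, Tendsto f l (nhds x) := by
  obtain ⟨x, -, hx⟩ := (isCompact_Icc (a := -R) (b := R)).ultrafilter_le_nhds (l.map f) (by
    rw [le_principal_iff]
    change ∀ᶠ k in (l : Filter α), f k ∈ Icc (-R) R
    exact h.mono fun k hk => abs_le.1 hk)
  exact ⟨x, hx⟩

theorem exists_tendsto_SL2R {α : Type*} (l : Ultrafilter α) {f : α → SL2R} {R : ℝ}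
    (h : ∀ᶠ k in (l : Filter α), ∀ i j, |f k i j| ≤ R) : ∃ q, Tendsto f l (nhds q) := by
  choose M hM using fun i j => exists_tendsto_real l (f := fun k => f k i j) (R := R)
    (h.mono fun k hk => hk i j)
  have hdet : M 0 0 * M 1 1 - M 0 1 * M 1 0 = 1 := by
    have h1 : Tendsto (fun k => f k 0 0 * f k 1 1 - f k 0 1 * f k 1 0) l
        (nhds (M 0 0 * M 1 1 - M 0 1 * M 1 0)) :=
      ((hM 0 0).mul (hM 1 1)).sub ((hM 0 1).mul (hM 1 0))
    simp only [det_SL2R] at h1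
    exact tendsto_nhds_unique h1 tendsto_const_nhds
  exact ⟨⟨Matrix.of M, by rw [Matrix.det_fin_two]; exact hdet⟩, tendsto_SL2R_iff.2 hM⟩

theorem exists_tendsto_of_thick {α : Type*} (l : Ultrafilter α) {f : α → SL2R} {ε : ℝ} (hε : 0 < ε)
    (h : ∀ᶠ k in (l : Filter α), Thick ε (f k)) :
    ∃ (γ : α → SL2Z) (q : SL2R), Tendsto (fun k => f k * ofInt (γ k)) l (nhds q) := by
  have : ∀ k, ∃ γ : SL2Z, Thick ε (f k) → ∀ i j, |(f k * ofInt γ) i j| ≤ 2 / ε := by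
    intro k
    by_cases hk : Thick ε (f k)
    · obtain ⟨γ, hγ⟩ := exists_bounded_of_thick hε hk
      exact ⟨γ, fun _ => hγ⟩
    · exact ⟨1, fun h => absurd h hk⟩
  choose γ hγ using this
  obtain ⟨q, hq⟩ := exists_tendsto_SL2R l (f := fun k => f k * ofInt (γ k)) (h.mono hγ)
  exact ⟨γ, q, hq⟩

instance : ContinuousInv SL2R where
  continuous_inv := by
    rw [continuous_SL2R_iff]
    have e : ∀ (g : SL2R) (i j : Fin 2), (g⁻¹ : SL2R) i j = !![g 1 1, -g 0 1; -g 1 0, g 0 0] i j := by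
      intro g i j
      rw [Matrix.SpecialLinearGroup.coe_inv, Matrix.adjugate_fin_two]
    intro i j
    simp only [e]
    fin_cases i <;> fin_cases j
    · exact continuous_SL2R_apply 1 1
    · exact (continuous_SL2R_apply 0 1).neg
    · exact (continuous_SL2R_apply 1 0).neg
    · exact continuous_SL2R_apply 0 0

/-- All digit shifts of the forward orbit of `q` under the diagonal flow stay thick. -/
def Persist (β : ℕ) (ε : ℝ) (q : SL2R) : Prop :=
  ∀ (m : ℤ) (I : Finset ℕ),
    Thick ε (hu (∑ i ∈ I, ((β : ℝ) ^ 2) ^ i) * (g2 (m * Real.log β) * q))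

theorem exp_two_mul_log {β : ℕ} (hβ : 2 ≤ β) (m : ℤ) :
    Real.exp (2 * (m * Real.log β)) = ((β : ℝ) ^ 2) ^ m := by
  have hβ0 : (0 : ℝ) < β := by positivity
  rw [← Real.exp_log (show (0 : ℝ) < ((β : ℝ) ^ 2) ^ m by positivity), Real.log_zpow, Real.log_pow]
  congr 1; push_cast; ring

theorem g2_mul_hu_log {β : ℕ} (hβ : 2 ≤ β) (m : ℤ) (s : ℝ) :
    g2 (m * Real.log β) * hu s = hu (((β : ℝ) ^ 2) ^ m * s) * g2 (m * Real.log β) := by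
  rw [g2_mul_hu, exp_two_mul_log hβ]

theorem Persist.ne_zero {β : ℕ} (hβ : 2 ≤ β) {ε : ℝ} (hε : 0 < ε) {q : SL2R} (h : Persist β ε q)
    {m n : ℤ} (hmn : ¬(m = 0 ∧ n = 0)) : q 1 0 * m + q 1 1 * n ≠ 0 := by
  intro h0
  have hβ1 : (1 : ℝ) < β := by exact_mod_cast hβ
  obtain ⟨k, hk⟩ := pow_unbounded_of_one_lt (|q 0 0 * m + q 0 1 * n| / ε) hβ1
  have := h (-k) ∅ m n hmn
  have he : Real.exp (-(k : ℝ) * Real.log β) = ((β : ℝ) ^ k)⁻¹ := by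
    rw [neg_mul, Real.exp_neg, mul_comm, Real.exp_mul, Real.exp_log (by positivity),
      Real.rpow_natCast]
  rw [Finset.sum_empty, hu_zero, one_mul] at this
  simp only [mul_SL2R_apply, g2_00, g2_01, g2_10, g2_11, Int.cast_neg, Int.cast_natCast] at this
  rw [show ∀ E : ℝ, (E * q 0 0 + 0 * q 1 0) * m + (E * q 0 1 + 0 * q 1 1) * n =
    E * (q 0 0 * m + q 0 1 * n) from fun E => by ring, show ∀ E : ℝ,
    (0 * q 0 0 + E * q 1 0) * m + (0 * q 0 1 + E * q 1 1) * n =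
    E * (q 1 0 * m + q 1 1 * n) from fun E => by ring, h0, mul_zero, abs_zero, he,
    max_eq_left (abs_nonneg _), abs_mul, abs_of_pos (by positivity), inv_mul_eq_div,
    le_div_iff₀ (by positivity)] at this
  rw [div_lt_iff₀ hε] at hk
  linarith

theorem persist_of_tendsto {β : ℕ} (hβ : 2 ≤ β) {ε : ℝ} {p Q : SL2R} (hp : Persist β ε p)
    {α : Type*} {l : Filter α} [NeBot l] (J : α → Finset ℕ)
    (hJ : ∀ B : ℕ, ∀ᶠ k in l, ∀ j ∈ J k, B ≤ j) (γ : α → SL2Z)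
    (hQ : Tendsto (fun k => hu (∑ i ∈ J k, ((β : ℝ) ^ 2) ^ i) * p * ofInt (γ k)) l (nhds Q)) :
    Persist β ε Q := by
  intro m I
  have hβ0 : (0 : ℝ) < β := by positivity
  refine thick_of_tendsto (tendsto_const_nhds.mul (tendsto_const_nhds.mul hQ)) ?_
  filter_upwards [hJ (m.natAbs + I.sup id + 1)] with k hk
  have hinj : Set.InjOn (fun j : ℕ => ((j : ℤ) + m).toNat) (J k) := by
    intro x hx y hy hxy
    have h1 := hk x hx
    have h2 := hk y hy
    simp only at hxy
    omega
  have hdisj : Disjoint I ((J k).image fun j : ℕ => ((j : ℤ) + m).toNat) := by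
    rw [Finset.disjoint_left]
    intro x hx hx'
    obtain ⟨j, hj, rfl⟩ := Finset.mem_image.1 hx'
    have h1 := hk j hj
    have h2 : ((j : ℤ) + m).toNat ≤ I.sup id := Finset.le_sup (f := id) hx
    omega
  have key := hp m (I ∪ (J k).image fun j : ℕ => ((j : ℤ) + m).toNat)
  rw [Finset.sum_union hdisj, Finset.sum_image hinj, ← hu_mul_hu] at key
  have hs : ∑ j ∈ J k, ((β : ℝ) ^ 2) ^ ((j : ℤ) + m).toNat =
      ((β : ℝ) ^ 2) ^ m * ∑ j ∈ J k, ((β : ℝ) ^ 2) ^ j := by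
    rw [Finset.mul_sum]
    refine Finset.sum_congr rfl fun j hj => ?_
    have h1 := hk j hj
    rw [← zpow_natCast, Int.toNat_of_nonneg (by omega), zpow_add₀ (by positivity), zpow_natCast,
      mul_comm]
  rw [hs] at key
  have := key.mul_ofInt (γ k)
  convert this using 1
  simp only [mul_assoc]
  rw [← mul_assoc (g2 _) (hu _), g2_mul_hu_log hβ]
  simp only [mul_assoc]

theorem exists_scale {b p r δ : ℝ} (hb : 4 ≤ b) (hpr : ¬(p = 0 ∧ r = 0)) (K : ℕ)
    (hp : |p| * b ^ (2 * K + 1) < 2 * δ) (hr : |r| * (b ^ (2 * K + 1)) ^ 2 < 2 * δ) :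
    ∃ s, K ≤ s ∧ δ ≤ |p * b ^ (2 * s + 1) - r * (b ^ (2 * s + 1)) ^ 2| ∧
      |p * b ^ (2 * s + 1) - r * (b ^ (2 * s + 1)) ^ 2| ≤ 4 * b ^ 8 * δ ∧
      |r| * (b ^ (2 * s + 1)) ^ 2 ≤ 2 * b ^ 8 * δ := by
  have hb0 : 0 < b := by linarith
  have hδ : 0 < δ := by nlinarith [abs_nonneg p, pow_pos hb0 (2 * K + 1)]
  have hex : ∃ s, K ≤ s ∧ (2 * δ ≤ |p| * b ^ (2 * s + 1) ∨ 2 * δ ≤ |r| * (b ^ (2 * s + 1)) ^ 2) := by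
    have hgrow : ∀ c : ℝ, 0 < c → ∃ s, K ≤ s ∧ 2 * δ ≤ c * b ^ (2 * s + 1) := by
      intro c hc
      obtain ⟨k, hk⟩ := pow_unbounded_of_one_lt (2 * δ / c) (show 1 < b by linarith)
      refine ⟨K + k, by omega, ?_⟩
      rw [div_lt_iff₀ hc, mul_comm (b ^ k)] at hk
      refine hk.le.trans ?_
      gcongr
      · linarith
      · omega
    by_cases h : p = 0
    · have hr0 : r ≠ 0 := fun h' => hpr ⟨h, h'⟩
      obtain ⟨s, hs, h2⟩ := hgrow |r| (abs_pos.2 hr0)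
      refine ⟨s, hs, Or.inr (h2.trans ?_)⟩
      gcongr
      rw [sq]
      have : 1 ≤ b ^ (2 * s + 1) := one_le_pow₀ (by linarith)
      nlinarith
    · obtain ⟨s, hs, h2⟩ := hgrow |p| (abs_pos.2 h)
      exact ⟨s, hs, Or.inl h2⟩
  classical
  obtain ⟨hK, hs⟩ := Nat.find_spec hex
  have hmin := fun m => @Nat.find_min _ _ hex m
  set s := Nat.find hex
  have hsK : K < s := by
    rcases hK.lt_or_eq with h | h
    · exact h
    · rw [← h] at hs; rcases hs with hs | hs <;> linarith
  have hprev := hmin (s - 1) (by omega)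
  push Not at hprev
  obtain ⟨hp1, hr1⟩ := hprev (by omega)
  have hu' : b ^ (2 * s + 1) = b ^ 2 * b ^ (2 * (s - 1) + 1) := by
    rw [← pow_add]; congr 1; omega
  set v := b ^ (2 * (s - 1) + 1) with hv
  have hv0 : 0 < v := by positivity
  set u := b ^ (2 * s + 1) with hu
  have hu0 : 0 < u := by positivity
  have hpu : |p| * u < b ^ 2 * (2 * δ) := by
    rw [hu']; nlinarith [mul_lt_mul_of_pos_left hp1 (pow_pos hb0 2)]
  have hru : |r| * u ^ 2 < b ^ 4 * (2 * δ) := by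
    rw [hu']; nlinarith [mul_lt_mul_of_pos_left hr1 (pow_pos hb0 4)]
  have hb2 : (16 : ℝ) ≤ b ^ 2 := by nlinarith
  have hb4 : b ^ 2 ≤ b ^ 4 := pow_le_pow_right₀ (by linarith) (by norm_num)
  have hb8 : b ^ 4 ≤ b ^ 8 := pow_le_pow_right₀ (by linarith) (by norm_num)
  have habs : ∀ w : ℝ, 0 < w → |p * w - r * w ^ 2| ≤ |p| * w + |r| * w ^ 2 := fun w hw => by
    refine (abs_sub _ _).trans_eq ?_
    rw [abs_mul, abs_mul, abs_of_pos hw, abs_of_pos (pow_pos hw 2)]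
  by_cases hcase : δ ≤ |p * u - r * u ^ 2|
  · exact ⟨s, hsK.le, hcase, (habs u hu0).trans (by nlinarith), by nlinarith⟩
  · push Not at hcase
    have hu2 : b ^ (2 * (s + 1) + 1) = b ^ 2 * u := by rw [hu, ← pow_add]; congr 1; omega
    have hru' : δ ≤ |r| * u ^ 2 := by
      rcases hs with hs | hs
      · have h1 : |p * u| ≤ |p * u - r * u ^ 2| + |r * u ^ 2| := by
          have := abs_add_le (p * u - r * u ^ 2) (r * u ^ 2)
          rwa [sub_add_cancel] at this
        rw [abs_mul, abs_mul, abs_of_pos hu0, abs_of_pos (pow_pos hu0 2)] at h1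
        linarith
      · linarith
    refine ⟨s + 1, by omega, ?_, ?_, ?_⟩
    · rw [hu2]
      have h1 : |(b ^ 4 - b ^ 2) * (r * u ^ 2)| ≤
          |b ^ 2 * (p * u - r * u ^ 2)| + |p * (b ^ 2 * u) - r * (b ^ 2 * u) ^ 2| := by
        refine (abs_sub (b ^ 2 * (p * u - r * u ^ 2)) (p * (b ^ 2 * u) - r * (b ^ 2 * u) ^ 2)).trans'
          (le_of_eq ?_)
        congr 1; ring
      rw [abs_mul, abs_mul, abs_mul, abs_of_nonneg (show 0 ≤ b ^ 4 - b ^ 2 by linarith),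
        abs_of_pos (pow_pos hb0 2), abs_of_pos (pow_pos hu0 2)] at h1
      have h2 : (b ^ 4 - b ^ 2) * δ ≤ (b ^ 4 - b ^ 2) * (|r| * u ^ 2) := by gcongr
      have h3 : b ^ 2 * |p * u - r * u ^ 2| ≤ b ^ 2 * δ := by gcongr
      nlinarith
    · rw [hu2]
      refine (habs _ (by positivity)).trans ?_
      have e : |p| * (b ^ 2 * u) + |r| * (b ^ 2 * u) ^ 2 = b ^ 2 * (|p| * u) + b ^ 4 * (|r| * u ^ 2) := by
        ring
      rw [e]
      have h1 : b ^ 2 * (|p| * u) ≤ b ^ 2 * (b ^ 2 * (2 * δ)) := by gcongr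
      have h2 : b ^ 4 * (|r| * u ^ 2) ≤ b ^ 4 * (b ^ 4 * (2 * δ)) := by gcongr
      nlinarith
    · rw [hu2]
      have h2 : b ^ 4 * (|r| * u ^ 2) ≤ b ^ 4 * (b ^ 4 * (2 * δ)) := by gcongr
      nlinarith

theorem exists_near_return (f : ℕ → SL2R) {ε : ℝ} (hε : 0 < ε) (hf : ∀ i, Thick ε (f i)) (K : ℕ)
    {η : ℝ} (hη : 0 < η) :
    ∃ (i i' : ℕ) (γ : SL2Z) (g : SL2R), K ≤ i ∧ i < i' ∧ f i' * ofInt γ = g * f i ∧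
      |g 0 0 - 1| < η ∧ |g 0 1| < η ∧ |g 1 0| < η ∧ |g 1 1 - 1| < η := by
  obtain ⟨γ, P, hP⟩ := exists_tendsto_of_thick (hyperfilter ℕ) hε (Eventually.of_forall hf)
  have hV : ∀ᶠ g in nhds (1 : SL2R),
      |g 0 0 - 1| < η ∧ |g 0 1| < η ∧ |g 1 0| < η ∧ |g 1 1 - 1| < η := by
    have h := fun i j => (continuous_SL2R_apply i j).tendsto (1 : SL2R)
    have h00 := ((h 0 0).sub_const 1).abs
    have h11 := ((h 1 1).sub_const 1).abs
    have h01 := (h 0 1).abs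
    have h10 := (h 1 0).abs
    simp only [Matrix.SpecialLinearGroup.coe_one, Matrix.one_apply_eq, sub_self, abs_zero,
      Matrix.one_apply, if_false, zero_ne_one, one_ne_zero] at h00 h11 h01 h10
    filter_upwards [h00.eventually_lt_const hη, h01.eventually_lt_const hη,
      h10.eventually_lt_const hη, h11.eventually_lt_const hη] with g a b c d using ⟨a, b, c, d⟩
  have hc : Tendsto (fun p : SL2R × SL2R => p.1 * p.2⁻¹) (nhds (P, P)) (nhds 1) := by
    have : Continuous fun p : SL2R × SL2R => p.1 * p.2⁻¹ :=
      continuous_fst.mul continuous_snd.inv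
    simpa using this.tendsto (P, P)
  have hW := hc.eventually hV
  rw [nhds_prod_eq] at hW
  obtain ⟨W, hWP, hW⟩ := mem_prod_self_iff.1 hW
  have hev := hP.eventually hWP
  have hlarge : ∀ K : ℕ, ∀ᶠ i in (hyperfilter ℕ : Filter ℕ), K ≤ i := fun K =>
    (Nat.hyperfilter_le_atTop) (eventually_ge_atTop K)
  obtain ⟨i, hi, hiK⟩ := (hev.and (hlarge K)).exists
  obtain ⟨i', hi', hiK'⟩ := (hev.and (hlarge (i + 1))).exists
  refine ⟨i, i', γ i' * (γ i)⁻¹, f i' * ofInt (γ i') * (f i * ofInt (γ i))⁻¹, hiK, hiK', ?_,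
    hW (mk_mem_prod hi' hi)⟩
  rw [ofInt_mul, ofInt_inv]
  group

theorem exists_shear_return {β : ℕ} (hβ : 2 ≤ β) {ε : ℝ} (hε : 0 < ε) {q : SL2R}
    (hq : Persist β ε q) {δ : ℝ} (hδ : 0 < δ) (K : ℕ) :
    ∃ (l i i' : ℕ) (γ : SL2Z) (g : SL2R), K ≤ l ∧ K ≤ i ∧ K ≤ i' ∧
      hu (((β : ℝ) ^ 2) ^ (2 * i')) * q * ofInt γ = g * (hu (((β : ℝ) ^ 2) ^ (2 * i)) * q) ∧
      |g 0 0 - 1| ≤ 1 / (K + 1) ∧ |g 0 1| ≤ 1 / (K + 1) ∧ |g 1 1 - 1| ≤ 1 / (K + 1) ∧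
      δ ≤ |(g 1 1 - g 0 0) * ((β : ℝ) ^ 2) ^ (2 * l + 1) - g 1 0 * (((β : ℝ) ^ 2) ^ (2 * l + 1)) ^ 2| ∧
      |(g 1 1 - g 0 0) * ((β : ℝ) ^ 2) ^ (2 * l + 1) - g 1 0 * (((β : ℝ) ^ 2) ^ (2 * l + 1)) ^ 2|
        ≤ 4 * ((β : ℝ) ^ 2) ^ 8 * δ ∧
      |g 1 0| * (((β : ℝ) ^ 2) ^ (2 * l + 1)) ^ 2 ≤ 2 * ((β : ℝ) ^ 2) ^ 8 * δ := by
  set b : ℝ := (β : ℝ) ^ 2 with hb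
  have hβ2 : (2 : ℝ) ≤ β := by exact_mod_cast hβ
  have hb4 : 4 ≤ b := by rw [hb]; nlinarith
  have hb0 : 0 < b := by linarith
  have hth : ∀ i : ℕ, Thick ε (hu (b ^ (2 * i)) * q) := fun i => by
    have := hq 0 {2 * i}
    simpa [g2_zero] using this
  set v := b ^ (2 * K + 1) with hv
  have hv1 : 1 ≤ v := one_le_pow₀ (by linarith)
  set η : ℝ := min (1 / (K + 1)) (δ / (2 * v ^ 2)) with hη
  have hη0 : 0 < η := by positivity
  have hη1 : η ≤ 1 / (K + 1) := min_le_left _ _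
  have hη2 : η * v ^ 2 ≤ δ / 2 := by
    have : η ≤ δ / (2 * v ^ 2) := min_le_right _ _
    rw [le_div_iff₀ (by positivity)] at this
    linarith
  have hηone : η ≤ 1 := hη1.trans (by
    rw [div_le_one (by positivity)]; linarith [Nat.cast_nonneg (α := ℝ) K])
  obtain ⟨i, i', γ, g, hKi, hii', hg, h00, h01, h10, h11⟩ := exists_near_return _ hε hth K hη0
  have hne : ¬(g 1 1 - g 0 0 = 0 ∧ g 1 0 = 0) := by
    rintro ⟨h1, h2⟩
    have hd := det_SL2R g
    have hg1 : g 0 0 = 1 := by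
      have e : g 1 1 = g 0 0 := by linarith
      rw [e, h2] at hd
      have h3 : (g 0 0 - 1) * (g 0 0 + 1) = 0 := by linarith
      rcases mul_eq_zero.1 h3 with h | h
      · linarith
      · rw [abs_lt] at h00; linarith
    have hgu : g = hu (g 0 1) := by
      apply ext_SL2R <;> simp [hg1, h2]
      linarith
    have hS : q * ofInt γ = hu (g 0 1 + b ^ (2 * i) - b ^ (2 * i')) * q := by
      have h3 : hu (b ^ (2 * i')) * (q * ofInt γ) =
          hu (b ^ (2 * i')) * (hu (g 0 1 + b ^ (2 * i) - b ^ (2 * i')) * q) := by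
        rw [← mul_assoc, hg, ← mul_assoc (hu _) (hu _), hu_mul_hu, hgu, ← mul_assoc, hu_mul_hu]
        congr 2
        simp
      exact mul_left_cancel h3
    have hSne : g 0 1 + b ^ (2 * i) - b ^ (2 * i') ≠ 0 := by
      have h3 : b ^ (2 * i) * b ^ 2 ≤ b ^ (2 * i') := by
        rw [← pow_add]; exact pow_le_pow_right₀ (by linarith) (by omega)
      have h4 : 1 ≤ b ^ (2 * i) := one_le_pow₀ (by linarith)
      have h5 := (abs_lt.1 h01).2
      have h6 : b ^ (2 * i) * 16 ≤ b ^ (2 * i) * b ^ 2 := by gcongr; nlinarith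
      intro h7
      linarith
    set S := g 0 1 + b ^ (2 * i) - b ^ (2 * i')
    have hq10 : q 1 0 ≠ 0 := by
      have := hq.ne_zero hβ hε (m := 1) (n := 0) (by simp)
      simpa using this
    have e10 : (q * ofInt γ) 1 0 = q 1 0 := by rw [hS, mul_SL2R_apply]; simp
    have e00 : (q * ofInt γ) 0 0 = q 0 0 + S * q 1 0 := by rw [hS, mul_SL2R_apply]; simp
    simp only [mul_SL2R_apply, ofInt_apply] at e10 e00
    by_cases h0 : γ 0 0 - 1 = 0 ∧ γ 1 0 = 0
    · have h3 : γ 0 0 = 1 := by linarith [h0.1]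
      rw [h3, h0.2] at e00
      have : S * q 1 0 = 0 := by push_cast at e00; linarith
      exact mul_ne_zero hSne hq10 this
    · apply hq.ne_zero hβ hε h0
      push_cast
      linarith
  obtain ⟨s, hs, h1, h2, h3⟩ := exists_scale (δ := δ) hb4 hne K (by
    have h3 : |g 1 1 - g 0 0| ≤ 2 * η := by
      rw [abs_lt] at h00 h11
      rw [abs_le]; constructor <;> linarith
    have h4 : |g 1 1 - g 0 0| * v ≤ 2 * η * v := by gcongr
    nlinarith) (by
    have : |g 1 0| * v ^ 2 ≤ η * v ^ 2 := by gcongr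
    linarith)
  exact ⟨s, i, i', γ, g, hs, hKi, by omega, hg, h00.le.trans hη1, h01.le.trans hη1,
    h11.le.trans hη1, h1, h2, h3⟩

theorem good_step {β : ℕ} (hβ : 2 ≤ β) {ε : ℝ} (hε : 0 < ε) {A : Set ℝ} {q : SL2R} (h0 : (0 : ℝ) ∈ A)
    (hq : ∀ a ∈ A, Persist β ε (hu a * q)) {δ : ℝ} (hδ : 0 < δ) :
    ∃ (τ : ℝ) (Q : SL2R), δ ≤ τ ∧ τ ≤ 4 * ((β : ℝ) ^ 2) ^ 8 * δ ∧
      ∀ a ∈ A, Persist β ε (hu a * Q) ∧ Persist β ε (hu (a + τ) * Q) := by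
  have hq0 : Persist β ε q := by simpa [hu_zero] using hq 0 h0
  choose l i i' γ g hKl hKi hKi' hg h00 h01 h11 hP1 hP2 hP3 using
    exists_shear_return hβ hε hq0 hδ
  set b : ℝ := (β : ℝ) ^ 2 with hb
  have hβ2 : (2 : ℝ) ≤ β := by exact_mod_cast hβ
  have hb4 : 4 ≤ b := by rw [hb]; nlinarith
  set u : ℕ → ℝ := fun K => b ^ (2 * l K + 1) with hu_def
  have huK : ∀ K : ℕ, (K : ℝ) < u K := fun K => by
    have h1 : (K : ℝ) < b ^ K := by
      have : (K : ℝ) < 2 ^ K := by exact_mod_cast Nat.lt_two_pow_self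
      exact this.trans_le (pow_le_pow_left₀ (by norm_num) (by linarith) K)
    exact h1.trans_le (pow_le_pow_right₀ (by linarith) (by have := hKl K; omega))
  have hu0 : ∀ K, 0 < u K := fun K => lt_of_le_of_lt (Nat.cast_nonneg K) (huK K)
  let U := hyperfilter ℕ
  have hUtop : (U : Filter ℕ) ≤ atTop := Nat.hyperfilter_le_atTop
  have hth : ∀ K, Thick ε (hu (u K + b ^ (2 * i K)) * q) := fun K => by
    have := hq0 0 {2 * l K + 1, 2 * i K}
    rw [Finset.sum_pair (by omega)] at this
    simpa [g2_zero] using this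
  obtain ⟨δ', Q, hQ⟩ := exists_tendsto_of_thick U hε (Eventually.of_forall hth)
  obtain ⟨τ, hτ⟩ := exists_tendsto_real U (Eventually.of_forall hP2)
  have hτ1 : δ ≤ |τ| := ge_of_tendsto hτ.abs (Eventually.of_forall hP1)
  have hτ2 : |τ| ≤ 4 * b ^ 8 * δ := le_of_tendsto hτ.abs (Eventually.of_forall hP2)
  have hK0 : Tendsto (fun K : ℕ => 1 / ((K : ℝ) + 1)) U (nhds 0) :=
    tendsto_one_div_add_atTop_nhds_zero_nat.mono_left hUtop
  have hsq : ∀ {f : ℕ → ℝ}, (∀ K, |f K| ≤ 1 / ((K : ℝ) + 1)) → Tendsto f U (nhds 0) := fun h =>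
    squeeze_zero_norm h hK0
  have hu_inv : Tendsto (fun K => (u K)⁻¹) U (nhds 0) :=
    tendsto_inv_atTop_zero.comp ((tendsto_atTop_mono (fun K => (huK K).le)
      tendsto_natCast_atTop_atTop).mono_left hUtop)
  have hcu : Tendsto (fun K => g K 1 0 * u K) U (nhds 0) := by
    refine squeeze_zero_norm (a := fun K => 2 * b ^ 8 * δ * (u K)⁻¹) (fun K => ?_) ?_
    · rw [Real.norm_eq_abs, abs_mul, abs_of_pos (hu0 K), ← div_eq_mul_inv, le_div_iff₀ (hu0 K)]
      calc |g K 1 0| * u K * u K = |g K 1 0| * u K ^ 2 := by ring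
        _ ≤ _ := hP3 K
    · simpa using hu_inv.const_mul (2 * b ^ 8 * δ)
  have hc : Tendsto (fun K => g K 1 0) U (nhds 0) := by
    have := hcu.mul hu_inv
    rw [zero_mul] at this
    refine this.congr fun K => ?_
    rw [mul_assoc, mul_inv_cancel₀ (hu0 K).ne', mul_one]
  have hgτ : Tendsto (fun K => hu (u K) * g K * hu (-u K)) U (nhds (hu τ)) := by
    rw [tendsto_SL2R_iff]
    intro r c
    simp only [mul_SL2R_apply]
    fin_cases r <;> fin_cases c
    · have h1 := ((hsq h00).add_const 1).add hcu
      simp only [zero_add, add_zero] at h1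
      refine h1.congr fun K => ?_
      simp; ring
    · have h1 := (hsq h01).add hτ
      rw [zero_add] at h1
      refine h1.congr fun K => ?_
      simp [hu_def]; ring
    · exact hc.congr fun K => by simp
    · have h1 := ((hsq h11).add_const 1).sub hcu
      simp only [zero_add, sub_zero] at h1
      refine h1.congr fun K => ?_
      simp; ring
  have hQ' : Tendsto (fun K => hu (u K + b ^ (2 * i' K)) * q * ofInt (γ K * δ' K)) U
      (nhds (hu τ * Q)) := by
    refine (hgτ.mul hQ).congr fun K => ?_
    rw [ofInt_mul, ← hu_mul_hu (u K) (b ^ (2 * i' K))]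
    calc hu (u K) * g K * hu (-u K) * (hu (u K + b ^ (2 * i K)) * q * ofInt (δ' K))
        = hu (u K) * (g K * ((hu (-u K) * hu (u K + b ^ (2 * i K))) * q)) * ofInt (δ' K) := by
          simp only [mul_assoc]
      _ = hu (u K) * (hu (b ^ (2 * i' K)) * q * ofInt (γ K)) * ofInt (δ' K) := by
          rw [hu_mul_hu, neg_add_cancel_left, hg K]
      _ = _ := by simp only [mul_assoc]
  have hshift : ∀ (J : ℕ → ℕ), (∀ K, K ≤ J K) → ∀ (η : ℕ → SL2Z) (R : SL2R),
      Tendsto (fun K => hu (u K + b ^ (2 * J K)) * q * ofInt (η K)) U (nhds R) →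
      ∀ a ∈ A, Persist β ε (hu a * R) := by
    intro J hJ η R hR a ha
    refine persist_of_tendsto hβ (hq a ha) (l := (U : Filter ℕ)) (fun K => {2 * l K + 1, 2 * J K})
      (fun B => ?_) η ?_
    · filter_upwards [hUtop (eventually_ge_atTop B)] with K hK j hj
      have h1 := hKl K
      have h2 := hJ K
      have h3 : B ≤ K := hK
      simp only [Finset.mem_insert, Finset.mem_singleton] at hj
      omega
    · refine (hR.const_mul (hu a)).congr fun K => ?_
      rw [Finset.sum_pair (by omega), ← mul_assoc (hu _) (hu a), hu_mul_hu, ← mul_assoc, ← mul_assoc,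
        hu_mul_hu, add_comm a]
  have hA1 := hshift i hKi δ' Q hQ
  have hA2 := hshift i' hKi' _ _ hQ'
  rcases le_or_gt 0 τ with hτ0 | hτ0
  · rw [abs_of_nonneg hτ0] at hτ1 hτ2
    refine ⟨τ, Q, hτ1, hτ2, fun a ha => ⟨hA1 a ha, ?_⟩⟩
    rw [← hu_mul_hu, mul_assoc]
    exact hA2 a ha
  · rw [abs_of_neg hτ0] at hτ1 hτ2
    refine ⟨-τ, hu τ * Q, hτ1, hτ2, fun a ha => ⟨hA2 a ha, ?_⟩⟩
    rw [← mul_assoc, hu_mul_hu, neg_add_cancel_right]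
    exact hA1 a ha

theorem persist_of_tendsto_nhds {β : ℕ} {ε : ℝ} {α : Type*} {l : Filter α} [NeBot l] {f : α → SL2R}
    {Q : SL2R} (hf : Tendsto f l (nhds Q)) (h : ∀ᶠ k in l, Persist β ε (f k)) : Persist β ε Q :=
  fun m I => thick_of_tendsto (tendsto_const_nhds.mul (tendsto_const_nhds.mul hf))
    (h.mono fun _ hk => hk m I)

theorem Persist.mul_ofInt {β : ℕ} {ε : ℝ} {q : SL2R} (h : Persist β ε q) (γ : SL2Z) :
    Persist β ε (q * ofInt γ) := fun m I => by
  have := (h m I).mul_ofInt γ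
  simpa only [mul_assoc] using this

theorem Persist.thick {β : ℕ} {ε : ℝ} {q : SL2R} (h : Persist β ε q) : Thick ε q := by
  simpa [hu_zero, g2_zero] using h 0 ∅

theorem good_dense {β : ℕ} (hβ : 2 ≤ β) {ε : ℝ} (hε : 0 < ε) {q : SL2R} (hq : Persist β ε q)
    {δ : ℝ} (hδ : 0 < δ) (n : ℕ) :
    ∃ (A : Set ℝ) (Q : SL2R), (0 : ℝ) ∈ A ∧ (∀ a ∈ A, Persist β ε (hu a * Q)) ∧
      ∀ s : ℝ, 0 ≤ s → s ≤ n * δ → ∃ a ∈ A, |a - s| ≤ 4 * ((β : ℝ) ^ 2) ^ 8 * δ := by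
  induction n with
  | zero =>
    refine ⟨{0}, q, rfl, fun a ha => ?_, fun s hs hs' => ⟨0, rfl, ?_⟩⟩
    · rw [mem_singleton_iff.1 ha, hu_zero, one_mul]; exact hq
    · have : s = 0 := by simp at hs'; linarith
      rw [this, sub_zero, abs_zero]; positivity
  | succ n ih =>
    obtain ⟨A, Q, h0, hA, hdense⟩ := ih
    obtain ⟨τ, Q', h1, h2, h3⟩ := good_step hβ hε h0 hA hδ
    refine ⟨A ∪ (fun a => a + τ) '' A, Q', Or.inl h0, ?_, fun s hs hs' => ?_⟩
    · rintro a (ha | ⟨a', ha', rfl⟩)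
      · exact (h3 a ha).1
      · exact (h3 a' ha').2
    · by_cases hsn : s ≤ n * δ
      · obtain ⟨a, ha, h⟩ := hdense s hs hsn
        exact ⟨a, Or.inl ha, h⟩
      · by_cases hsτ : τ ≤ s
        · obtain ⟨a, ha, h⟩ := hdense (s - τ) (by linarith) (by push_cast at hs'; linarith)
          refine ⟨a + τ, Or.inr ⟨a, ha, rfl⟩, ?_⟩
          rwa [show a + τ - s = a - (s - τ) by ring]
        · refine ⟨0, Or.inl h0, ?_⟩
          rw [zero_sub, abs_neg, abs_of_nonneg hs]
          linarith

theorem exists_persist_line {β : ℕ} (hβ : 2 ≤ β) {ε : ℝ} (hε : 0 < ε) {q : SL2R}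
    (hq : Persist β ε q) : ∃ Q : SL2R, ∀ s : ℝ, Persist β ε (hu s * Q) := by
  set C : ℝ := 4 * ((β : ℝ) ^ 2) ^ 8 with hC
  have hC0 : 0 < C := by positivity
  have hkey : ∀ k : ℕ, ∃ Q : SL2R, Persist β ε Q ∧ ∀ s : ℝ, |s| ≤ k →
      ∃ s', |s' - s| ≤ 2 * (C * (1 / ((k : ℝ) + 1))) ∧ Persist β ε (hu s' * Q) := by
    intro k
    have hδ : (0 : ℝ) < 1 / ((k : ℝ) + 1) := by positivity
    obtain ⟨n, hn⟩ := exists_nat_ge (2 * (k : ℝ) * (k + 1))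
    obtain ⟨A, Q, -, hA, hd⟩ := good_dense hβ hε hq hδ n
    have hn' : 2 * (k : ℝ) ≤ n * (1 / ((k : ℝ) + 1)) := by
      rw [mul_one_div, le_div_iff₀ (by positivity)]; exact hn
    have hk0 : (0 : ℝ) ≤ k := Nat.cast_nonneg k
    obtain ⟨a, ha, hak⟩ := hd k hk0 (by linarith)
    refine ⟨hu a * Q, hA a ha, fun s hs => ?_⟩
    rw [abs_le] at hs
    obtain ⟨a', ha', hak'⟩ := hd (k + s) (by linarith) (by linarith)
    refine ⟨a' - a, ?_, ?_⟩
    · rw [show a' - a - s = (a' - (k + s)) - (a - k) by ring]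
      refine (abs_sub _ _).trans ?_
      linarith
    · rw [← mul_assoc, hu_mul_hu, sub_add_cancel]; exact hA a' ha'
  choose Q hQ hQs using hkey
  obtain ⟨γ, R, hR⟩ := exists_tendsto_of_thick (hyperfilter ℕ) hε
    (Eventually.of_forall fun k => (hQ k).thick)
  refine ⟨R, fun s => ?_⟩
  have hex : ∀ k : ℕ, ∃ s', |s| ≤ k → |s' - s| ≤ 2 * (C * (1 / ((k : ℝ) + 1))) ∧
      Persist β ε (hu s' * Q k) := by
    intro k
    by_cases hk : |s| ≤ k
    · obtain ⟨s', h⟩ := hQs k s hk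
      exact ⟨s', fun _ => h⟩
    · exact ⟨0, fun h => absurd h hk⟩
  choose s' hs' using hex
  obtain ⟨k₀, hk₀⟩ := exists_nat_ge |s|
  have hev : ∀ᶠ k : ℕ in (hyperfilter ℕ : Filter ℕ), |s| ≤ k := by
    filter_upwards [Nat.hyperfilter_le_atTop (eventually_ge_atTop k₀)] with k hk
    exact hk₀.trans (by exact_mod_cast hk)
  have hlim : Tendsto s' (hyperfilter ℕ : Filter ℕ) (nhds s) := by
    rw [tendsto_iff_norm_sub_tendsto_zero]
    refine squeeze_zero' (Eventually.of_forall fun k => norm_nonneg _)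
      (g := fun k : ℕ => 2 * (C * (1 / ((k : ℝ) + 1)))) (hev.mono fun k hk => (hs' k hk).1) ?_
    have := (tendsto_one_div_add_atTop_nhds_zero_nat (𝕜 := ℝ)).mono_left
      Nat.hyperfilter_le_atTop
    simpa using (this.const_mul C).const_mul 2
  refine persist_of_tendsto_nhds (((continuous_hu.tendsto s).comp hlim).mul hR) ?_
  filter_upwards [hev] with k hk
  have := (hs' k hk).2.mul_ofInt (γ k)
  simpa only [mul_assoc, Function.comp_apply] using this

theorem exists_small_second_coordinate (q : SL2R) {ε : ℝ} (hε : 0 < ε) :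
    ∃ m n : ℤ, ¬(m = 0 ∧ n = 0) ∧ |q 1 0 * m + q 1 1 * n| < ε := by
  by_cases h0 : q 1 0 = 0
  · exact ⟨1, 0, by simp, by simpa [h0] using hε⟩
  · obtain ⟨N, hN⟩ := exists_nat_gt (|q 1 0| / ε)
    obtain ⟨j, k, hk, -, hjk⟩ := Real.exists_int_int_abs_mul_sub_le (q 1 1 / q 1 0)
      (show 0 < N + 1 by omega)
    refine ⟨-j, k, by omega, ?_⟩
    have h1 : q 1 0 * ((-j : ℤ) : ℝ) + q 1 1 * k = q 1 0 * (k * (q 1 1 / q 1 0) - j) := by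
      push_cast; field_simp; ring
    rw [h1, abs_mul]
    have h2 : |q 1 0| * |(k : ℝ) * (q 1 1 / q 1 0) - j| ≤ |q 1 0| * (1 / (((N + 1 : ℕ) : ℝ) + 1)) := by
      gcongr
    refine h2.trans_lt ?_
    rw [div_lt_iff₀ hε] at hN
    rw [mul_one_div, div_lt_iff₀ (by positivity)]
    push_cast
    nlinarith

theorem not_persist {β : ℕ} (hβ : 2 ≤ β) {ε : ℝ} (hε : 0 < ε) (q : SL2R) : ¬ Persist β ε q := by
  intro hq
  obtain ⟨Q, hQ⟩ := exists_persist_line hβ hε hq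
  obtain ⟨m, n, hmn, hlt⟩ := exists_small_second_coordinate Q hε
  have hQ0 : Persist β ε Q := by simpa [hu_zero] using hQ 0
  have hne := hQ0.ne_zero hβ hε hmn
  set η := Q 1 0 * m + Q 1 1 * n with hη
  have := (hQ (-(Q 0 0 * m + Q 0 1 * n) / η)).thick m n hmn
  simp only [mul_SL2R_apply, hu_00, hu_01, hu_10, hu_11] at this
  set s := -(Q 0 0 * m + Q 0 1 * n) / η with hs
  rw [show (1 * Q 0 0 + s * Q 1 0) * (m : ℝ) + (1 * Q 0 1 + s * Q 1 1) * n =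
    (Q 0 0 * m + Q 0 1 * n) + s * η by rw [hη]; ring, hs, div_mul_cancel₀ _ hne,
    show (0 * Q 0 0 + 1 * Q 1 0) * (m : ℝ) + (0 * Q 0 1 + 1 * Q 1 1) * n = η by rw [hη]; ring,
    add_neg_cancel, abs_zero, max_eq_right (abs_nonneg _)] at this
  linarith

theorem exists_not_thick {β : ℕ} (hβ : 2 ≤ β) {ε : ℝ} (hε : 0 < ε) (y : SL2R) :
    ∃ j : ℕ, ∃ I ⊆ Finset.range j,
      ¬ Thick ε (hu (∑ i ∈ I, ((β : ℝ) ^ 2) ^ i) * (g2 (j * Real.log β) * y)) := by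
  by_contra! h
  have hth : ∀ j : ℕ, Thick ε (g2 (j * Real.log β) * y) := fun j => by
    simpa [hu_zero] using h j ∅ (by simp)
  obtain ⟨γ, Q, hQ⟩ := exists_tendsto_of_thick (hyperfilter ℕ) hε (Eventually.of_forall hth)
  refine not_persist hβ hε Q fun m I => ?_
  refine thick_of_tendsto (tendsto_const_nhds.mul (tendsto_const_nhds.mul hQ)) ?_
  filter_upwards [Nat.hyperfilter_le_atTop (eventually_ge_atTop (m.natAbs + I.sup id + 1))] with j hj
  have hj' : m.natAbs + I.sup id + 1 ≤ j := hj
  have := (h ((j : ℤ) + m).toNat I (fun x hx => by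
    have h2 : x ≤ I.sup id := Finset.le_sup (f := id) hx
    rw [Finset.mem_range]; omega)).mul_ofInt (γ j)
  convert this using 1
  have hc : (((j : ℤ) + m).toNat : ℝ) = j + m := by
    have : ((((j : ℤ) + m).toNat : ℤ) : ℝ) = ((j + m : ℤ) : ℝ) := by
      rw [Int.toNat_of_nonneg (by omega)]
    push_cast at this
    exact this
  simp only [mul_assoc]
  rw [← mul_assoc (g2 _) (g2 _), g2_mul_g2, hc, show (m : ℝ) * Real.log β + j * Real.log β =
    (j + m) * Real.log β by ring]

theorem exists_mem_lower_left_ne_zero {W : Set SL2R} (hne : W.Nonempty)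
    (hW : ∀ g ∈ W, ∀ γ, g * ofInt γ ∈ W) : ∃ g ∈ W, g 1 0 ≠ 0 := by
  obtain ⟨g, hg⟩ := hne
  by_cases h : g 1 0 = 0
  · refine ⟨_, hW g hg ModularGroup.S, ?_⟩
    have hd := det_SL2R g
    have e : ofInt ModularGroup.S 1 0 = 1 := by rw [ofInt_apply]; simp [ModularGroup.S]
    rw [mul_SL2R_apply, h, e, zero_mul, zero_add, mul_one]
    intro h'
    rw [h, h'] at hd; norm_num at hd
  · exact ⟨g, hg, h⟩

/-- The matrix with first column `(A, C)` and bottom row `(C, D)`. -/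
def ofThree (A C D : ℝ) (hC : C ≠ 0) : SL2R :=
  ⟨!![A, (A * D - 1) / C; C, D], by rw [Matrix.det_fin_two_of]; field_simp; ring⟩

theorem tendsto_ofThree {α : Type*} {l : Filter α} {f : α → SL2R} {g : SL2R} (hC : g 1 0 ≠ 0)
    (h00 : Tendsto (fun k => f k 0 0) l (nhds (g 0 0)))
    (h10 : Tendsto (fun k => f k 1 0) l (nhds (g 1 0)))
    (h11 : Tendsto (fun k => f k 1 1) l (nhds (g 1 1))) : Tendsto f l (nhds g) := by
  have h01 : ∀ p : SL2R, p 1 0 ≠ 0 → p 0 1 = (p 0 0 * p 1 1 - 1) / p 1 0 := fun p hp => by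
    rw [eq_div_iff hp]; linear_combination -det_SL2R p
  rw [tendsto_SL2R_iff]
  intro i j
  fin_cases i <;> fin_cases j
  · exact h00
  · have := ((h00.mul h11).sub_const 1).div h10 hC
    simp only [Fin.zero_eta, Fin.mk_one]
    rw [h01 g hC]
    refine this.congr' ?_
    filter_upwards [h10.eventually_ne hC] with k hk
    exact (h01 _ hk).symm
  · exact h10
  · exact h11

theorem exists_mem_rational_slope {W : Set SL2R} (hWo : IsOpen W) (hne : W.Nonempty)
    (hW : ∀ g ∈ W, ∀ γ, g * ofInt γ ∈ W) :
    ∃ g ∈ W, ∃ (r : ℚ), g 1 0 ≠ 0 ∧ g 1 1 = g 1 0 * r := by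
  obtain ⟨g, hg, hC⟩ := exists_mem_lower_left_ne_zero hne hW
  obtain ⟨r, -, -, hr⟩ := Real.exists_seq_rat_strictMono_tendsto (g 1 1 / g 1 0)
  have ht : Tendsto (fun k => ofThree (g 0 0) (g 1 0) (g 1 0 * r k) hC) atTop (nhds g) := by
    refine tendsto_ofThree hC tendsto_const_nhds tendsto_const_nhds ?_
    have := hr.const_mul (g 1 0)
    rwa [mul_div_cancel₀ _ hC] at this
  obtain ⟨k, hk⟩ := (ht.eventually (hWo.mem_nhds hg)).exists
  exact ⟨_, hk, r k, hC, rfl⟩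

theorem exists_horocycle_mem {W : Set SL2R} (hWo : IsOpen W) (hne : W.Nonempty)
    (hW : ∀ g ∈ W, ∀ γ, g * ofInt γ ∈ W) :
    ∃ ρ₀ > 0, ∀ ρ ≥ ρ₀, ∃ s, hu s * g2 (Real.log ρ) ∈ W := by
  obtain ⟨g, hg, r, hC, hD⟩ := exists_mem_rational_slope hWo hne hW
  set p₀ : ℤ := ((r.den : ℕ) : ℤ) with hp₀
  set q₀ : ℤ := r.num with hq₀
  have hcop : IsCoprime p₀ q₀ := by
    rw [Int.isCoprime_iff_gcd_eq_one, Int.gcd_comm, hp₀, hq₀]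
    exact r.reduced
  obtain ⟨v₀, u₀', huv⟩ := hcop
  set u₀ := -u₀'
  have hdet : p₀ * v₀ - q₀ * u₀ = 1 := by simp only [u₀]; linarith
  have hp0 : (p₀ : ℝ) ≠ 0 := by simp [p₀]
  set τ : ℝ := g 1 0 / p₀ with hτ
  have hgC : g 1 0 = τ * p₀ := by rw [hτ, div_mul_cancel₀ _ hp0]
  have hgD : g 1 1 = τ * q₀ := by
    rw [hD, hgC, mul_assoc]; congr 1
    have : (r : ℝ) = (q₀ : ℝ) / (p₀ : ℝ) := by simp [p₀, q₀, Rat.cast_def]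
    rw [this]; field_simp
  set γ : ℝ → SL2Z := fun ρ => ⟨!![p₀, q₀; ⌊ρ * τ⌋ * p₀ + u₀, ⌊ρ * τ⌋ * q₀ + v₀], by
    rw [Matrix.det_fin_two_of]; linear_combination hdet⟩ with hγ
  have hfl : Tendsto (fun ρ : ℝ => (⌊ρ * τ⌋ : ℝ) / ρ) atTop (nhds τ) := by
    have h1 : Tendsto (fun ρ : ℝ => τ - ρ⁻¹) atTop (nhds τ) := by
      simpa using tendsto_inv_atTop_zero.const_sub τ
    refine tendsto_of_tendsto_of_tendsto_of_le_of_le' h1 tendsto_const_nhds ?_ ?_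
    · filter_upwards [eventually_gt_atTop 0] with ρ hρ
      rw [le_div_iff₀ hρ, sub_mul, inv_mul_cancel₀ hρ.ne']
      linarith [Int.lt_floor_add_one (ρ * τ)]
    · filter_upwards [eventually_gt_atTop 0] with ρ hρ
      rw [div_le_iff₀ hρ, mul_comm τ]
      exact Int.floor_le _
  have hrow : ∀ p u : ℤ, Tendsto (fun ρ : ℝ => ((⌊ρ * τ⌋ * p + u : ℤ) : ℝ) / ρ) atTop
      (nhds (τ * p)) := by
    intro p u
    have := (hfl.mul_const (p : ℝ)).add (tendsto_inv_atTop_zero.const_mul (u : ℝ))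
    rw [mul_zero, add_zero] at this
    refine this.congr fun ρ => ?_
    push_cast; ring
  set s : ℝ → ℝ := fun ρ => (g 0 0 - ρ * p₀) / (((⌊ρ * τ⌋ * p₀ + u₀ : ℤ) : ℝ) / ρ) with hs
  have ht : Tendsto (fun ρ => hu (s ρ) * g2 (Real.log ρ) * ofInt (γ ρ)) atTop (nhds g) := by
    refine tendsto_ofThree hC ?_ ?_ ?_
    · refine tendsto_const_nhds.congr' ?_
      filter_upwards [eventually_gt_atTop 0, (hrow p₀ u₀).eventually_ne (hgC ▸ hC)] with ρ hρ hne'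
      have h1 : s ρ * (((⌊ρ * τ⌋ * p₀ + u₀ : ℤ) : ℝ) / ρ) = g 0 0 - ρ * p₀ := by
        rw [hs]; exact div_mul_cancel₀ _ hne'
      simp only [mul_SL2R_apply, hu_00, hu_01, g2_00, g2_01, g2_10, g2_11, ofInt_apply,
        Real.exp_neg, Real.exp_log hρ]
      change g 0 0 = (1 * ρ + s ρ * 0) * (p₀ : ℝ) +
        (1 * 0 + s ρ * ρ⁻¹) * ((⌊ρ * τ⌋ * p₀ + u₀ : ℤ) : ℝ)
      linear_combination -h1
    · rw [hgC]
      refine (hrow p₀ u₀).congr' ?_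
      filter_upwards [eventually_gt_atTop 0] with ρ hρ
      simp only [mul_SL2R_apply, hu_10, hu_11, g2_00, g2_01, g2_10, g2_11, ofInt_apply,
        Real.exp_neg, Real.exp_log hρ]
      change ((⌊ρ * τ⌋ * p₀ + u₀ : ℤ) : ℝ) / ρ = (0 * ρ + 1 * 0) * (p₀ : ℝ) +
        (0 * 0 + 1 * ρ⁻¹) * ((⌊ρ * τ⌋ * p₀ + u₀ : ℤ) : ℝ)
      ring
    · rw [hgD]
      refine (hrow q₀ v₀).congr' ?_
      filter_upwards [eventually_gt_atTop 0] with ρ hρ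
      simp only [mul_SL2R_apply, hu_10, hu_11, g2_00, g2_01, g2_10, g2_11, ofInt_apply,
        Real.exp_neg, Real.exp_log hρ]
      change ((⌊ρ * τ⌋ * q₀ + v₀ : ℤ) : ℝ) / ρ = (0 * ρ + 1 * 0) * (q₀ : ℝ) +
        (0 * 0 + 1 * ρ⁻¹) * ((⌊ρ * τ⌋ * q₀ + v₀ : ℤ) : ℝ)
      ring
  obtain ⟨ρ₁, hρ₁⟩ := eventually_atTop.1 (ht.eventually (hWo.mem_nhds hg))
  refine ⟨max ρ₁ 1, by positivity, fun ρ hρ => ⟨s ρ, ?_⟩⟩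
  have := hW _ (hρ₁ ρ ((le_max_left _ _).trans hρ)) (γ ρ)⁻¹
  rwa [mul_assoc, ← ofInt_mul, mul_inv_cancel, ofInt_one, mul_one] at this

theorem sum_pow_shift (b : ℝ) {j : ℕ} {I : Finset ℕ} (hI : I ⊆ Finset.range (j + 1)) :
    ∃ I' ⊆ Finset.range j, ∃ δ : ℝ, (δ = 0 ∨ δ = 1) ∧ ∑ i ∈ I, b ^ i = δ + b * ∑ i ∈ I', b ^ i := by
  refine ⟨(Finset.range j).filter (· + 1 ∈ I), Finset.filter_subset _ _, if 0 ∈ I then 1 else 0,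
    by split_ifs <;> simp, ?_⟩
  rw [← Finset.inter_eq_right.2 hI, ← Finset.filter_mem_eq_inter, Finset.sum_filter,
    Finset.sum_range_succ', Finset.sum_filter, Finset.mul_sum, add_comm, pow_zero]
  have h0 : (0 : ℕ) ∈ Finset.filter (fun i => i ∈ I) (Finset.range (j + 1)) ↔ 0 ∈ I := by simp
  simp only [h0]
  congr 1
  refine Finset.sum_congr rfl fun i hi => ?_
  have hi' : i < j := Finset.mem_range.1 hi
  simp only [Finset.mem_filter, Finset.mem_range, Nat.add_lt_add_iff_right, hi', true_and]
  split_ifs <;> ring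

theorem exists_coprime_of_not_thick {ε : ℝ} {q : SL2R} (h : ¬ Thick ε q) :
    ∃ m n : ℤ, IsCoprime m n ∧ |q 0 0 * m + q 0 1 * n| < ε ∧ |q 1 0 * m + q 1 1 * n| < ε := by
  simp only [Thick, not_forall, not_le] at h
  obtain ⟨m, n, hmn, hlt⟩ := h
  have hg : 0 < Int.gcd m n := Int.gcd_pos_iff.2 (by tauto)
  obtain ⟨m', n', hc, hm, hn⟩ := Int.exists_gcd_one hg
  have hg1 : (1 : ℝ) ≤ Int.gcd m n := by exact_mod_cast hg
  have hred : ∀ u v : ℝ, |u * m + v * n| < ε → |u * m' + v * n'| < ε := by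
    intro u v huv
    have h1 : u * m + v * n = (u * m' + v * n') * Int.gcd m n := by
      have hm' : (m : ℝ) = m' * (Int.gcd m n : ℝ) := by exact_mod_cast hm
      have hn' : (n : ℝ) = n' * (Int.gcd m n : ℝ) := by exact_mod_cast hn
      rw [hm', hn']; simp only [Int.gcd] ; ring
    rw [h1, abs_mul, abs_of_pos (by linarith : (0 : ℝ) < Int.gcd m n)] at huv
    nlinarith [abs_nonneg (u * m' + v * n')]
  exact ⟨m', n', Int.isCoprime_iff_gcd_eq_one.2 hc, hred _ _ ((le_max_left _ _).trans_lt hlt),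
    hred _ _ ((le_max_right _ _).trans_lt hlt)⟩

/-- The first excursion into the cusp leaves a short vector whose second coordinate is not
much smaller than the first. -/
theorem exists_first_excursion {β : ℕ} (hβ : 2 ≤ β) {ε : ℝ} (hε : 0 < ε) {y : SL2R}
    (hy : Thick ε y) :
    ∃ j : ℕ, ∃ I ⊆ Finset.range j, ∃ m n : ℤ, IsCoprime m n ∧ ∃ q : SL2R,
      q = hu (∑ i ∈ I, ((β : ℝ) ^ 2) ^ i) * (g2 (j * Real.log β) * y) ∧
      |q 0 0 * m + q 0 1 * n| < ε ∧ |q 1 0 * m + q 1 1 * n| < ε ∧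
      ε / β ≤ |q 1 0 * m + q 1 1 * n| := by
  classical
  have hex := exists_not_thick hβ hε y
  have hβ0 : (2 : ℝ) ≤ β := by exact_mod_cast hβ
  obtain ⟨I, hI, hnot⟩ := Nat.find_spec hex
  have hmin := fun j => Nat.find_min hex (m := j)
  generalize Nat.find hex = j at hI hnot hmin
  obtain ⟨m, n, hc, hx, hη⟩ := exists_coprime_of_not_thick hnot
  refine ⟨j, I, hI, m, n, hc, _, rfl, hx, hη, ?_⟩
  by_contra! hlt
  cases j with
  | zero =>
    rw [Finset.range_zero, Finset.subset_empty] at hI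
    subst hI
    apply hnot
    simpa [hu_zero, g2_zero] using hy
  | succ j =>
    obtain ⟨I', hI', δ, hδ, hsum⟩ := sum_pow_shift ((β : ℝ) ^ 2) hI
    apply hmin j (Nat.lt_succ_self j)
    refine ⟨I', hI', fun hth => ?_⟩
    set p := hu (∑ i ∈ I', ((β : ℝ) ^ 2) ^ i) * (g2 (j * Real.log β) * y) with hp
    have hq : hu (∑ i ∈ I, ((β : ℝ) ^ 2) ^ i) * (g2 ((j + 1 : ℕ) * Real.log β) * y) =
        hu δ * (g2 (Real.log β) * p) := by
      have h1 := g2_mul_hu_log hβ 1 (∑ i ∈ I', ((β : ℝ) ^ 2) ^ i)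
      simp only [Int.cast_one, one_mul, zpow_one] at h1
      rw [hp, ← mul_assoc (g2 (Real.log β)), h1, hsum, ← hu_mul_hu]
      simp only [mul_assoc]
      rw [← mul_assoc (g2 (Real.log β)), g2_mul_g2]
      congr 4
      push_cast; ring
    rw [hq] at hx hη hlt
    have hmn : ¬(m = 0 ∧ n = 0) := by
      rintro ⟨rfl, rfl⟩; exact not_isCoprime_zero_zero hc
    have := hth m n hmn
    have hβpos : (0 : ℝ) < β := by linarith
    simp only [mul_SL2R_apply (hu δ), mul_SL2R_apply (g2 (Real.log β)), hu_00, hu_01, hu_10, hu_11,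
      g2_00, g2_01, g2_10, g2_11, Real.exp_neg, Real.exp_log hβpos] at hx hη hlt
    set x' := p 0 0 * m + p 0 1 * n
    set η' := p 1 0 * m + p 1 1 * n
    rw [show (0 * (β * p 0 0 + 0 * p 1 0) + 1 * (0 * p 0 0 + (β : ℝ)⁻¹ * p 1 0)) * m +
      (0 * (β * p 0 1 + 0 * p 1 1) + 1 * (0 * p 0 1 + (β : ℝ)⁻¹ * p 1 1)) * n = (β : ℝ)⁻¹ * η' by
        simp only [η']; ring, abs_mul, abs_of_pos (inv_pos.2 hβpos), ← div_eq_inv_mul] at hη hlt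
    rw [show (1 * (β * p 0 0 + 0 * p 1 0) + δ * (0 * p 0 0 + (β : ℝ)⁻¹ * p 1 0)) * m +
      (1 * (β * p 0 1 + 0 * p 1 1) + δ * (0 * p 0 1 + (β : ℝ)⁻¹ * p 1 1)) * n =
        β * x' + δ * ((β : ℝ)⁻¹ * η') by simp only [x', η']; ring] at hx
    have hη1 : |η'| < ε := (div_lt_div_iff_of_pos_right hβpos).1 hlt
    have hδη : |δ * ((β : ℝ)⁻¹ * η')| < ε := by
      rcases hδ with rfl | rfl
      · simpa using hε
      · rw [one_mul, abs_mul, abs_of_pos (inv_pos.2 hβpos), ← div_eq_inv_mul,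
          div_lt_iff₀ hβpos]
        nlinarith
    have hx1 : |(β : ℝ) * x'| < 2 * ε := by
      rw [show (β : ℝ) * x' = (β * x' + δ * ((β : ℝ)⁻¹ * η')) - δ * ((β : ℝ)⁻¹ * η') by ring]
      refine (abs_sub _ _).trans_lt (by linarith)
    rw [abs_mul, abs_of_pos hβpos] at hx1
    have hx2 : |x'| < ε := by nlinarith [abs_nonneg x']
    exact absurd this (not_le.2 (max_lt hx2 hη1))

/-- Change of basis making a primitive vector the first column. -/
theorem exists_first_column (g : SL2R) {m n : ℤ} (hc : IsCoprime m n)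
    (h0 : g 0 0 * m + g 0 1 * n ≠ 0) :
    ∃ γ : SL2Z, (g * ofInt γ) 0 0 = |g 0 0 * m + g 0 1 * n| ∧
      |(g * ofInt γ) 1 0| = |g 1 0 * m + g 1 1 * n| ∧
      0 ≤ (g * ofInt γ) 0 1 ∧ (g * ofInt γ) 0 1 ≤ |g 0 0 * m + g 0 1 * n| := by
  wlog hpos : 0 < g 0 0 * m + g 0 1 * n generalizing m n
  · have hneg : g 0 0 * (-m : ℤ) + g 0 1 * (-n : ℤ) = -(g 0 0 * m + g 0 1 * n) := by
      push_cast; ring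
    have hneg' : g 1 0 * (-m : ℤ) + g 1 1 * (-n : ℤ) = -(g 1 0 * m + g 1 1 * n) := by
      push_cast; ring
    have hlt : g 0 0 * m + g 0 1 * n < 0 := lt_of_le_of_ne (not_lt.1 hpos) h0
    have := this (m := -m) (n := -n) hc.neg_neg (by rw [hneg]; exact neg_ne_zero.2 h0)
      (by rw [hneg]; linarith)
    rwa [hneg, hneg', abs_neg, abs_neg] at this
  · obtain ⟨a, b, hab⟩ := hc
    set X := g 0 0 * m + g 0 1 * n with hX
    set B := -g 0 0 * b + g 0 1 * a with hB
    set k : ℤ := ⌊B / X⌋ with hk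
    obtain ⟨γ, h00, h01, h10, h11⟩ : ∃ γ : SL2Z, γ 0 0 = m ∧ γ 0 1 = -b - k * m ∧ γ 1 0 = n ∧
        γ 1 1 = a - k * n :=
      ⟨⟨!![m, -b - k * m; n, a - k * n], by
        rw [Matrix.det_fin_two_of]; linear_combination hab⟩, rfl, rfl, rfl, rfl⟩
    refine ⟨γ, ?_⟩
    simp only [mul_SL2R_apply, ofInt_apply, h00, h01, h10, h11]
    rw [show g 0 0 * ((-b - k * m : ℤ) : ℝ) + g 0 1 * ((a - k * n : ℤ) : ℝ) = B - k * X by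
      push_cast; rw [hB, hX]; ring, abs_of_pos hpos]
    have h1 := Int.floor_le (B / X)
    have h2 := Int.lt_floor_add_one (B / X)
    rw [le_div_iff₀ hpos] at h1
    rw [div_lt_iff₀ hpos] at h2
    refine ⟨by trivial, by trivial, by linarith, by linarith⟩

/-- A digit pattern consisting of an initial block, a middle block and a final block. -/
theorem exists_three_blocks {b : ℝ} (hb : b ≠ 0) {j l : ℕ} {I Z I' : Finset ℕ}
    (hI : I ⊆ Finset.range j) (hZ : Z ⊆ Finset.Icc 1 (l / 2)) (hI' : ∀ i ∈ I', i + l / 2 < l) :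
    ∃ J : Finset ℕ, 0 ∉ J ∧ ∑ i ∈ J, (b ^ i)⁻¹ = (b ^ j)⁻¹ * (∑ i ∈ I, b ^ i +
      ∑ i ∈ Z, (b ^ i)⁻¹ + (b ^ l)⁻¹ * ∑ i ∈ I', b ^ i) := by
  have hI1 : ∀ i ∈ I, i < j := fun i hi => Finset.mem_range.1 (hI hi)
  have hZ1 : ∀ i ∈ Z, 1 ≤ i ∧ i ≤ l / 2 := fun i hi => Finset.mem_Icc.1 (hZ hi)
  refine ⟨I.image (fun i => j - i) ∪ Z.image (fun i => j + i) ∪ I'.image (fun i => j + l - i),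
    ?_, ?_⟩
  · simp only [Finset.mem_union, Finset.mem_image, not_or, not_exists, not_and]
    refine ⟨⟨fun i hi h => ?_, fun i hi h => ?_⟩, fun i hi h => ?_⟩
    · have := hI1 i hi; omega
    · have := hZ1 i hi; omega
    · have := hI' i hi; omega
  · rw [Finset.sum_union, Finset.sum_union, Finset.sum_image, Finset.sum_image, Finset.sum_image,
      mul_add, mul_add, Finset.mul_sum, Finset.mul_sum, Finset.mul_sum, Finset.mul_sum]
    · congr 1
      · congr 1
        · refine Finset.sum_congr rfl fun i hi => ?_
          rw [pow_sub₀ _ hb (hI1 i hi).le, mul_inv, inv_inv]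
        · refine Finset.sum_congr rfl fun i hi => ?_
          rw [pow_add, mul_inv]
      · refine Finset.sum_congr rfl fun i hi => ?_
        have := hI' i hi
        rw [pow_sub₀ _ hb (by omega), mul_inv, inv_inv, pow_add, mul_inv, mul_assoc]
    · intro x hx x' hx' h
      have := hI' x hx
      have := hI' x' hx'
      dsimp at h; omega
    · intro x hx x' hx' h
      dsimp at h; omega
    · intro x hx x' hx' h
      have := hI1 x hx
      have := hI1 x' hx'
      dsimp at h; omega
    · rw [Finset.disjoint_left]
      intro a ha ha'
      simp only [Finset.mem_image] at ha ha'
      obtain ⟨i, hi, rfl⟩ := ha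
      obtain ⟨i', hi', h⟩ := ha'
      have := hI1 i hi
      have := hZ1 i' hi'
      omega
    · rw [Finset.disjoint_left]
      intro a ha ha'
      simp only [Finset.mem_union, Finset.mem_image] at ha ha'
      obtain ⟨i', hi', h⟩ := ha'
      have := hI' i' hi'
      rcases ha with ⟨i, hi, rfl⟩ | ⟨i, hi, rfl⟩
      · have := hI1 i hi
        omega
      · have := hZ1 i hi
        omega

/-- Renormalisation of a three block translate. -/
theorem renormalize_three_blocks {β : ℕ} (hβ : 2 ≤ β) (c z w v : ℝ) (j l : ℕ) (y : SL2R) :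
    g2 c * hu ((((β : ℝ) ^ 2) ^ j)⁻¹ * (w + z + (((β : ℝ) ^ 2) ^ l)⁻¹ * v)) * y =
      hu (Real.exp (c - j * Real.log β) ^ 2 * (((β : ℝ) ^ 2) ^ l)⁻¹ * v) *
        (g2 (c - j * Real.log β) * hu z * (hu w * (g2 (j * Real.log β) * y))) := by
  have hb : ((β : ℝ) ^ 2) ^ j ≠ 0 := by
    have : (β : ℝ) ≠ 0 := by
      have : β ≠ 0 := by omega
      exact_mod_cast this
    positivity
  set r := c - j * Real.log β with hr
  have h1 := g2_mul_hu_log hβ j ((((β : ℝ) ^ 2) ^ j)⁻¹ * (w + z + (((β : ℝ) ^ 2) ^ l)⁻¹ * v))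
  rw [zpow_natCast, Int.cast_natCast, mul_inv_cancel_left₀ hb] at h1
  have h2 : g2 c = g2 r * g2 (j * Real.log β) := by
    rw [g2_mul_g2, hr, sub_add_cancel]
  rw [h2, mul_assoc (g2 r), h1, ← Real.exp_nat_mul]
  have h3 := g2_mul_hu r ((((β : ℝ) ^ 2) ^ l)⁻¹ * v)
  push_cast
  rw [show w + z + (((β : ℝ) ^ 2) ^ l)⁻¹ * v = (((β : ℝ) ^ 2) ^ l)⁻¹ * v + (z + w) by ring,
    ← hu_mul_hu, ← hu_mul_hu]
  simp only [← mul_assoc]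
  rw [h3]
  simp only [← mul_assoc]

/-- Subsums of a geometric series avoid any prescribed countable set. -/
theorem exists_subsum_notMem {b : ℝ} (hb : 2 < b) {B : Set ℝ} (hB : B.Countable) :
    ∃ f : ℕ → Bool, ∃ z ∉ B, Tendsto
      (fun N => ∑ i ∈ (Finset.Icc 1 N).filter (fun i => f i = true), (b ^ i)⁻¹) atTop (nhds z) := by
  have hc0 : 0 < b⁻¹ := by positivity
  have hc : b⁻¹ < 1 / 2 := by rw [one_div]; exact inv_strictAnti₀ (by norm_num) hb
  have hinj := Cardinal.cantorFunction_injective hc0 hc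
  set F : (ℕ → Bool) → ℝ := fun f => b⁻¹ * Cardinal.cantorFunction b⁻¹ f with hF
  have hFinj : Function.Injective F := fun f g h => hinj (mul_left_cancel₀ hc0.ne' h)
  have hnot : ∃ f, F f ∉ B := by
    by_contra! h
    have h1 : (F ⁻¹' B).Countable := hB.preimage hFinj
    have h2 : F ⁻¹' B = univ := eq_univ_of_forall h
    rw [h2, countable_univ_iff] at h1
    classical
    obtain ⟨e, he⟩ := h1.exists_injective_nat
    refine Function.cantor_injective (fun S : Set ℕ => e fun n => decide (n ∈ S)) fun S T h => ?_
    ext n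
    simpa using congrFun (he h) n
  obtain ⟨f, hf⟩ := hnot
  refine ⟨fun i => f (i - 1), F f, hf, ?_⟩
  have hs := (Cardinal.summable_cantor_function f hc0.le (by linarith)).hasSum.tendsto_sum_nat
  have := hs.const_mul b⁻¹
  refine this.congr fun N => ?_
  rw [Finset.sum_filter]
  induction N with
  | zero => simp
  | succ N ih =>
    rw [Finset.sum_range_succ, mul_add, ih, Finset.sum_Icc_succ_top (by omega)]
    congr 1
    simp only [Nat.add_sub_cancel]
    cases h : f N
    · rw [Cardinal.cantorFunctionAux_false h]; simp
    · rw [Cardinal.cantorFunctionAux_true h]; simp [pow_succ', mul_comm]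

theorem exists_time {t : ℝ} (ht : 0 < t) {ρ₀ X c : ℝ} (hρ₀ : 0 < ρ₀) (hX : 0 < X)
    (hXc : X ≤ ρ₀ * Real.exp (-c)) :
    ∃ κ : ℕ, ρ₀ ≤ Real.exp (c + t * κ) * X ∧ Real.exp (c + t * κ) * X ≤ ρ₀ * Real.exp t := by
  have hA : 0 ≤ Real.log (ρ₀ / X) - c := by
    rw [sub_nonneg, Real.le_log_iff_exp_le (by positivity), le_div_iff₀ hX]
    calc Real.exp c * X ≤ Real.exp c * (ρ₀ * Real.exp (-c)) := by gcongr
      _ = ρ₀ * (Real.exp c * Real.exp (-c)) := by ring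
      _ = ρ₀ := by rw [← Real.exp_add]; simp
  refine ⟨⌈(Real.log (ρ₀ / X) - c) / t⌉₊, ?_, ?_⟩
  · have h1 := Nat.le_ceil ((Real.log (ρ₀ / X) - c) / t)
    rw [div_le_iff₀ ht] at h1
    rw [← div_le_iff₀ hX, ← Real.log_le_iff_le_exp (by positivity)]
    linarith
  · have h1 := Nat.ceil_lt_add_one (div_nonneg hA ht.le)
    have h2 : (⌈(Real.log (ρ₀ / X) - c) / t⌉₊ : ℝ) * t ≤ Real.log (ρ₀ / X) - c + t := by
      rw [← sub_lt_iff_lt_add, lt_div_iff₀ ht] at h1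
      linarith
    calc Real.exp (c + t * ⌈(Real.log (ρ₀ / X) - c) / t⌉₊) * X
        ≤ Real.exp (Real.log (ρ₀ / X) + t) * X :=
          mul_le_mul_of_nonneg_right (Real.exp_le_exp.2 (by linarith)) hX.le
      _ = ρ₀ * Real.exp t := by
        rw [Real.exp_add, Real.exp_log (by positivity)]; field_simp

theorem exists_subsum_irrational {b : ℝ} (hb : 2 < b) (ξ μ : ℝ) (hμ : 0 < μ) :
    ∃ f : ℕ → Bool, ∃ z : ℝ, ξ + z ≠ 0 ∧ Irrational (μ / (ξ + z) ^ 2) ∧ Tendsto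
      (fun N => ∑ i ∈ (Finset.Icc 1 N).filter (fun i => f i = true), (b ^ i)⁻¹) atTop (nhds z) := by
  obtain ⟨f, z, hz, hlim⟩ := exists_subsum_notMem hb (B := {-ξ} ∪ ⋃ q : ℚ,
    ({√(μ / q) - ξ, -√(μ / q) - ξ} : Set ℝ)) ((countable_singleton _).union
      (countable_iUnion fun q => (Set.toFinite _).countable))
  simp only [mem_union, mem_singleton_iff, mem_iUnion, mem_insert_iff, not_or, not_exists] at hz
  have hne : ξ + z ≠ 0 := fun h => hz.1 (by linarith)
  refine ⟨f, z, hne, ?_, hlim⟩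
  rintro ⟨q, hq⟩
  have h1 : (ξ + z) ^ 2 = μ / q := by rw [hq]; field_simp
  have h2 : |ξ + z| = √(μ / q) := by rw [← h1, Real.sqrt_sq_eq_abs]
  rcases abs_choice (ξ + z) with h | h
  · exact (hz.2 q).1 (by linarith)
  · exact (hz.2 q).2 (by linarith)

/-- A horocycle orbit of a diagonal element contains arithmetic translates meeting `W`. -/
theorem exists_horocycle_translate_mem {β : ℕ} (hβ : 2 ≤ β) {W : Set SL2R} (hWo : IsOpen W)
    (hW : ∀ g ∈ W, ∀ γ, g * ofInt γ ∈ W) {ρ lam u s : ℝ} (hρ : 0 < ρ)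
    (hirr : Irrational (lam / ρ ^ 2)) (hs : hu s * g2 (Real.log ρ) ∈ W) :
    ∃ I : Finset ℕ, hu (lam * ∑ i ∈ I, ((β : ℝ) ^ 2) ^ i) * (hu (u * ρ) * g2 (Real.log ρ)) ∈ W := by
  have hcont : Continuous fun s' => hu s' * g2 (Real.log ρ) := continuous_hu.mul continuous_const
  obtain ⟨δ, hδ, hball⟩ := Metric.isOpen_iff.1 (hWo.preimage hcont) s hs
  have hb2 : 2 ≤ β ^ 2 := by nlinarith
  obtain ⟨I, n, hI⟩ := exists_sum_pow_mul_near hb2 hirr ((s - u * ρ) / ρ ^ 2)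
    (show 0 < δ / ρ ^ 2 by positivity)
  refine ⟨I, ?_⟩
  push_cast at hI
  set w := ∑ i ∈ I, ((β : ℝ) ^ 2) ^ i with hw
  have h1 : lam * w + u * ρ - ρ ^ 2 * n ∈ Metric.ball s δ := by
    rw [Metric.mem_ball, Real.dist_eq]
    have e : lam * w + u * ρ - ρ ^ 2 * n - s =
        ρ ^ 2 * (w * (lam / ρ ^ 2) - (s - u * ρ) / ρ ^ 2 - n) := by field_simp; ring
    rw [e, abs_mul, abs_of_pos (by positivity : 0 < ρ ^ 2)]
    rwa [lt_div_iff₀' (by positivity)] at hI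
  have h2 : hu (lam * w + u * ρ - ρ ^ 2 * n) * g2 (Real.log ρ) ∈ W := hball h1
  obtain ⟨γ, hγ⟩ : ∃ γ : SL2Z, ofInt γ = hu n := by
    obtain ⟨γ, h00, h01, h10, h11⟩ : ∃ γ : SL2Z, γ 0 0 = 1 ∧ γ 0 1 = n ∧ γ 1 0 = 0 ∧ γ 1 1 = 1 :=
      ⟨⟨!![1, n; 0, 1], by simp⟩, rfl, rfl, rfl, rfl⟩
    exact ⟨γ, by apply ext_SL2R <;> simp [h00, h01, h10, h11]⟩
  have h3 := hW _ h2 γ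
  rw [hγ, mul_assoc, g2_mul_hu, ← mul_assoc, hu_mul_hu, two_mul, Real.exp_add, Real.exp_log hρ]
    at h3
  rw [← mul_assoc, hu_mul_hu]
  convert h3 using 3
  ring

theorem Thick.mono {ε ε' : ℝ} {q : SL2R} (h : Thick ε q) (hε : ε' ≤ ε) : Thick ε' q :=
  fun m n hmn => hε.trans (h m n hmn)

/-- A first excursion together with the scale of its short vector. -/
theorem exists_scaled_excursion {β : ℕ} (hβ : 2 ≤ β) {ε : ℝ} (hε : 0 < ε) (hε1 : ε ≤ 1) {y : SL2R}
    (hy : Thick ε y) :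
    ∃ j l : ℕ, ∃ I ⊆ Finset.range j, ∃ m n : ℤ, IsCoprime m n ∧ ∃ q : SL2R,
      q = hu (∑ i ∈ I, ((β : ℝ) ^ 2) ^ i) * (g2 (j * Real.log β) * y) ∧ ∃ x η μ : ℝ,
      x = q 0 0 * m + q 0 1 * n ∧ η = q 1 0 * m + q 1 1 * n ∧ η ≠ 0 ∧ |η| < ε ∧ |x / η| ≤ β ∧
      1 ≤ μ ∧ μ ≤ (β : ℝ) ^ 2 ∧ η ^ 2 * μ * ((β : ℝ) ^ 2) ^ l = 1 := by
  obtain ⟨j, I, hI, m, n, hc, q, hq, hx, hη, hη'⟩ := exists_first_excursion hβ hε hy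
  have hβ0 : (2 : ℝ) ≤ β := by exact_mod_cast hβ
  have hβpos : (0 : ℝ) < β := by linarith
  set x := q 0 0 * m + q 0 1 * n with hxd
  set η := q 1 0 * m + q 1 1 * n with hηd
  have hpos : 0 < |η| := (div_pos hε hβpos).trans_le hη'
  have hη0 : η ≠ 0 := abs_pos.1 hpos
  have h1 : 1 ≤ 1 / η ^ 2 := by
    rw [le_div_iff₀ (by positivity), one_mul, ← sq_abs]
    nlinarith
  obtain ⟨l, hl, hl'⟩ := exists_nat_pow_near h1 (show 1 < (β : ℝ) ^ 2 by nlinarith)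
  refine ⟨j, l, I, hI, m, n, hc, q, hq, x, η, 1 / η ^ 2 / ((β : ℝ) ^ 2) ^ l, hxd, hηd, hη0, hη,
    ?_, ?_, ?_, ?_⟩
  · rw [abs_div, div_le_iff₀ hpos]
    rw [div_le_iff₀ hβpos] at hη'
    linarith
  · rwa [le_div_iff₀ (by positivity), one_mul]
  · rw [div_le_iff₀ (by positivity), ← pow_succ']; exact hl'.le
  · field_simp

theorem eventually_le_scale {b : ℝ} (hb : 1 < b) {α : Type*} {F : Filter α} {η μ : α → ℝ}
    {l : α → ℕ} (hη : Tendsto η F (nhds 0)) (hμ : ∀ k, 1 ≤ μ k) (hμ' : ∀ k, μ k ≤ b)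
    (h : ∀ k, η k ^ 2 * μ k * b ^ l k = 1) : Tendsto l F atTop := by
  rw [tendsto_atTop]
  intro N
  have h1 : Tendsto (fun k => η k ^ 2 * (b * b ^ N)) F (nhds 0) := by
    simpa using (hη.pow 2).mul_const (b * b ^ N)
  filter_upwards [h1.eventually_lt_const one_pos] with k hk
  by_contra! hlt
  have h2 : η k ^ 2 * μ k * b ^ l k ≤ η k ^ 2 * (b * b ^ N) := by
    rw [mul_assoc]
    have := hμ k
    have := hμ' k
    gcongr
    exact hb.le
  rw [h k] at h2
  linarith

/-- Expanding a translate whose primitive vector is short and not too flat. -/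
theorem exists_renormalized {q : SL2R} {m n : ℤ} (hc : IsCoprime m n) {x η z t c ρ₀ : ℝ}
    (hx : x = q 0 0 * m + q 0 1 * n) (hη : η = q 1 0 * m + q 1 1 * n) (ht : 0 < t) (hρ₀ : 0 < ρ₀)
    (h0 : x + z * η ≠ 0) (hle : |x + z * η| ≤ ρ₀ * Real.exp (-c)) :
    ∃ p : ℕ × SL2R × ℝ, (∃ γ, p.2.1 = g2 (c + t * p.1) * hu z * q * ofInt γ) ∧
      ρ₀ ≤ p.2.2 ∧ p.2.2 ≤ ρ₀ * Real.exp t ∧ p.2.2 = Real.exp (c + t * p.1) * |x + z * η| ∧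
      p.2.1 0 0 = p.2.2 ∧ |p.2.1 1 0| ≤ |η| * |x + z * η| / ρ₀ ∧ |p.2.1 0 1| ≤ ρ₀ * Real.exp t := by
  have hX : 0 < |x + z * η| := abs_pos.2 h0
  obtain ⟨κ, h1, h2⟩ := exists_time ht hρ₀ hX hle
  set r := c + t * κ with hr
  set g := g2 r * hu z * q with hg
  have e0 : g 0 0 * m + g 0 1 * n = Real.exp r * (x + z * η) := by
    rw [hx, hη, hg]; simp only [mul_SL2R_apply, hu_00, hu_01, hu_10, hu_11, g2_00, g2_01]; ring
  have e1 : g 1 0 * m + g 1 1 * n = (Real.exp r)⁻¹ * η := by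
    rw [hη, hg]
    simp only [mul_SL2R_apply, hu_00, hu_01, hu_10, hu_11, g2_10, g2_11, Real.exp_neg]; ring
  have ea : |Real.exp r * (x + z * η)| = Real.exp r * |x + z * η| := by
    rw [abs_mul, abs_of_pos (Real.exp_pos r)]
  obtain ⟨γ, hγ0, hγ1, hγ2, hγ3⟩ := exists_first_column g hc (by rw [e0]; positivity)
  rw [e0, ea] at hγ0 hγ3
  rw [e1, abs_mul, abs_of_pos (inv_pos.2 (Real.exp_pos r))] at hγ1
  refine ⟨(κ, g * ofInt γ, Real.exp r * |x + z * η|), ⟨γ, rfl⟩, h1, h2, rfl, hγ0, ?_, ?_⟩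
  · dsimp only
    rw [hγ1, le_div_iff₀ hρ₀]
    calc (Real.exp r)⁻¹ * |η| * ρ₀ ≤ (Real.exp r)⁻¹ * |η| * (Real.exp r * |x + z * η|) := by gcongr
      _ = |η| * |x + z * η| := by field_simp
  · dsimp only
    rw [abs_of_nonneg hγ2]
    exact hγ3.trans h2

theorem tendsto_upper_triangular {α : Type*} {l : Filter α} {M : α → SL2R} {ρ u : ℝ} (hρ : 0 < ρ)
    (h00 : Tendsto (fun k => M k 0 0) l (nhds ρ)) (h01 : Tendsto (fun k => M k 0 1) l (nhds u))
    (h10 : Tendsto (fun k => M k 1 0) l (nhds 0)) :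
    Tendsto M l (nhds (hu (u * ρ) * g2 (Real.log ρ))) := by
  have h11 : Tendsto (fun k => M k 1 1) l (nhds ρ⁻¹) := by
    have := ((h01.mul h10).const_add 1).div h00 hρ.ne'
    rw [mul_zero, add_zero, one_div] at this
    refine this.congr' ?_
    filter_upwards [h00.eventually_ne hρ.ne'] with k hk
    simp only [Pi.div_apply]
    rw [div_eq_iff hk]
    linear_combination -det_SL2R (M k)
  rw [tendsto_SL2R_iff]
  intro i j
  fin_cases i <;> fin_cases j <;>
    simp only [Fin.zero_eta, Fin.mk_one, mul_SL2R_apply, hu_00, hu_01, hu_10, hu_11, g2_00, g2_01,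
      g2_10, g2_11, Real.exp_neg, Real.exp_log hρ]
  · simpa using h00
  · simpa [mul_assoc, mul_inv_cancel₀ hρ.ne'] using h01
  · simpa using h10
  · simpa using h11

/-- Arithmetic translates of any point reach any invariant open set under the diagonal flow. -/
theorem exists_flow_translate_mem {β : ℕ} (hβ : 2 ≤ β) {t : ℝ} (ht : 0 < t) {W : Set SL2R}
    (hWo : IsOpen W) (hne : W.Nonempty) (hW : ∀ g ∈ W, ∀ γ, g * ofInt γ ∈ W) (y : SL2R) (c₀ : ℝ) :
    ∃ I : Finset ℕ, ∃ k : ℕ, 0 ∉ I ∧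
      g2 (c₀ + t * k) * hu (∑ i ∈ I, (((β : ℝ) ^ 2) ^ i)⁻¹) * y ∈ W := by
  by_contra! H
  have hβ0 : (2 : ℝ) ≤ β := by exact_mod_cast hβ
  obtain ⟨b, hb⟩ : ∃ b : ℝ, b = (β : ℝ) ^ 2 := ⟨_, rfl⟩
  have hb2 : 2 < b := by rw [hb]; nlinarith
  obtain ⟨ρ₀, hρ₀, hhor⟩ := exists_horocycle_mem hWo hne hW
  obtain ⟨ε₀, hε₀, hy⟩ := exists_thick y
  have hex := fun k : ℕ => exists_scaled_excursion hβ
    (ε := min ε₀ (1 / ((k : ℝ) + 1))) (lt_min hε₀ (by positivity))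
    ((min_le_right _ _).trans (by rw [div_le_one (by positivity)]; linarith [k.cast_nonneg (α := ℝ)]))
    (hy.mono (min_le_left _ _))
  choose j l I hI m n hc q hq x η μ hx hη hη0 hηε hξ hμ1 hμb hscale using hex
  rw [← hb] at hμb hscale
  have hηlim : Tendsto η (hyperfilter ℕ : Filter ℕ) (nhds 0) := by
    refine squeeze_zero_norm (a := fun k : ℕ => 1 / ((k : ℝ) + 1)) (fun k => ?_)
      ((tendsto_one_div_add_atTop_nhds_zero_nat (𝕜 := ℝ)).mono_left Nat.hyperfilter_le_atTop)
    exact (hηε k).le.trans (min_le_right _ _)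
  obtain ⟨ξ, hξlim⟩ := exists_tendsto_real (hyperfilter ℕ) (Eventually.of_forall hξ)
  obtain ⟨μ₀, hμlim⟩ := exists_tendsto_real (hyperfilter ℕ) (f := μ) (R := b)
    (Eventually.of_forall fun k => by rw [abs_of_nonneg (by linarith [hμ1 k])]; exact hμb k)
  have hμ₀ : 0 < μ₀ := one_pos.trans_le (ge_of_tendsto hμlim (Eventually.of_forall hμ1))
  have hllim := eventually_le_scale (by linarith) hηlim hμ1 hμb hscale
  obtain ⟨f, z, hz0, hirr, hzlim⟩ := exists_subsum_irrational hb2 ξ μ₀ hμ₀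
  have hl2 : Tendsto (fun k => l k / 2) (hyperfilter ℕ : Filter ℕ) atTop :=
    (Nat.tendsto_div_const_atTop two_ne_zero).comp hllim
  set Z : ℕ → Finset ℕ := fun k => (Finset.Icc 1 (l k / 2)).filter (fun i => f i = true) with hZ
  set zk : ℕ → ℝ := fun k => ∑ i ∈ Z k, (b ^ i)⁻¹ with hzk
  have hzklim : Tendsto zk (hyperfilter ℕ : Filter ℕ) (nhds z) := hzlim.comp hl2
  have hX : ∀ k, x k + zk k * η k = η k * (x k / η k + zk k) := fun k => by
    have := hη0 k
    field_simp
  have hXlim : Tendsto (fun k => x k + zk k * η k) (hyperfilter ℕ : Filter ℕ) (nhds 0) := by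
    have := hηlim.mul (hξlim.add hzklim)
    rw [zero_mul] at this
    exact this.congr fun k => (hX k).symm
  have hevne : ∀ᶠ k in (hyperfilter ℕ : Filter ℕ), x k / η k + zk k ≠ 0 :=
    (hξlim.add hzklim).eventually_ne hz0
  have hstep : ∀ᶠ k in (hyperfilter ℕ : Filter ℕ), ∃ p : ℕ × SL2R × ℝ,
      (∃ γ, p.2.1 = g2 (c₀ - j k * Real.log β + t * p.1) * hu (zk k) * q k * ofInt γ) ∧
      ρ₀ ≤ p.2.2 ∧ p.2.2 ≤ ρ₀ * Real.exp t ∧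
      p.2.2 = Real.exp (c₀ - j k * Real.log β + t * p.1) * |x k + zk k * η k| ∧
      p.2.1 0 0 = p.2.2 ∧ |p.2.1 1 0| ≤ |η k| * |x k + zk k * η k| / ρ₀ ∧
      |p.2.1 0 1| ≤ ρ₀ * Real.exp t := by
    have h1 : Tendsto (fun k => |x k + zk k * η k|) (hyperfilter ℕ : Filter ℕ) (nhds 0) := by
      simpa using hXlim.abs
    filter_upwards [hevne, h1.eventually_le_const
      (show 0 < ρ₀ * Real.exp (-c₀) by positivity)] with k hk hk'
    refine exists_renormalized (hc k) (hx k) (hη k) ht hρ₀ ?_ (hk'.trans ?_)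
    · rw [hX]; exact mul_ne_zero (hη0 k) hk
    · have : 0 ≤ j k * Real.log β := mul_nonneg (Nat.cast_nonneg _) (Real.log_nonneg (by linarith))
      gcongr
      linarith
  obtain ⟨p, hp⟩ := hstep.choice
  set ρk : ℕ → ℝ := fun k => (p k).2.2 with hρk
  set M : ℕ → SL2R := fun k => (p k).2.1 with hM
  obtain ⟨ρ, hρlim⟩ := exists_tendsto_real (hyperfilter ℕ) (f := ρk) (R := ρ₀ * Real.exp t)
    (by filter_upwards [hp] with k hk; rw [abs_of_nonneg (by linarith [hk.2.1])]; exact hk.2.2.1)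
  obtain ⟨u, hulim⟩ := exists_tendsto_real (hyperfilter ℕ) (f := fun k => M k 0 1)
    (R := ρ₀ * Real.exp t) (by filter_upwards [hp] with k hk; exact hk.2.2.2.2.2.2)
  have hρge : ρ₀ ≤ ρ := ge_of_tendsto hρlim (by filter_upwards [hp] with k hk; exact hk.2.1)
  have hρ : 0 < ρ := hρ₀.trans_le hρge
  have hMlim : Tendsto M (hyperfilter ℕ : Filter ℕ) (nhds (hu (u * ρ) * g2 (Real.log ρ))) := by
    refine tendsto_upper_triangular hρ ?_ hulim ?_
    · refine hρlim.congr' ?_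
      filter_upwards [hp] with k hk
      exact hk.2.2.2.2.1.symm
    · refine squeeze_zero_norm' (a := fun k => |η k| * |x k + zk k * η k| / ρ₀)
        (by filter_upwards [hp] with k hk; exact hk.2.2.2.2.2.1) ?_
      simpa using (hηlim.abs.mul hXlim.abs).div_const ρ₀
  set lam : ℝ := ρ ^ 2 * μ₀ / (ξ + z) ^ 2 with hlam
  have hlamlim : Tendsto (fun k => Real.exp (c₀ - j k * Real.log β + t * (p k).1) ^ 2 *
      (b ^ l k)⁻¹) (hyperfilter ℕ : Filter ℕ) (nhds lam) := by
    refine (((hρlim.pow 2).mul hμlim).div ((hξlim.add hzklim).pow 2) (pow_ne_zero 2 hz0)).congr' ?_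
    filter_upwards [hp, hevne] with k hk hk'
    have h1 : ρk k = Real.exp (c₀ - j k * Real.log β + t * (p k).1) * |x k + zk k * η k| :=
      hk.2.2.2.1
    have h2 := hscale k
    have h3 : (b ^ l k)⁻¹ = η k ^ 2 * μ k := (eq_inv_of_mul_eq_one_left h2).symm
    simp only [Pi.div_apply]
    rw [h1, mul_pow, sq_abs, hX k, h3, div_eq_iff (pow_ne_zero 2 hk')]
    ring
  obtain ⟨s, hs⟩ := hhor ρ hρge
  have hirr' : Irrational (lam / ρ ^ 2) := by
    convert hirr using 1
    rw [hlam]; field_simp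
  obtain ⟨I', hI'⟩ := exists_horocycle_translate_mem hβ hWo hW (u := u) hρ hirr' hs
  rw [← hb] at hI'
  have hfin := ((continuous_hu.tendsto _).comp
    (hlamlim.mul_const (∑ i ∈ I', b ^ i))).mul hMlim
  have hev := hfin.eventually (hWo.mem_nhds hI')
  obtain ⟨k, hk, hpk, hlk⟩ := (hev.and (hp.and
    (hllim.eventually_ge_atTop (2 * I'.sup id + 1)))).exists
  obtain ⟨γ, hγ⟩ := hpk.1
  obtain ⟨J, hJ0, hJ⟩ := exists_three_blocks (b := b) (by linarith) (hI k)
    (Finset.filter_subset (fun i => f i = true) (Finset.Icc 1 (l k / 2))) (I' := I')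
    (fun i hi => by
      have h2 : i ≤ I'.sup id := Finset.le_sup (f := id) hi
      omega)
  refine H J (p k).1 hJ0 ?_
  have e := renormalize_three_blocks hβ (c₀ + t * (p k).1) (zk k) (∑ i ∈ I k, b ^ i)
    (∑ i ∈ I', b ^ i) (j k) (l k) y
  rw [← hb] at e ⊢
  rw [hJ, e]
  have hqk := hq k
  rw [← hb] at hqk
  rw [← hqk]
  have h4 := hW _ hk γ⁻¹
  simp only [Function.comp_apply] at h4
  rw [show M k = _ from hγ, mul_assoc, mul_assoc _ (ofInt γ), ← ofInt_mul, mul_inv_cancel,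
    ofInt_one, mul_one] at h4
  rw [show c₀ + t * ((p k).1 : ℝ) - j k * Real.log β = c₀ - j k * Real.log β + t * (p k).1 by ring]
  exact h4

theorem tendsto_sum_Icc_inv_pow {b : ℝ} (hb : 1 < b) :
    Tendsto (fun L => ∑ i ∈ Finset.Icc 1 L, (b ^ i)⁻¹) atTop (nhds (1 / (b - 1))) := by
  have h1 : ∀ L, ∑ i ∈ Finset.Icc 1 L, (b ^ i)⁻¹ = (1 - b⁻¹ ^ L) / (b - 1) := by
    intro L
    have hb1 : b - 1 ≠ 0 := by linarith
    have hb0 : b ≠ 0 := by linarith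
    induction L with
    | zero => simp
    | succ L ih =>
      rw [Finset.sum_Icc_succ_top (by omega), ih, inv_pow, inv_pow]
      field_simp
      ring
  simp only [h1]
  have h2 := tendsto_pow_atTop_nhds_zero_of_lt_one (inv_nonneg.2 (by linarith : 0 ≤ b))
    (inv_lt_one_of_one_lt₀ hb)
  simpa using (h2.const_sub 1).div_const (b - 1)

theorem ThickNode.thick {β N a : ℕ} (hβ : 2 ≤ β) (h : ThickNode β N a) :
    Thick (1 / (2 * (β : ℝ) ^ 3))
      (g2 (N * Real.log β) * hu (a / ((β : ℝ) ^ 2) ^ N)) := by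
  have hβ0 : (0 : ℝ) < β := by exact_mod_cast (by omega : 0 < β)
  intro m n hmn
  convert h m n hmn using 3
  · simp only [mul_SL2R_apply, hu_00, hu_01, hu_10, hu_11, g2_00, g2_01, Real.exp_nat_mul,
      Real.exp_log hβ0]
    ring
  · simp only [mul_SL2R_apply, hu_00, hu_01, hu_10, hu_11, g2_10, g2_11, Real.exp_neg,
      Real.exp_nat_mul, Real.exp_log hβ0]
    rw [show (0 * 1 + ((β : ℝ) ^ N)⁻¹ * 0) * m + (0 * (a / ((β : ℝ) ^ 2) ^ N) + ((β : ℝ) ^ N)⁻¹ * 1) * n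
      = n / (β : ℝ) ^ N by ring, abs_div, abs_of_pos (by positivity : 0 < (β : ℝ) ^ N)]

theorem isEvent_flow {β : ℕ} (hβ : 2 ≤ β) (d0 : ℕ) {t : ℝ} (ht : 0 < t) {U : Set X2}
    (hU : IsOpen U) (hne : U.Nonempty) :
    IsEvent (β ^ 2) d0 (ThickNode β) {x : ℝ | ∃ k : ℕ, g2 t ^ k • h2 x ∈ U} := by
  by_contra hnot
  simp only [IsEvent, not_exists, not_forall, not_and] at hnot
  choose N a hth hno using hnot
  have hβ0 : (2 : ℝ) ≤ β := by exact_mod_cast hβ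
  obtain ⟨b, hb⟩ : ∃ b : ℝ, b = (β : ℝ) ^ 2 := ⟨_, rfl⟩
  have hb1 : 1 < b := by rw [hb]; nlinarith
  have hbN : ∀ i, 0 < b ^ i := fun i => by positivity
  set W : Set SL2R := {g | (QuotientGroup.mk g : X2) ∈ U} with hWd
  have hWo : IsOpen W := hU.preimage continuous_quotient_mk'
  have hWne : W.Nonempty := by
    obtain ⟨u, hu⟩ := hne
    obtain ⟨g, rfl⟩ := QuotientGroup.mk_surjective u
    exact ⟨g, hu⟩
  have hW : ∀ g ∈ W, ∀ γ, g * ofInt γ ∈ W := fun g hg γ => by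
    rw [hWd, mem_ofPred_eq, mk_mul_ofInt]; exact hg
  set qL : ℕ → SL2R := fun L => g2 (N L * Real.log β) * hu (a L / b ^ N L) with hqL
  obtain ⟨γ, y, hy⟩ := exists_tendsto_of_thick (hyperfilter ℕ) (f := qL)
    (ε := 1 / (2 * (β : ℝ) ^ 3)) (by positivity)
    (Eventually.of_forall fun L => by rw [hqL, hb]; exact (hth L).thick hβ)
  have hlog : 0 ≤ Real.log β := Real.log_nonneg (by linarith)
  set k0 : ℕ → ℕ := fun L => ⌈N L * Real.log β / t⌉₊ with hk0
  set cL : ℕ → ℝ := fun L => t * k0 L - N L * Real.log β with hcL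
  have hc : ∀ L, |cL L| ≤ t := fun L => by
    have hA : 0 ≤ N L * Real.log β / t := by positivity
    have h1 := Nat.le_ceil (N L * Real.log β / t)
    have h2 := Nat.ceil_lt_add_one hA
    rw [div_le_iff₀ ht] at h1
    rw [← sub_lt_iff_lt_add, lt_div_iff₀ ht] at h2
    rw [hcL, abs_le]
    constructor <;> simp only [hk0] <;> linarith
  obtain ⟨c, hclim⟩ := exists_tendsto_real (hyperfilter ℕ) (Eventually.of_forall hc)
  obtain ⟨I, k, hI0, hmem⟩ := exists_flow_translate_mem hβ ht hWo hWne hW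
    (hu (d0 * (1 / (b - 1))) * y) c
  rw [← hb] at hmem
  set z := ∑ i ∈ I, (b ^ i)⁻¹ with hz
  have hIL : ∀ L, I.sup id ≤ L → I ⊆ Finset.Icc 1 L := fun L hL i hi => by
    have h2 : i ≤ I.sup id := Finset.le_sup (f := id) hi
    have h3 : i ≠ 0 := fun h => hI0 (h ▸ hi)
    rw [Finset.mem_Icc]; omega
  have hx : ∀ L, ∃ e : ℝ, 0 ≤ e ∧ e ≤ b⁻¹ ^ L ∧ (I.sup id ≤ L → ∀ k : ℕ, g2 t ^ k •
      h2 ((a L + (d0 * ∑ i ∈ Finset.Icc 1 L, (b ^ i)⁻¹ + z + e)) / b ^ N L) ∉ U) := by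
    intro L
    by_cases hL : I.sup id ≤ L
    · obtain ⟨x, hx1, hx2, hx3⟩ := hno L I (hIL L hL)
      simp only [startPoint, Nat.cast_pow, ← hb, ← hz] at hx1 hx2
      simp only [mem_ofPred_eq, not_exists] at hx3
      set S := d0 * ∑ i ∈ Finset.Icc 1 L, (b ^ i)⁻¹ with hS
      refine ⟨x * b ^ N L - (a L + S + z), ?_, ?_, fun _ => ?_⟩
      · rw [div_le_iff₀ (hbN _)] at hx1; linarith
      · have h5 : (b ^ (N L + L))⁻¹ = b⁻¹ ^ L / b ^ N L := by
          rw [pow_add, inv_pow]; field_simp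
        rw [h5, ← add_div, le_div_iff₀ (hbN _)] at hx2
        linarith
      · rwa [show a L + (S + z + (x * b ^ N L - (a L + S + z))) = x * b ^ N L by ring,
          mul_div_cancel_right₀ _ (hbN _).ne']
    · exact ⟨0, le_rfl, by positivity, fun h => absurd h hL⟩
  choose e he0 heL hmiss using hx
  have helim : Tendsto e (hyperfilter ℕ : Filter ℕ) (nhds 0) :=
    squeeze_zero he0 heL ((tendsto_pow_atTop_nhds_zero_of_lt_one (inv_nonneg.2 (by linarith))
      (inv_lt_one_of_one_lt₀ hb1)).mono_left Nat.hyperfilter_le_atTop)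
  have hSlim := (((tendsto_sum_Icc_inv_pow hb1).mono_left
    Nat.hyperfilter_le_atTop).const_mul (d0 : ℝ)).add_const z |>.add helim
  have hlim := (((continuous_g2.tendsto _).comp (hclim.add_const (t * k))).mul
    ((continuous_hu.tendsto _).comp hSlim)).mul hy
  have hmem' : g2 (c + t * k) * hu (d0 * (1 / (b - 1)) + z + 0) * y ∈ W := by
    rw [add_zero, add_comm _ z, ← hu_mul_hu]
    simpa only [mul_assoc] using hmem
  obtain ⟨L, hL, hLI⟩ := ((hlim.eventually (hWo.mem_nhds hmem')).and
    (Nat.hyperfilter_le_atTop (eventually_ge_atTop (I.sup id)))).exists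
  refine hmiss L hLI (k0 L + k) ?_
  rw [g2_pow_smul_h2]
  have h4 := hW _ hL (γ L)⁻¹
  simp only [Function.comp_apply] at h4
  rw [mul_assoc, mul_assoc (qL L), ← ofInt_mul, mul_inv_cancel, ofInt_one, mul_one] at h4
  set S := d0 * ∑ i ∈ Finset.Icc 1 L, (b ^ i)⁻¹ + z + e L with hS
  have h6 : ∀ v : ℝ, g2 (N L * Real.log β) * hu (v / b ^ N L) = hu v * g2 (N L * Real.log β) := by
    intro v
    have := g2_mul_hu_log hβ (N L) (v / b ^ N L)
    rwa [zpow_natCast, Int.cast_natCast, ← hb, mul_div_cancel₀ _ (hbN _).ne'] at this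
  have h7 : g2 (((k0 L + k : ℕ) : ℝ) * t) * hu ((a L + S) / b ^ N L) =
      g2 (cL L + t * k) * hu S * qL L := by
    rw [hqL]
    simp only
    rw [h6, mul_assoc, ← mul_assoc (hu S), hu_mul_hu, add_comm S, ← h6, ← mul_assoc, g2_mul_g2]
    congr 2
    simp only [hcL]; push_cast; ring
  rw [h7]
  exact h4

theorem isEvent_univ (b d0 : ℕ) (P : ℕ → ℕ → Prop) : IsEvent b d0 P univ :=
  ⟨0, fun _ _ _ => ⟨∅, Finset.empty_subset _, fun _ _ _ => trivial⟩⟩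

theorem MultIndep.pow_ne {n m : ℕ} (h : MultIndep n m) {k : ℕ} (hk : 1 ≤ k) (p q : ℕ) (hp : 1 ≤ p)
    (hq : 1 ≤ q) : ((n ^ k) ^ 2) ^ p ≠ m ^ q := by
  intro heq
  refine h ⟨k * 2 * p, q, ?_, hq, ?_⟩
  · exact Nat.mul_pos (Nat.mul_pos hk two_pos) hp
  · rw [pow_mul, pow_mul]; exact_mod_cast heq

/-- The events of visiting the members of countable bases of the circle and of `X2`. -/
def visitEvents (n : ℕ) (t : ℕ → ℝ) : Set (Set ℝ) :=
  insert univ ((⋃ m ∈ {m : ℕ | 2 ≤ m ∧ MultIndep n m}, (fun V : Set Circ =>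
      {x : ℝ | ∃ k : ℕ, (((m : ℝ) ^ k * x : ℝ) : Circ) ∈ V}) ''
        TopologicalSpace.countableBasis Circ) ∪
    ⋃ i : ℕ, (fun U : Set X2 => {x : ℝ | ∃ k : ℕ, g2 (t i) ^ k • h2 x ∈ U}) ''
      TopologicalSpace.countableBasis X2)

theorem countable_visitEvents (n : ℕ) (t : ℕ → ℝ) : (visitEvents n t).Countable :=
  (((to_countable _).biUnion fun _ _ => (TopologicalSpace.countable_countableBasis _).image _).union
    (countable_iUnion fun _ => (TopologicalSpace.countable_countableBasis _).image _)).insert _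

theorem isEvent_of_mem_visitEvents {n : ℕ} (hn : 2 ≤ n) {t : ℕ → ℝ} (ht : ∀ i, 0 < t i) {k : ℕ}
    (hk : 1 ≤ k) (d0 : ℕ) {A : Set ℝ} (hA : A ∈ visitEvents n t) :
    IsEvent ((n ^ k) ^ 2) d0 (ThickNode (n ^ k)) A := by
  have hβ : 2 ≤ n ^ k := hn.trans (Nat.le_self_pow (by omega) n)
  rcases hA with rfl | hA | hA
  · exact isEvent_univ _ _ _
  · simp only [mem_iUnion] at hA
    obtain ⟨m, ⟨hm, hmn⟩, V, hV, rfl⟩ := hA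
    exact isEvent_iterate_mem hm (by nlinarith) (hmn.pow_ne hk) _
      (TopologicalSpace.isOpen_of_mem_countableBasis hV)
      (TopologicalSpace.nonempty_of_mem_countableBasis hV)
  · simp only [mem_iUnion] at hA
    obtain ⟨i, U, hU, rfl⟩ := hA
    exact isEvent_flow hβ d0 (ht i) (TopologicalSpace.isOpen_of_mem_countableBasis hU)
      (TopologicalSpace.nonempty_of_mem_countableBasis hU)

theorem closure_range_eq_univ {X : Type*} [TopologicalSpace X] [SecondCountableTopology X]
    {f : ℕ → X} (h : ∀ V ∈ TopologicalSpace.countableBasis X, ∃ k, f k ∈ V) :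
    closure (Set.range f) = univ := by
  rw [← dense_iff_closure_eq, (TopologicalSpace.isBasis_countableBasis X).dense_iff]
  intro V hV _
  obtain ⟨k, hk⟩ := h V hV
  exact ⟨f k, hk, mem_range_self k⟩

theorem dense_flows_dense_times_m_nondense_times_n (n : ℤ) (hn : 2 ≤ n)
    (S : Set Circ) (hS : S.Finite) (t : ℕ → ℝ) (ht : ∀ i, 0 < t i) :
    dimH ({s : ℝ |
        closure (Set.range fun k : ℕ => (fun x : Circ => n • x)^[k] (s : Circ)) ∩ S = ∅}
      ∩ (⋂ m ∈ {m : ℕ | 2 ≤ m ∧ MultIndep n m},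
          {s : ℝ |
            closure (Set.range fun k : ℕ => (fun x : Circ => (m : ℤ) • x)^[k] (s : Circ))
              = Set.univ})
      ∩ (⋂ i : ℕ,
          {s : ℝ | closure (Set.range fun k : ℕ => (g2 (t i)) ^ k • h2 s) = Set.univ}))
      = 1 := by
  lift n to ℕ using by omega
  have hn' : 2 ≤ n := by exact_mod_cast hn
  refine le_antisymm ((dimH_mono (subset_univ _)).trans Real.dimH_univ.le) ?_
  obtain ⟨V, hV⟩ := (countable_visitEvents n t).exists_eq_range ⟨_, mem_insert _ _⟩
  have hVmem : ∀ r, V r ∈ visitEvents n t := fun r => hV ▸ mem_range_self r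
  refine le_of_forall_lt fun a ha => ?_
  obtain ⟨α, hα0, hα⟩ := ENNReal.lt_iff_exists_real_btwn.1 ha
  have hα1 : α < 1 := by
    have := hα.2
    rwa [← ENNReal.ofReal_one, ENNReal.ofReal_lt_ofReal_iff one_pos] at this
  have hαpos : 0 < α := ENNReal.ofReal_pos.1 (pos_of_gt hα.1)
  refine hα.1.trans_le ((le_dimH_avoiding hn' hS hαpos hα1 V fun k d0 hk r =>
    isEvent_of_mem_visitEvents hn' ht hk d0 (hVmem r)).trans (dimH_mono ?_))
  rintro s ⟨hsS, hs⟩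
  have hmem : ∀ A ∈ visitEvents n t, s ∈ A := fun A hA => by
    rw [hV] at hA
    obtain ⟨r, rfl⟩ := hA
    exact mem_iInter.1 hs r
  refine ⟨⟨hsS, mem_iInter₂.2 fun m hm => closure_range_eq_univ fun V hV => ?_⟩,
    mem_iInter.2 fun i => closure_range_eq_univ fun U hU => ?_⟩
  · obtain ⟨k, hk⟩ := hmem _ (Or.inr (Or.inl (mem_iUnion₂.2 ⟨m, hm, V, hV, rfl⟩)))
    refine ⟨k, ?_⟩
    rw [iterate_zsmul_coe, Int.cast_natCast]
    exact hk
  · exact hmem _ (Or.inr (Or.inr (mem_iUnion.2 ⟨i, U, hU, rfl⟩)))
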